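/- arXiv:1306.4628 — 2 statements merged into one kernel-verified Lean document; each statement's English description precedes it below -/
import Mathlib

section
/- For j = 0, 1, 2 let p_j(n,k) denote the number of permutations of {1,…,n} of genus 1 having exactly j back points and exactly k cycles. Then for all integers n ≥ 2 and k ≥ 1: 3·p₁(n,k) = C(n,2)·C(n−2,k)·C(n−2,k−1) and 6·p₂(n,k) = C(n,2)·C(n−2,k+1)·C(n−2,k−1), where C(a,b) denotes the binomial coefficient. -/
/-- The setoid on `Fin n` whose equivalence classes are the cycles (orbits) of the
permutation `α`. -/
def cycleSetoid {n : ℕ} (α : Equiv.Perm (Fin n)) : Setoid (Fin n) :=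
  ⟨α.SameCycle,
    ⟨fun x => Equiv.Perm.SameCycle.refl α x, fun h => h.symm, fun h h' => h.trans h'⟩⟩

/-- `zPerm α` is the number of cycles of `α`, i.e. the number of orbits of `⟨α⟩` acting
on `Fin n` (fixed points counting as cycles). -/
noncomputable def zPerm {n : ℕ} (α : Equiv.Perm (Fin n)) : ℕ :=
  Nat.card (Quotient (cycleSetoid α))

/-- `α` has genus one, i.e. `z(α) + z(α⁻¹ ∘ ζₙ) = n - 1` (written additively).
Here `finRotate n` plays the role of the cycle `ζₙ = (1, 2, …, n)`. -/
def IsGenusOne {n : ℕ} (α : Equiv.Perm (Fin n)) : Prop :=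
  zPerm α + zPerm (α⁻¹ * finRotate n) + 2 = n + 1

/-- `i` is a back point of `α`: `α i < i` and `α i` is not the smallest element of the
cycle (orbit) of `α` containing `i`. -/
def IsBackPoint {n : ℕ} (α : Equiv.Perm (Fin n)) (i : Fin n) : Prop :=
  α i < i ∧ ∃ j : Fin n, α.SameCycle i j ∧ j < α i

/-- The number of back points of `α`. -/
noncomputable def backPointCount {n : ℕ} (α : Equiv.Perm (Fin n)) : ℕ :=
  Nat.card {i : Fin n // IsBackPoint α i}

/-- `α` is the permutation associated with a set partition (each block of the partition
is a cycle of `α`, traversed in increasing order); equivalently, `α` has no back point. -/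
def IsPartitionPerm {n : ℕ} (α : Equiv.Perm (Fin n)) : Prop :=
  ∀ i : Fin n, ¬ IsBackPoint α i

namespace GenusOne

open Equiv

/-- The complementary permutation `α⁻¹ ∘ ζₙ`. -/
def dual {n : ℕ} (α : Perm (Fin n)) : Perm (Fin n) := α⁻¹ * finRotate n

/-- The number of exceedances `i < α i`. -/
def exc {n : ℕ} (α : Perm (Fin n)) : ℕ := (Finset.univ.filter fun i => i < α i).card

lemma dual_apply {n : ℕ} (α : Perm (Fin n)) (i : Fin n) : dual α i = α⁻¹ (finRotate n i) := rfl

lemma dual_apply_eq_iff {n : ℕ} (α : Perm (Fin n)) (i j : Fin n) :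
    dual α i = j ↔ α j = finRotate n i := by
  rw [dual_apply, Perm.inv_eq_iff_eq, eq_comm]

lemma apply_dual {n : ℕ} (α : Perm (Fin n)) (i : Fin n) : α (dual α i) = finRotate n i :=
  (dual_apply_eq_iff α i _).1 rfl

lemma val_finRotate {n : ℕ} (i : Fin n) :
    (finRotate n i : ℕ) = if (i : ℕ) + 1 = n then 0 else (i : ℕ) + 1 := by
  cases n with
  | zero => exact i.elim0
  | succ n =>
    rw [coe_finRotate]
    simp only [Fin.ext_iff, Fin.val_last, Nat.add_right_cancel_iff]

/-- Removing the point `i` from its cycle, together with the value at `i`. -/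
def delEquiv {n : ℕ} (i : Fin (n + 1)) : Perm (Fin (n + 1)) ≃ Fin (n + 1) × Perm (Fin n) :=
  ((finSuccEquiv' i).permCongr.trans Perm.decomposeOption).trans
    ((finSuccEquiv' i).symm.prodCongr (Equiv.refl _))

/-- The permutation obtained from `α` by removing the point `i` from its cycle. -/
def del {n : ℕ} (i : Fin (n + 1)) (α : Perm (Fin (n + 1))) : Perm (Fin n) := (delEquiv i α).2

lemma delEquiv_fst {n : ℕ} (i : Fin (n + 1)) (α : Perm (Fin (n + 1))) :
    (delEquiv i α).1 = α i := by
  simp [delEquiv, Equiv.permCongr_apply]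

lemma delEquiv_eq {n : ℕ} (i : Fin (n + 1)) (α : Perm (Fin (n + 1))) :
    delEquiv i α = (α i, del i α) := Prod.ext (delEquiv_fst i α) rfl

lemma succAbove_del {n : ℕ} (i : Fin (n + 1)) (α : Perm (Fin (n + 1))) (a : Fin n) :
    i.succAbove (del i α a) = swap i (α i) (α (i.succAbove a)) := by
  have h1 : α (i.succAbove a) ≠ α i := fun h => Fin.succAbove_ne i a (α.injective h)
  set e := (finSuccEquiv' i).permCongr α with he
  have hd : del i α = removeNone e := rfl
  have key : (finSuccEquiv' i).symm (some (del i α a)) = i.succAbove (del i α a) := rfl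
  rw [← key, hd]
  by_cases h : α (i.succAbove a) = i
  · rw [removeNone_none, h, swap_apply_left]
    · simp [he, Equiv.permCongr_apply]
    · simp [he, Equiv.permCongr_apply, h]
  · rw [removeNone_some, swap_apply_of_ne_of_ne h h1]
    · simp [he, Equiv.permCongr_apply]
    · obtain ⟨x, hx⟩ := Fin.exists_succAbove_eq h
      exact ⟨x, by simp [he, Equiv.permCongr_apply, ← hx]⟩

lemma succAbove_del_of_ne {n : ℕ} {i : Fin (n + 1)} {α : Perm (Fin (n + 1))} {a : Fin n}
    (h : α (i.succAbove a) ≠ i) : i.succAbove (del i α a) = α (i.succAbove a) := by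
  rw [succAbove_del, swap_apply_of_ne_of_ne h]
  exact fun h => Fin.succAbove_ne i a (α.injective h)

lemma succAbove_del_of_eq {n : ℕ} {i : Fin (n + 1)} {α : Perm (Fin (n + 1))} {a : Fin n}
    (h : α (i.succAbove a) = i) : i.succAbove (del i α a) = α i := by
  rw [succAbove_del, h, swap_apply_left]

lemma eq_del_iff {n : ℕ} (i : Fin (n + 1)) (α : Perm (Fin (n + 1))) (δ : Perm (Fin n)) :
    δ = del i α ↔ ∀ a, i.succAbove (δ a) = swap i (α i) (α (i.succAbove a)) := by
  constructor
  · rintro rfl a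
    exact succAbove_del i α a
  · intro h
    ext a : 1
    apply Fin.succAbove_right_injective (p := i)
    rw [h, succAbove_del]

lemma del_mul_of_right_fixed {n : ℕ} {i : Fin (n + 1)} (σ : Perm (Fin (n + 1)))
    {τ : Perm (Fin (n + 1))} (h : τ i = i) : del i (σ * τ) = del i σ * del i τ := by
  symm
  rw [eq_del_iff]
  intro a
  have h1 : τ (i.succAbove a) ≠ i := fun h2 => Fin.succAbove_ne i a (τ.injective (h2.trans h.symm))
  rw [Perm.mul_apply, succAbove_del, succAbove_del_of_ne h1, Perm.mul_apply, Perm.mul_apply, h]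

lemma del_mul_of_left_fixed {n : ℕ} {i : Fin (n + 1)} {σ : Perm (Fin (n + 1))}
    (τ : Perm (Fin (n + 1))) (h : σ i = i) : del i (σ * τ) = del i σ * del i τ := by
  symm
  rw [eq_del_iff]
  intro a
  have h1 : σ (i.succAbove (del i τ a)) ≠ i :=
    fun h2 => Fin.succAbove_ne i _ (σ.injective (h2.trans h.symm))
  rw [Perm.mul_apply, succAbove_del_of_ne h1, succAbove_del, Perm.mul_apply, Perm.mul_apply]
  conv_rhs => rw [← h, swap_apply_apply]
  simp [h]

lemma del_inv {n : ℕ} (i : Fin (n + 1)) (α : Perm (Fin (n + 1))) :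
    del i α⁻¹ = (del i α)⁻¹ := by
  rw [eq_inv_iff_mul_eq_one]
  ext a : 1
  apply Fin.succAbove_right_injective (p := i)
  rw [Perm.mul_apply, Perm.one_apply]
  by_cases h : α (i.succAbove a) = i
  · have h1 : α⁻¹ i = i.succAbove a := by rw [Perm.inv_eq_iff_eq, h]
    rw [succAbove_del_of_eq, h1]
    rw [succAbove_del_of_eq h, Perm.inv_eq_iff_eq]
  · rw [succAbove_del_of_ne] <;> rw [succAbove_del_of_ne h]
    · simp
    rw [Ne, Perm.inv_eq_iff_eq, α.injective.eq_iff]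
    exact Fin.succAbove_ne i a

lemma del_finRotate {n : ℕ} (i : Fin (n + 1)) : del i (finRotate (n + 1)) = finRotate n := by
  symm
  rw [eq_del_iff]
  intro a
  have hi := i.2
  have ha := a.2
  have hs : ∀ b : Fin n, (i.succAbove b : ℕ) = if (b : ℕ) < i then (b : ℕ) else b + 1 := by
    intro b
    simp only [Fin.succAbove, Fin.lt_def]
    split_ifs <;> simp_all
  have h2 := hs a
  have h3 := hs (finRotate n a)
  have h4 := val_finRotate a
  have h5 := val_finRotate i
  have h6 := val_finRotate (i.succAbove a)
  have h7 := (Fin.succAbove_ne i a)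
  rw [swap_apply_def]
  split_ifs with c1 c2
  · rw [Fin.ext_iff] at c1 ⊢
    grind
  · exact absurd ((finRotate _).injective c2) h7
  · rw [Fin.ext_iff] at c1 c2 ⊢
    grind

lemma dual_del_of_fixed {n : ℕ} {i : Fin (n + 1)} {α : Perm (Fin (n + 1))} (h : α i = i) :
    dual (del i α) = del i (dual α) := by
  rw [dual, dual, del_mul_of_left_fixed, del_inv, del_finRotate]
  rw [Perm.inv_eq_iff_eq, h]

lemma dual_del_of_dual_fixed {n : ℕ} {i : Fin (n + 1)} {α : Perm (Fin (n + 1))}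
    (h : dual α i = i) : dual (del i α) = del i (dual α) := by
  have h1 : finRotate (n + 1) = α * dual α := by simp [dual]
  have h2 := del_mul_of_right_fixed α h
  rw [← h1, del_finRotate] at h2
  rw [dual, h2]
  simp

lemma sameCycle_del_iff {n : ℕ} (i : Fin (n + 1)) (α : Perm (Fin (n + 1))) (a b : Fin n) :
    (del i α).SameCycle a b ↔ α.SameCycle (i.succAbove a) (i.succAbove b) := by
  constructor
  · intro h
    obtain ⟨k, rfl⟩ := h.exists_nat_pow_eq
    clear h
    induction k with
    | zero => exact Perm.SameCycle.refl _ _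
    | succ k ih =>
      refine ih.trans ?_
      rw [pow_succ', Perm.mul_apply]
      set c := (del i α ^ k) a
      by_cases h : α (i.succAbove c) = i
      · have h1 : α i = α (α (i.succAbove c)) := by rw [h]
        rw [succAbove_del_of_eq h, h1, Perm.sameCycle_apply_right, Perm.sameCycle_apply_right]
      · rw [succAbove_del_of_ne h, Perm.sameCycle_apply_right]
  · intro h
    obtain ⟨k, hk⟩ := h.exists_nat_pow_eq
    clear h
    induction k using Nat.strong_induction_on generalizing a with
    | _ k ih =>
      rcases k with _ | k
      · rw [pow_zero, Perm.one_apply] at hk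
        rw [Fin.succAbove_right_injective hk]
      · rw [← Perm.sameCycle_apply_left]
        by_cases h : α (i.succAbove a) = i
        · rcases k with _ | k
          · rw [zero_add, pow_one, h] at hk
            exact absurd hk.symm (Fin.succAbove_ne i b)
          · refine ih k (by omega) _ ?_
            rw [succAbove_del_of_eq h, ← hk, pow_succ, pow_succ, Perm.mul_apply, Perm.mul_apply, h]
        · refine ih k (by omega) _ ?_
          rw [succAbove_del_of_ne h, ← hk, pow_succ, Perm.mul_apply]

/-- The map on cycles induced by the inclusion that skips `i`. -/
def cycleMap {n : ℕ} (i : Fin (n + 1)) (α : Perm (Fin (n + 1))) :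
    Quotient (cycleSetoid (del i α)) → Quotient (cycleSetoid α) :=
  Quotient.map i.succAbove fun a b h => (sameCycle_del_iff i α a b).1 h

lemma cycleMap_injective {n : ℕ} (i : Fin (n + 1)) (α : Perm (Fin (n + 1))) :
    Function.Injective (cycleMap i α) := by
  intro x y
  induction x using Quotient.inductionOn
  induction y using Quotient.inductionOn
  intro h
  exact Quotient.sound ((sameCycle_del_iff i α _ _).2 (Quotient.exact h))

lemma zPerm_del_of_ne {n : ℕ} {i : Fin (n + 1)} {α : Perm (Fin (n + 1))} (h : α i ≠ i) :
    zPerm (del i α) = zPerm α := by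
  refine Nat.card_congr (Equiv.ofBijective _ ⟨cycleMap_injective i α, ?_⟩)
  intro x
  induction x using Quotient.inductionOn with
  | _ x =>
    by_cases hx : x = i
    · obtain ⟨c, hc⟩ := Fin.exists_succAbove_eq h
      refine ⟨⟦c⟧, Quotient.sound ?_⟩
      change α.SameCycle _ _
      rw [hc, hx, Perm.sameCycle_apply_left]
    · obtain ⟨c, hc⟩ := Fin.exists_succAbove_eq hx
      exact ⟨⟦c⟧, by rw [← hc]; rfl⟩

lemma zPerm_del_of_eq {n : ℕ} {i : Fin (n + 1)} {α : Perm (Fin (n + 1))} (h : α i = i) :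
    zPerm α = zPerm (del i α) + 1 := by
  have h1 : Set.range (cycleMap i α) = {(⟦i⟧ : Quotient (cycleSetoid α))}ᶜ := by
    ext x
    induction x using Quotient.inductionOn with
    | _ x =>
      simp only [Set.mem_range, Set.mem_compl_iff, Set.mem_singleton_iff]
      constructor
      · rintro ⟨y, hy⟩ hx
        rw [hx] at hy
        induction y using Quotient.inductionOn with
        | _ y =>
          have h2 : α.SameCycle (i.succAbove y) i := Quotient.exact hy
          obtain ⟨k, hk⟩ := h2.symm
          rw [Perm.zpow_apply_eq_self_of_apply_eq_self h] at hk
          exact Fin.succAbove_ne i y hk.symm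
      · intro hx
        have hx : x ≠ i := fun h => hx (by rw [h])
        obtain ⟨c, hc⟩ := Fin.exists_succAbove_eq hx
        exact ⟨⟦c⟧, by rw [← hc]; rfl⟩
  have h2 := Set.ncard_add_ncard_compl {(⟦i⟧ : Quotient (cycleSetoid α))}
  rw [← h1, Set.ncard_singleton, ← Set.image_univ,
    Set.ncard_image_of_injective _ (cycleMap_injective i α), Set.ncard_univ] at h2
  rw [zPerm, zPerm, ← h2, add_comm]

lemma exc_eq_sum {n : ℕ} (α : Perm (Fin n)) : exc α = ∑ i, if i < α i then 1 else 0 := by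
  rw [exc, Finset.card_filter]

lemma lt_del_iff {n : ℕ} {i : Fin (n + 1)} {α : Perm (Fin (n + 1))} {a : Fin n}
    (h : α (i.succAbove a) ≠ i) : a < del i α a ↔ i.succAbove a < α (i.succAbove a) := by
  rw [← succAbove_del_of_ne h, Fin.succAbove_lt_succAbove_iff]

lemma exc_del_of_fixed {n : ℕ} {i : Fin (n + 1)} {α : Perm (Fin (n + 1))} (h : α i = i) :
    exc (del i α) = exc α := by
  rw [exc_eq_sum, exc_eq_sum, Fin.sum_univ_succAbove _ i, if_neg (by simp [h]), zero_add]
  refine Finset.sum_congr rfl fun a _ => ?_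
  have h1 : α (i.succAbove a) ≠ i := fun h2 => Fin.succAbove_ne i a (α.injective (h2.trans h.symm))
  exact if_congr (lt_del_iff h1) rfl rfl

lemma exc_del_of_dual_fixed {n : ℕ} {i : Fin (n + 2)} {α : Perm (Fin (n + 2))}
    (h : dual α i = i) : exc α = exc (del i α) + 1 := by
  rw [dual_apply_eq_iff] at h
  have hi := val_finRotate i
  rw [← h] at hi
  have hne : α i ≠ i := fun h2 => by
    rw [h2] at hi
    split_ifs at hi <;> omega
  rw [exc_eq_sum, exc_eq_sum, Fin.sum_univ_succAbove _ i]
  by_cases hl : (i : ℕ) + 1 = n + 2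
  · rw [if_pos hl] at hi
    rw [if_neg (by rw [Fin.lt_def]; omega), zero_add]
    obtain ⟨a, ha⟩ := Fin.exists_succAbove_eq (x := α⁻¹ i) (y := i)
      (by rw [Ne, Perm.inv_eq_iff_eq]; exact hne.symm)
    have ha : α (i.succAbove a) = i := by rw [ha]; simp
    trans (∑ b, if b < del i α b then 1 else 0) + ∑ b, if a = b then 1 else 0
    swap
    · simp
    rw [← Finset.sum_add_distrib]
    refine Finset.sum_congr rfl fun b _ => ?_
    by_cases hb : a = b
    · subst hb
      have h2 := Fin.succAbove_ne i a
      rw [ha, if_pos, if_neg, if_pos rfl]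
      · rw [← Fin.succAbove_lt_succAbove_iff (p := i), succAbove_del_of_eq ha, Fin.lt_def]
        omega
      · rw [Fin.lt_def]
        rw [Ne, Fin.ext_iff] at h2
        omega
    · have h1 : α (i.succAbove b) ≠ i := fun h2 =>
        hb (Fin.succAbove_right_injective (α.injective (ha.trans h2.symm)))
      rw [if_neg hb, add_zero]
      exact if_congr (lt_del_iff h1).symm rfl rfl
  · rw [if_neg hl] at hi
    rw [if_pos (by rw [Fin.lt_def]; omega), add_comm]
    congr 1
    refine Finset.sum_congr rfl fun a _ => ?_
    by_cases h1 : α (i.succAbove a) = i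
    · have h2 := Fin.succAbove_ne i a
      rw [Ne, Fin.ext_iff] at h2
      refine if_congr ?_ rfl rfl
      rw [h1, ← Fin.succAbove_lt_succAbove_iff (p := i), succAbove_del_of_eq h1, Fin.lt_def,
        Fin.lt_def]
      omega
    · exact if_congr (lt_del_iff h1).symm rfl rfl

lemma exc_dual {n : ℕ} (α : Perm (Fin (n + 1))) : exc (dual α) + exc α = n := by
  have h1 : exc (dual α) + 1 = ∑ i, if α i ≤ i then 1 else 0 := by
    rw [← Equiv.sum_comp (dual α), exc_eq_sum]
    trans (∑ b, if b < dual α b then 1 else 0) + ∑ b, if Fin.last n = b then 1 else 0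
    · simp
    rw [← Finset.sum_add_distrib]
    refine Finset.sum_congr rfl fun i _ => ?_
    rw [apply_dual]
    have h2 := val_finRotate i
    have h3 := (dual α i).2
    simp only [Fin.lt_def, Fin.le_def, Fin.ext_iff, Fin.val_last]
    split_ifs at h2 ⊢ <;> omega
  have h2 : (∑ i, if α i ≤ i then 1 else 0) + exc α = n + 1 := by
    rw [exc_eq_sum, ← Finset.sum_add_distrib]
    have : ∀ i : Fin (n + 1), ((if α i ≤ i then 1 else 0) + if i < α i then 1 else 0) = 1 := by
      intro i
      split_ifs <;> simp_all
      omega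
    simp [this]
  omega

/-- The point `i` is the smallest element of its cycle. -/
def IsCycleMin {n : ℕ} (α : Perm (Fin n)) (i : Fin n) : Prop := ∀ j, α.SameCycle i j → i ≤ j

lemma card_isCycleMin {n : ℕ} (α : Perm (Fin n)) : Nat.card {i // IsCycleMin α i} = zPerm α := by
  refine Nat.card_congr (Equiv.ofBijective (fun i => ⟦i.1⟧) ⟨?_, ?_⟩)
  · rintro ⟨i, hi⟩ ⟨j, hj⟩ h
    have h : α.SameCycle i j := Quotient.exact h
    exact Subtype.ext (le_antisymm (hi j h) (hj i h.symm))
  · intro x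
    induction x using Quotient.inductionOn with
    | _ x =>
      obtain ⟨m, hm, hmin⟩ := Set.exists_min_image {j | α.SameCycle x j} id (Set.toFinite _)
        ⟨x, Perm.SameCycle.refl _ _⟩
      exact ⟨⟨m, fun j hj => hmin j (hm.trans hj)⟩, Quotient.sound (Perm.SameCycle.symm hm)⟩

lemma IsCycleMin.le_apply {n : ℕ} {α : Perm (Fin n)} {i : Fin n} (h : IsCycleMin α i) :
    i ≤ α i := h _ (by simp [Perm.SameCycle.refl])

open Classical in
lemma zPerm_eq_sum {n : ℕ} (α : Perm (Fin n)) :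
    zPerm α = ∑ i, if IsCycleMin α i then 1 else 0 := by
  rw [← card_isCycleMin, Nat.card_eq_fintype_card, Fintype.card_subtype, Finset.card_filter]

lemma zPerm_le_exc {n : ℕ} {α : Perm (Fin n)} (h : ∀ i, α i ≠ i) : zPerm α ≤ exc α := by
  classical
  rw [zPerm_eq_sum, exc_eq_sum]
  refine Finset.sum_le_sum fun i _ => ?_
  split_ifs with h1 h2
  · exact le_rfl
  · exact absurd (lt_of_le_of_ne h1.le_apply (h i).symm) h2
  · exact Nat.zero_le _
  · exact le_rfl

lemma backPointCount_add {n : ℕ} (α : Perm (Fin n)) :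
    backPointCount α + zPerm α + exc α = n := by
  classical
  rw [zPerm_eq_sum, exc_eq_sum, backPointCount, Nat.card_eq_fintype_card, Fintype.card_subtype,
    Finset.card_filter, ← Equiv.sum_comp α (fun i => if IsCycleMin α i then 1 else 0),
    ← Finset.sum_add_distrib, ← Finset.sum_add_distrib]
  have : ∀ i : Fin n, ((if IsBackPoint α i then 1 else 0) + (if IsCycleMin α (α i) then 1 else 0)
      + if i < α i then 1 else 0) = 1 := by
    intro i
    have hmin : IsCycleMin α (α i) ↔ ¬ ∃ j, α.SameCycle i j ∧ j < α i := by
      simp [IsCycleMin]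
    rcases lt_trichotomy i (α i) with h | h | h
    · have h1 : ¬ IsBackPoint α i := fun h2 => lt_asymm h h2.1
      have h2 : ¬ IsCycleMin α (α i) := fun h2 => absurd (h2 i (by simp [Perm.SameCycle.refl]))
        (not_le.2 h)
      simp [h1, h2, h]
    · have h1 : ¬ IsBackPoint α i := fun h2 => absurd h2.1 (by rw [← h]; exact lt_irrefl _)
      have h2 : IsCycleMin α (α i) := by
        intro j hj
        rw [Perm.sameCycle_apply_left] at hj
        obtain ⟨k, hk⟩ := hj
        rw [Perm.zpow_apply_eq_self_of_apply_eq_self h.symm] at hk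
        rw [← hk, ← h]
      have h3 : ¬ i < α i := by rw [← h]; exact lt_irrefl _
      simp [h1, h2, h3]
    · have h3 : ¬ i < α i := not_lt.2 h.le
      by_cases h2 : IsCycleMin α (α i)
      · have h1 : ¬ IsBackPoint α i := fun h4 => hmin.1 h2 h4.2
        simp [h1, h2, h3]
      · have h1 : IsBackPoint α i := ⟨h, not_not.1 fun h4 => h2 (hmin.2 h4)⟩
        simp [h1, h2, h3]
  simp [this]

lemma zPerm_conj {n : ℕ} (τ α : Perm (Fin n)) : zPerm (τ * α * τ⁻¹) = zPerm α := by
  refine (Nat.card_congr (Quotient.congr τ fun a b => ?_)).symm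
  change α.SameCycle a b ↔ (τ * α * τ⁻¹).SameCycle (τ a) (τ b)
  rw [Perm.sameCycle_conj]
  simp

lemma zPerm_pos {n : ℕ} (α : Perm (Fin (n + 1))) : 0 < zPerm α := by
  have : Nonempty (Quotient (cycleSetoid α)) := ⟨⟦0⟧⟩
  exact Nat.card_pos

/-- The permutations with `k` cycles, `k'` complementary cycles and `exc α + j = k' + 1`, whose
fixed points satisfy `A` and whose complementary fixed points satisfy `D`. -/
def family (j n k k' : ℕ) (A D : Fin n → Prop) : Set (Perm (Fin n)) :=
  {α | zPerm α = k ∧ zPerm (dual α) = k' ∧ exc α + j = k' + 1 ∧ (∀ i, α i = i → A i) ∧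
    ∀ i, dual α i = i → D i}

lemma family_zero_left (j n k' : ℕ) (A D : Fin (n + 1) → Prop) : family j (n + 1) 0 k' A D = ∅ := by
  ext α
  have := zPerm_pos α
  simp only [family, Set.mem_ofPred_eq, Set.mem_empty_iff_false, iff_false]
  omega

lemma family_zero_right (j n k : ℕ) (A D : Fin (n + 1) → Prop) :
    family j (n + 1) k 0 A D = ∅ := by
  ext α
  have := zPerm_pos (dual α)
  simp only [family, Set.mem_ofPred_eq, Set.mem_empty_iff_false, iff_false]
  omega

lemma ncard_del {n : ℕ} (i v : Fin (n + 1)) (S : Set (Perm (Fin (n + 1)))) (T : Set (Perm (Fin n)))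
    (h : ∀ α, α i = v → (α ∈ S ↔ del i α ∈ T)) : (S ∩ {α | α i = v}).ncard = T.ncard := by
  refine Set.ncard_congr (fun α _ => del i α) ?_ ?_ ?_
  · rintro α ⟨h1, h2⟩
    exact (h α h2).1 h1
  · rintro α β ⟨_, h1⟩ ⟨_, h2⟩ h3
    apply (delEquiv i).injective
    rw [delEquiv_eq, delEquiv_eq]
    exact Prod.ext (h1.trans h2.symm) h3
  · intro δ hδ
    have h1 := delEquiv_eq i ((delEquiv i).symm (v, δ))
    rw [Equiv.apply_symm_apply, Prod.ext_iff] at h1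
    have h2 : del i ((delEquiv i).symm (v, δ)) = δ := h1.2.symm
    refine ⟨(delEquiv i).symm (v, δ), ⟨(h _ h1.1.symm).2 ?_, h1.1.symm⟩, h2⟩
    rwa [h2]

lemma finRotate_ne {n : ℕ} (i : Fin (n + 2)) : finRotate (n + 2) i ≠ i := by
  have h := val_finRotate i
  intro h1
  rw [h1] at h
  split_ifs at h <;> omega

lemma del_apply_eq_self_iff {n : ℕ} {i : Fin (n + 1)} {α : Perm (Fin (n + 1))} {a : Fin n} :
    del i α a = a ↔ α (i.succAbove a) = i.succAbove a ∨
      (α (i.succAbove a) = i ∧ α i = i.succAbove a) := by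
  rw [← (Fin.succAbove_right_injective (p := i)).eq_iff]
  have h1 := Fin.succAbove_ne i a
  by_cases h : α (i.succAbove a) = i
  · rw [succAbove_del_of_eq h, h]
    simp [h1.symm]
  · rw [succAbove_del_of_ne h]
    simp [h]

lemma mem_family_iff_of_fixed {j n k k' : ℕ} {i : Fin (n + 2)} {A D : Fin (n + 2) → Prop}
    {A' D' : Fin (n + 1) → Prop} (hi : A i) (hA : ∀ a, A (i.succAbove a) ↔ A' a)
    (hD : ∀ a, finRotate _ (i.succAbove a) ≠ i → (D (i.succAbove a) ↔ D' a))
    (hD' : ∀ a, finRotate _ (i.succAbove a) = i → D' a) (α : Perm (Fin (n + 2))) (h : α i = i) :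
    α ∈ family j (n + 2) (k + 1) k' A D ↔ del i α ∈ family j (n + 1) k k' A' D' := by
  have h0 : dual α i ≠ i := fun h1 => by
    rw [dual_apply_eq_iff, h] at h1
    exact finRotate_ne i h1.symm
  simp only [family, Set.mem_ofPred_eq, zPerm_del_of_eq h, dual_del_of_fixed h,
    zPerm_del_of_ne h0, exc_del_of_fixed h, Nat.add_right_cancel_iff]
  refine and_congr_right fun _ => and_congr_right fun _ => and_congr_right fun _ =>
    and_congr ?_ ?_
  · rw [Fin.forall_iff_succAbove i]
    refine ⟨fun h1 a ha => ?_, fun h1 => ⟨fun _ => hi, fun a ha => ?_⟩⟩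
    · rw [← hA]
      apply h1.2
      rcases del_apply_eq_self_iff.1 ha with h2 | h2
      · exact h2
      · exact absurd (h2.2.symm.trans h) (Fin.succAbove_ne i a)
    · rw [hA]
      exact h1 a (del_apply_eq_self_iff.2 (Or.inl ha))
  · rw [Fin.forall_iff_succAbove i]
    refine ⟨fun h1 a ha => ?_, fun h1 => ⟨fun h2 => absurd h2 h0, fun a ha => ?_⟩⟩
    · by_cases h3 : finRotate _ (i.succAbove a) = i
      · exact hD' a h3
      · rw [← hD a h3]
        apply h1.2
        rcases del_apply_eq_self_iff.1 ha with h2 | h2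
        · exact h2
        · rw [dual_apply_eq_iff, h] at h2
          exact absurd h2.1.symm h3
    · rw [hD a]
      · exact h1 a (del_apply_eq_self_iff.2 (Or.inl ha))
      · intro h3
        rw [dual_apply_eq_iff, h3, ← h] at ha
        rw [h] at ha
        exact Fin.succAbove_ne i a (α.injective (ha.trans h.symm))

lemma mem_family_iff_of_dual_fixed {j n k k' : ℕ} {i : Fin (n + 2)} {A D : Fin (n + 2) → Prop}
    {A' D' : Fin (n + 1) → Prop} (hi : D i) (hD : ∀ a, D (i.succAbove a) ↔ D' a)
    (hA : ∀ a, finRotate _ i ≠ i.succAbove a → (A (i.succAbove a) ↔ A' a))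
    (hA' : ∀ a, finRotate _ i = i.succAbove a → A' a) (α : Perm (Fin (n + 2)))
    (h : α i = finRotate _ i) :
    α ∈ family j (n + 2) k (k' + 1) A D ↔ del i α ∈ family j (n + 1) k k' A' D' := by
  have h' : dual α i = i := by rwa [dual_apply_eq_iff]
  have h0 : α i ≠ i := by
    rw [h]
    exact finRotate_ne i
  simp only [family, Set.mem_ofPred_eq, zPerm_del_of_eq h', dual_del_of_dual_fixed h',
    zPerm_del_of_ne h0, exc_del_of_dual_fixed h', Nat.add_right_cancel_iff]
  refine and_congr_right fun _ => and_congr_right fun _ => and_congr (by omega)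
    (and_congr ?_ ?_)
  · rw [Fin.forall_iff_succAbove i]
    refine ⟨fun h1 a ha => ?_, fun h1 => ⟨fun h2 => absurd h2 h0, fun a ha => ?_⟩⟩
    · by_cases h3 : finRotate _ i = i.succAbove a
      · exact hA' a h3
      · rw [← hA a h3]
        apply h1.2
        rcases del_apply_eq_self_iff.1 ha with h2 | h2
        · exact h2
        · exact absurd (h.symm.trans h2.2) h3
    · rw [hA a]
      · exact h1 a (del_apply_eq_self_iff.2 (Or.inl ha))
      · intro h3
        exact Fin.succAbove_ne i a (α.injective (ha.trans (h3.symm.trans h.symm)))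
  · rw [Fin.forall_iff_succAbove i]
    refine ⟨fun h1 a ha => ?_, fun h1 => ⟨fun _ => hi, fun a ha => ?_⟩⟩
    · rw [← hD]
      apply h1.2
      rcases del_apply_eq_self_iff.1 ha with h2 | h2
      · exact h2
      · exact absurd (h2.2.symm.trans h') (Fin.succAbove_ne i a)
    · rw [hD]
      exact h1 a (del_apply_eq_self_iff.2 (Or.inl ha))

lemma ncard_family_eq_add_of_fixed {j n k k' : ℕ} (i : Fin (n + 2)) {A B D E : Fin (n + 2) → Prop}
    {A' D' : Fin (n + 1) → Prop} (hi : A i) (hA : ∀ a, A (i.succAbove a) ↔ A' a)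
    (hD : ∀ a, finRotate _ (i.succAbove a) ≠ i → (D (i.succAbove a) ↔ D' a))
    (hD' : ∀ a, finRotate _ (i.succAbove a) = i → D' a) (hB : ∀ x, B x ↔ A x ∧ x ≠ i)
    (hE : ∀ x, E x ↔ D x) :
    (family j (n + 2) (k + 1) k' A D).ncard =
      (family j (n + 2) (k + 1) k' B E).ncard + (family j (n + 1) k k' A' D').ncard := by
  rw [← ncard_del i i _ _ (mem_family_iff_of_fixed hi hA hD hD'),
    ← Set.ncard_inter_add_ncard_sdiff_eq_ncard _ {α | α i = i}, add_comm]
  congr 2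
  ext α
  simp only [family, Set.mem_sdiff, Set.mem_ofPred_eq, hB, hE]
  constructor
  · rintro ⟨⟨h1, h2, h3, h4, h5⟩, h6⟩
    exact ⟨h1, h2, h3, fun x hx => ⟨h4 x hx, by rintro rfl; exact h6 hx⟩, h5⟩
  · rintro ⟨h1, h2, h3, h4, h5⟩
    exact ⟨⟨h1, h2, h3, fun x hx => (h4 x hx).1, h5⟩, fun h => (h4 i h).2 rfl⟩

lemma ncard_family_eq_add_of_dual_fixed {j n k k' : ℕ} (i : Fin (n + 2))
    {A B D E : Fin (n + 2) → Prop}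
    {A' D' : Fin (n + 1) → Prop} (hi : D i) (hD : ∀ a, D (i.succAbove a) ↔ D' a)
    (hA : ∀ a, finRotate _ i ≠ i.succAbove a → (A (i.succAbove a) ↔ A' a))
    (hA' : ∀ a, finRotate _ i = i.succAbove a → A' a) (hE : ∀ x, E x ↔ D x ∧ x ≠ i)
    (hB : ∀ x, B x ↔ A x) :
    (family j (n + 2) k (k' + 1) A D).ncard =
      (family j (n + 2) k (k' + 1) B E).ncard + (family j (n + 1) k k' A' D').ncard := by
  rw [← ncard_del i _ _ _ (mem_family_iff_of_dual_fixed hi hD hA hA'),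
    ← Set.ncard_inter_add_ncard_sdiff_eq_ncard _ {α | α i = finRotate _ i}, add_comm]
  congr 2
  ext α
  simp only [family, Set.mem_sdiff, Set.mem_ofPred_eq, hB, hE, dual_apply_eq_iff]
  constructor
  · rintro ⟨⟨h1, h2, h3, h4, h5⟩, h6⟩
    exact ⟨h1, h2, h3, h4, fun x hx => ⟨h5 x hx, by rintro rfl; exact h6 hx⟩⟩
  · rintro ⟨h1, h2, h3, h4, h5⟩
    exact ⟨⟨h1, h2, h3, h4, fun x hx => (h5 x hx).1⟩, fun h => (h5 i h).2 rfl⟩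

lemma val_succAbove {n : ℕ} (i : Fin (n + 1)) (a : Fin n) :
    (i.succAbove a : ℕ) = if (a : ℕ) < i then (a : ℕ) else a + 1 := by
  simp only [Fin.succAbove, Fin.lt_def]
  split_ifs <;> simp_all

/-- The number of permutations in the family whose fixed points and complementary fixed points
close at position at most `l` in the sequence
`dual (n - 1), α 0, dual 0, α 1, dual 1, …, α (n - 1)`. -/
noncomputable def leafCount (j n l k k' : ℕ) : ℕ :=
  (family j n k k' (fun i => 2 * (i : ℕ) + 2 ≤ l)
    (fun i => (if (i : ℕ) + 1 = n then 1 else 2 * (i : ℕ) + 3) ≤ l)).ncard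

/-- The number of permutations in the family without fixed points and complementary fixed
points. -/
noncomputable def coreCount (j c c' : ℕ) : ℕ :=
  (family j (c + c' + 1) c c' (fun _ => False) (fun _ => False)).ncard

/-- The number of permutations in the family whose only possible leaf is the fixed point `0`. -/
noncomputable def zeroLeafCount (j n k k' : ℕ) : ℕ :=
  (family j n k k' (fun i => (i : ℕ) = 0) (fun _ => False)).ncard

lemma leafCount_even {j n u k k' : ℕ} (hu : u < n + 2) :
    leafCount j (n + 2) (2 * u + 2) (k + 1) k' =
      leafCount j (n + 2) (2 * u + 1) (k + 1) k' + leafCount j (n + 1) (2 * u + 1) k k' := by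
  rw [leafCount, leafCount, leafCount]
  refine ncard_family_eq_add_of_fixed ⟨u, hu⟩ ?_ ?_ ?_ ?_ ?_ ?_
  · exact le_rfl
  · intro a
    have h1 := val_succAbove ⟨u, hu⟩ a
    dsimp only at h1 ⊢
    split_ifs at h1 <;> omega
  · intro a
    have h0 := a.2
    have h1 := val_succAbove ⟨u, hu⟩ a
    have h2 := val_finRotate ((⟨u, hu⟩ : Fin (n + 2)).succAbove a)
    rw [Ne, Fin.ext_iff, h2]
    dsimp only at h1 ⊢
    split_ifs at h1 ⊢ <;> omega
  · intro a
    have h0 := a.2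
    have h1 := val_succAbove ⟨u, hu⟩ a
    have h2 := val_finRotate ((⟨u, hu⟩ : Fin (n + 2)).succAbove a)
    rw [Fin.ext_iff, h2]
    dsimp only at h1 ⊢
    split_ifs at h1 ⊢ <;> omega
  · intro x
    rw [Ne, Fin.ext_iff]
    dsimp only
    omega
  · intro x
    split_ifs <;> omega

lemma leafCount_odd {j n u k k' : ℕ} (hu : u + 1 < n + 2) :
    leafCount j (n + 2) (2 * u + 3) k (k' + 1) =
      leafCount j (n + 2) (2 * u + 2) k (k' + 1) + leafCount j (n + 1) (2 * u + 2) k k' := by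
  have hu' : u < n + 2 := by omega
  have h3 := val_finRotate (⟨u, hu'⟩ : Fin (n + 2))
  dsimp only at h3
  rw [if_neg (by omega)] at h3
  rw [leafCount, leafCount, leafCount]
  refine ncard_family_eq_add_of_dual_fixed ⟨u, hu'⟩ ?_ ?_ ?_ ?_ ?_ ?_
  · dsimp only
    rw [if_neg (by omega)]
  · intro a
    have h0 := a.2
    have h1 := val_succAbove ⟨u, hu'⟩ a
    dsimp only at h1 ⊢
    split_ifs at h1 ⊢ <;> omega
  · intro a
    have h1 := val_succAbove ⟨u, hu'⟩ a
    rw [Ne, Fin.ext_iff, h3]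
    dsimp only at h1 ⊢
    split_ifs at h1 <;> omega
  · intro a
    have h1 := val_succAbove ⟨u, hu'⟩ a
    rw [Fin.ext_iff, h3]
    dsimp only at h1 ⊢
    split_ifs at h1 <;> omega
  · intro x
    have h0 := x.2
    rw [Ne, Fin.ext_iff]
    dsimp only
    split_ifs <;> omega
  · intro x
    omega

lemma leafCount_one {j n k k' : ℕ} (h : n = k + k') :
    leafCount j (n + 2) 1 k (k' + 1) = coreCount j k (k' + 1) + zeroLeafCount j (n + 1) k k' := by
  subst h
  have h3 := val_finRotate (Fin.last (k + k' + 1))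
  rw [if_pos (by simp)] at h3
  have h5 : coreCount j k (k' + 1) =
      (family j (k + k' + 2) k (k' + 1) (fun _ => False) (fun _ => False)).ncard := rfl
  have h6 : leafCount j (k + k' + 2) 1 k (k' + 1) =
      (family j (k + k' + 2) k (k' + 1) (fun _ => False) (fun i => i = Fin.last _)).ncard := by
    rw [leafCount]
    congr 2
    · ext i
      simp
    · ext i
      rw [Fin.ext_iff, Fin.val_last]
      split_ifs <;> omega
  rw [h5, h6]
  refine ncard_family_eq_add_of_dual_fixed (Fin.last (k + k' + 1)) ?_ ?_ ?_ ?_ ?_ ?_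
  · rfl
  · intro a
    simp
  · intro a
    rw [Ne, Fin.ext_iff, h3, val_succAbove, Fin.val_last, if_pos a.2]
    exact fun h => iff_of_false id fun h1 => h h1.symm
  · intro a
    rw [Fin.ext_iff, h3, val_succAbove, Fin.val_last, if_pos a.2]
    exact Eq.symm
  · intro x
    simp
  · simp

lemma zeroLeafCount_succ {j n k k' : ℕ} (h : n = k + k') :
    zeroLeafCount j (n + 2) (k + 1) k' = coreCount j (k + 1) k' + leafCount j (n + 1) 1 k k' := by
  subst h
  have h4 : k + k' + 2 = k + 1 + k' + 1 := by omega
  have h5 : coreCount j (k + 1) k' =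
      (family j (k + k' + 2) (k + 1) k' (fun _ => False) (fun _ => False)).ncard := by
    rw [coreCount, h4]
  rw [h5]
  refine ncard_family_eq_add_of_fixed 0 ?_ ?_ ?_ ?_ ?_ ?_
  · rfl
  · intro a
    simp
  · intro a
    have h0 := a.2
    rw [Ne, Fin.ext_iff, val_finRotate]
    simp
    split_ifs <;> omega
  · intro a
    rw [Fin.ext_iff, val_finRotate]
    simp
    intro h
    rw [if_pos h]
  · intro x
    rw [Ne, Fin.ext_iff]
    simp
  · simp

lemma leafCount_zero_left (j n l k' : ℕ) : leafCount j (n + 1) l 0 k' = 0 := by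
  rw [leafCount, family_zero_left, Set.ncard_empty]

lemma leafCount_zero_right (j n l k : ℕ) : leafCount j (n + 1) l k 0 = 0 := by
  rw [leafCount, family_zero_right, Set.ncard_empty]

lemma coreCount_zero_left (j k' : ℕ) : coreCount j 0 k' = 0 := by
  rw [coreCount, family_zero_left, Set.ncard_empty]

lemma coreCount_zero_right (j k : ℕ) : coreCount j k 0 = 0 := by
  rw [coreCount, family_zero_right, Set.ncard_empty]

lemma leafCount_of_le {j n l k k' : ℕ} (hl : 2 * n ≤ l) :
    leafCount j n l k k' = (family j n k k' (fun _ => True) (fun _ => True)).ncard := by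
  rw [leafCount]
  congr 2
  · ext i
    have := i.2
    simp
    omega
  · ext i
    have := i.2
    simp
    split_ifs <;> omega

end GenusOne

namespace GenusOne

open PowerSeries

/-- The coefficient of `x ^ k * y ^ k'` of a power series in `x` over the power series in `y`. -/
noncomputable def coeff₂ (k k' : ℕ) (f : ℤ⟦X⟧⟦X⟧) : ℤ := coeff k' (coeff k f)

/-- The inner variable. -/
noncomputable def varY : ℤ⟦X⟧⟦X⟧ := C X

lemma coeff₂_add (k k' : ℕ) (f g : ℤ⟦X⟧⟦X⟧) :
    coeff₂ k k' (f + g) = coeff₂ k k' f + coeff₂ k k' g := by simp [coeff₂]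

lemma coeff₂_succ_X_mul (k k' : ℕ) (f : ℤ⟦X⟧⟦X⟧) :
    coeff₂ (k + 1) k' (X * f) = coeff₂ k k' f := by simp [coeff₂, coeff_succ_X_mul]

lemma coeff₂_zero_X_mul (k' : ℕ) (f : ℤ⟦X⟧⟦X⟧) : coeff₂ 0 k' (X * f) = 0 := by
  simp [coeff₂]

lemma coeff₂_succ_varY_mul (k k' : ℕ) (f : ℤ⟦X⟧⟦X⟧) :
    coeff₂ k (k' + 1) (varY * f) = coeff₂ k k' f := by
  simp [coeff₂, varY, coeff_succ_X_mul]

lemma coeff₂_zero_varY_mul (k : ℕ) (f : ℤ⟦X⟧⟦X⟧) : coeff₂ k 0 (varY * f) = 0 := by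
  simp [coeff₂, varY]

lemma coeff₂_varY_pow_mul {m k' : ℕ} (h : k' < m) (k : ℕ) (f : ℤ⟦X⟧⟦X⟧) :
    coeff₂ k k' (varY ^ m * f) = 0 := by
  induction m generalizing k' with
  | zero => omega
  | succ m ih =>
    rw [pow_succ', mul_assoc]
    cases k' with
    | zero => exact coeff₂_zero_varY_mul _ _
    | succ k' => rw [coeff₂_succ_varY_mul, ih (by omega)]

/-- The generating function of the core counts. -/
noncomputable def coreSeries (j : ℕ) : ℤ⟦X⟧⟦X⟧ := mk fun c => mk fun c' => (coreCount j c c' : ℤ)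

lemma coeff₂_coreSeries (j k k' : ℕ) : coeff₂ k k' (coreSeries j) = coreCount j k k' := by
  simp [coeff₂, coreSeries]

lemma coreSeries_eq_X_mul (j : ℕ) : ∃ S, coreSeries j = X * S := by
  refine X_dvd_iff.2 ?_
  ext k'
  rw [← coeff_zero_eq_constantCoeff_apply]
  simp [coreSeries, coreCount_zero_left]

lemma coreSeries_eq_varY_mul (j : ℕ) : ∃ S, coreSeries j = varY * S := by
  refine ⟨mk fun c => mk fun c' => (coreCount j c (c' + 1) : ℤ), ?_⟩
  ext k k'
  cases k' with
  | zero => simp [coreSeries, varY, coreCount_zero_right]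
  | succ k' => simp [coreSeries, varY, coeff_succ_X_mul]

lemma coeff₂_zero_left (j k' : ℕ) (W : ℤ⟦X⟧⟦X⟧) : coeff₂ 0 k' (W * coreSeries j) = 0 := by
  obtain ⟨S, hS⟩ := coreSeries_eq_X_mul j
  rw [hS, mul_left_comm, coeff₂_zero_X_mul]

lemma coeff₂_zero_right (j k : ℕ) (W : ℤ⟦X⟧⟦X⟧) : coeff₂ k 0 (W * coreSeries j) = 0 := by
  obtain ⟨S, hS⟩ := coreSeries_eq_varY_mul j
  rw [hS, mul_left_comm, coeff₂_zero_varY_mul]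

/-- The geometric sum `∑_{i < w} (x y) ^ i`. -/
noncomputable def geom (w : ℕ) : ℤ⟦X⟧⟦X⟧ := ∑ i ∈ Finset.range w, (X * varY) ^ i

lemma geom_succ (w : ℕ) : geom (w + 1) = geom w + (X * varY) ^ w := Finset.sum_range_succ _ _

lemma geom_succ' (w : ℕ) : geom (w + 1) = 1 + X * varY * geom w := by
  rw [geom, Finset.sum_range_succ', geom, Finset.mul_sum, add_comm]
  simp [pow_succ']

/-- The multiplier describing `leafCount` at odd positions. -/
noncomputable def oddWeight (w u : ℕ) : ℤ⟦X⟧⟦X⟧ :=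
  ((1 + X) * (1 + varY)) ^ u * ((1 + varY) * geom w + (X * varY) ^ w)

/-- The multiplier describing `leafCount` at even positions. -/
noncomputable def evenWeight (w u : ℕ) : ℤ⟦X⟧⟦X⟧ :=
  ((1 + X) * (1 + varY)) ^ u * geom (w + 1)

lemma evenWeight_succ (w u : ℕ) :
    evenWeight w (u + 1) = oddWeight (w + 1) u + X * oddWeight w u := by
  rw [evenWeight, oddWeight, oddWeight, geom_succ]
  ring

lemma oddWeight_succ (w u : ℕ) :
    oddWeight (w + 1) u = evenWeight (w + 1) u + varY * evenWeight w u := by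
  rw [evenWeight, evenWeight, oddWeight, geom_succ (w + 1)]
  ring

lemma oddWeight_zero (w : ℕ) :
    oddWeight (w + 2) 0 = 1 + varY + X * (varY * oddWeight w 0)
      + varY ^ (w + 2) * (X ^ (w + 1) + X ^ (w + 2)) := by
  rw [oddWeight, oddWeight, geom_succ, geom_succ']
  ring

lemma leafCount_one_eq (j n k k' : ℕ) (h : n = k + k' + 1) :
    (leafCount j n 1 k k' : ℤ) = coeff₂ k k' (oddWeight n 0 * coreSeries j) := by
  induction n using Nat.strong_induction_on generalizing k k' with
  | _ n ih =>
    subst h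
    rcases k with _ | k
    · rw [leafCount_zero_left, coeff₂_zero_left, Nat.cast_zero]
    rcases k' with _ | k'
    · rw [leafCount_zero_right, coeff₂_zero_right, Nat.cast_zero]
    have h1 : k + 1 + (k' + 1) + 1 = (k + k' + 1) + 2 := by omega
    rw [h1, leafCount_one (by omega), zeroLeafCount_succ rfl, oddWeight_zero, add_mul, add_mul,
      add_mul, one_mul, coeff₂_add, coeff₂_add, coeff₂_add, mul_assoc, mul_assoc, mul_assoc,
      coeff₂_varY_pow_mul (by omega), coeff₂_succ_X_mul, coeff₂_succ_varY_mul,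
      coeff₂_succ_varY_mul, ← ih _ (by omega) _ _ rfl, coeff₂_coreSeries, coeff₂_coreSeries]
    push_cast
    ring

lemma leafCount_odd_even (j u : ℕ) :
    (∀ n k k', n = k + k' + 1 → u ≤ n → (leafCount j n (2 * u + 1) k k' : ℤ) =
      coeff₂ k k' (oddWeight (n - u) u * coreSeries j)) ∧
    (∀ n k k', n = k + k' + 1 → u + 1 ≤ n → (leafCount j n (2 * u + 2) k k' : ℤ) =
      coeff₂ k k' (evenWeight (n - (u + 1)) (u + 1) * coreSeries j)) := by
  have key : ∀ u, (∀ n k k', n = k + k' + 1 → u ≤ n → (leafCount j n (2 * u + 1) k k' : ℤ) =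
        coeff₂ k k' (oddWeight (n - u) u * coreSeries j)) →
      (∀ n k k', n = k + k' + 1 → u + 1 ≤ n → (leafCount j n (2 * u + 2) k k' : ℤ) =
        coeff₂ k k' (evenWeight (n - (u + 1)) (u + 1) * coreSeries j)) := by
    intro u ih n k k' h hu
    subst h
    rcases k with _ | k
    · rw [leafCount_zero_left, coeff₂_zero_left, Nat.cast_zero]
    have h1 : k + 1 + k' + 1 = (k + k') + 2 := by omega
    have h2 : k + k' + 2 - u = k + k' + 2 - (u + 1) + 1 := by omega
    have h3 : k + k' + 1 - u = k + k' + 2 - (u + 1) := by omega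
    rw [h1, leafCount_even (by omega), evenWeight_succ, add_mul, coeff₂_add, mul_assoc,
      coeff₂_succ_X_mul, Nat.cast_add, ih _ _ _ (by omega) (by omega),
      ih _ _ _ rfl (by omega), h2, h3]
  induction u with
  | zero =>
    have h0 : ∀ n k k', n = k + k' + 1 → 0 ≤ n → (leafCount j n (2 * 0 + 1) k k' : ℤ) =
      coeff₂ k k' (oddWeight (n - 0) 0 * coreSeries j) :=
        fun n k k' h _ => leafCount_one_eq j n k k' h
    exact ⟨h0, key 0 h0⟩
  | succ u ih =>
    refine ⟨?_, key (u + 1) ?_⟩ <;>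
    · intro n k k' h hu
      subst h
      rcases k' with _ | k'
      · rw [leafCount_zero_right, coeff₂_zero_right, Nat.cast_zero]
      rcases hu.eq_or_lt with h | h
      · rw [leafCount_of_le (by omega), ← leafCount_of_le (l := 2 * u + 2) (by omega),
          ih.2 _ _ _ rfl (by omega), ← h, Nat.sub_self, evenWeight, oddWeight]
        simp [geom]
      have h1 : k + (k' + 1) + 1 = (k + k') + 2 := by omega
      have h2 : k + k' + 2 - (u + 1) = k + k' + 1 - (u + 1) + 1 := by omega
      rw [h1, show 2 * (u + 1) + 1 = 2 * u + 3 by ring, leafCount_odd (by omega), Nat.cast_add,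
        ih.2 _ _ _ (by omega) (by omega), ih.2 _ _ _ rfl (by omega), h2, oddWeight_succ, add_mul,
        coeff₂_add, mul_assoc varY, coeff₂_succ_varY_mul]

lemma coeff_one_add_X_pow {S : Type*} [CommRing S] (n k : ℕ) :
    coeff k ((1 + X : S⟦X⟧) ^ n) = (n.choose k : S) := by
  have h := Polynomial.coeff_one_add_X_pow S n k
  rw [← h, ← Polynomial.coeff_coe]
  simp

lemma coeff₂_binomial (n k k' : ℕ) (f : ℤ⟦X⟧⟦X⟧) :
    coeff₂ k k' (((1 + X) * (1 + varY)) ^ n * f) =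
      ∑ c ∈ Finset.range (k + 1), ∑ c' ∈ Finset.range (k' + 1),
        (n.choose (k - c) * n.choose (k' - c') : ℤ) * coeff₂ c c' f := by
  have h : (1 + varY) ^ n = C ((1 + X : ℤ⟦X⟧) ^ n) := by simp [varY]
  rw [mul_pow, mul_assoc, coeff₂, mul_comm, coeff_mul,
    Finset.Nat.sum_antidiagonal_eq_sum_range_succ_mk, map_sum]
  refine Finset.sum_congr rfl fun c _ => ?_
  dsimp only
  rw [h, coeff_C_mul, coeff_one_add_X_pow, mul_comm ((1 + X : ℤ⟦X⟧) ^ n), mul_comm (_ * _),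
    ← nsmul_eq_mul, map_nsmul, coeff_mul, Finset.Nat.sum_antidiagonal_eq_sum_range_succ_mk,
    Finset.smul_sum]
  refine Finset.sum_congr rfl fun c' _ => ?_
  dsimp only
  rw [coeff_one_add_X_pow, coeff₂, nsmul_eq_mul]
  ring

lemma ncard_family_eq_sum (j n k k' : ℕ) (h : n = k + k' + 1) :
    (family j n k k' (fun _ => True) (fun _ => True)).ncard =
      ∑ c ∈ Finset.range (k + 1), ∑ c' ∈ Finset.range (k' + 1),
        n.choose (k - c) * n.choose (k' - c') * coreCount j c c' := by
  have h1 := (leafCount_odd_even j (k + k')).2 n k k' h (by omega)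
  rw [leafCount_of_le (by omega), h, Nat.sub_self, evenWeight, geom_succ] at h1
  rw [geom, Finset.sum_range_zero, pow_zero, zero_add, mul_one, coeff₂_binomial] at h1
  simp only [coeff₂_coreSeries] at h1
  rw [h]
  exact_mod_cast h1

end GenusOne

namespace GenusOne

open Equiv

/-- The points that are not on a cycle of length at most two. -/
def bigSet {n : ℕ} (τ : Perm (Fin n)) : Finset (Fin n) := Finset.univ.filter fun i => τ (τ i) ≠ i

lemma mem_bigSet {n : ℕ} {τ : Perm (Fin n)} {i : Fin n} : i ∈ bigSet τ ↔ τ (τ i) ≠ i := by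
  simp [bigSet]

lemma apply_mem_bigSet {n : ℕ} {τ : Perm (Fin n)} {i : Fin n} :
    τ i ∈ bigSet τ ↔ i ∈ bigSet τ := by
  rw [mem_bigSet, mem_bigSet, Ne, τ.injective.eq_iff]

lemma bigSet_of_sameCycle {n : ℕ} {τ : Perm (Fin n)} {i j : Fin n} (h : τ.SameCycle i j) :
    i ∈ bigSet τ ↔ j ∈ bigSet τ := by
  obtain ⟨k, rfl⟩ := h.exists_nat_pow_eq
  clear h
  induction k with
  | zero => rfl
  | succ k ih => rw [ih, pow_succ', Perm.mul_apply, apply_mem_bigSet]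

lemma bigSet_eq_empty_iff {n : ℕ} {τ : Perm (Fin n)} : bigSet τ = ∅ ↔ ∀ i, τ (τ i) = i := by
  simp [Finset.eq_empty_iff_forall_notMem, mem_bigSet]

lemma orbit_subset {n : ℕ} {τ : Perm (Fin n)} {S : Finset (Fin n)} (hS : ∀ i ∈ S, τ i ∈ S)
    {i : Fin n} (hi : i ∈ S) : {i, τ i, τ (τ i)} ⊆ S := by
  have h1 := hS i hi
  have h2 := hS _ h1
  intro x hx
  simp only [Finset.mem_insert, Finset.mem_singleton] at hx
  rcases hx with rfl | rfl | rfl <;> assumption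

lemma card_orbit_three {n : ℕ} {τ : Perm (Fin n)} (hf : ∀ i, τ i ≠ i) {i : Fin n}
    (hi : τ (τ i) ≠ i) : ({i, τ i, τ (τ i)} : Finset (Fin n)).card = 3 := by
  rw [Finset.card_eq_three]
  exact ⟨_, _, _, (hf i).symm, hi.symm, (hf _).symm, rfl⟩

lemma eq_orbit_of_card_le_three {n : ℕ} {τ : Perm (Fin n)} (hf : ∀ i, τ i ≠ i)
    {S : Finset (Fin n)} (hS : ∀ i ∈ S, τ i ∈ S) (hc : S.card ≤ 3) {i : Fin n} (hi : i ∈ S)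
    (hi' : τ (τ i) ≠ i) : S = {i, τ i, τ (τ i)} ∧ τ (τ (τ i)) = i := by
  have h1 : {i, τ i, τ (τ i)} = S :=
    Finset.eq_of_subset_of_card_le (orbit_subset hS hi) (by rw [card_orbit_three hf hi']; exact hc)
  refine ⟨h1.symm, ?_⟩
  have h2 : τ (τ (τ i)) ∈ S := hS _ (hS _ (hS _ hi))
  rw [← h1] at h2
  simp only [Finset.mem_insert, Finset.mem_singleton] at h2
  rcases h2 with h2 | h2 | h2
  · exact h2
  · exact absurd (τ.injective h2) hi'
  · exact absurd h2 (hf _)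

open Classical in
/-- A fixed-point-free permutation with `b` cycles of length at least three: relation between the
number of cycles and the size of `bigSet`. -/
lemma exists_card_bigSet {n : ℕ} {τ : Perm (Fin n)} (hf : ∀ i, τ i ≠ i) :
    ∃ b, n + 2 * b = 2 * zPerm τ + (bigSet τ).card ∧ 3 * b ≤ (bigSet τ).card ∧
      ((bigSet τ).card ≠ 0 → 0 < b) ∧
      ((bigSet τ).card = 3 * b → ∀ i ∈ bigSet τ, τ (τ (τ i)) = i) := by
  let f : Fin n → Quotient (cycleSetoid τ) := fun i => ⟦i⟧
  have hfs : ∀ i j, f i = f j ↔ τ.SameCycle i j := fun i j => Quotient.eq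
  have hfa : ∀ i, f (τ i) = f i := fun i => (hfs _ _).2 (by simp [Perm.SameCycle.refl])
  set Q := (bigSet τ).image f with hQ
  have hmem : ∀ i, f i ∈ Q ↔ i ∈ bigSet τ := by
    intro i
    rw [hQ, Finset.mem_image]
    refine ⟨?_, fun h => ⟨i, h, rfl⟩⟩
    rintro ⟨j, hj, h⟩
    exact (bigSet_of_sameCycle ((hfs _ _).1 h)).1 hj
  have hcl : ∀ q, ∀ i ∈ Finset.univ.filter (fun i => f i = q),
      τ i ∈ Finset.univ.filter (fun i => f i = q) := by
    intro q i hi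
    simpa [hfa] using hi
  have hbig : ∀ i ∈ bigSet τ, 3 ≤ (Finset.univ.filter fun j => f j = f i).card := by
    intro i hi
    rw [← card_orbit_three hf (mem_bigSet.1 hi)]
    exact Finset.card_le_card (orbit_subset (hcl _) (by simp))
  have hsmall : ∀ i, i ∉ bigSet τ → (Finset.univ.filter fun j => f j = f i).card = 2 := by
    intro i hi
    rw [mem_bigSet, not_not] at hi
    rw [Finset.card_eq_two]
    refine ⟨i, τ i, (hf i).symm, ?_⟩
    ext j
    simp only [Finset.mem_filter, Finset.mem_univ, true_and, Finset.mem_insert,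
      Finset.mem_singleton]
    constructor
    · intro h
      obtain ⟨k, rfl⟩ := ((hfs _ _).1 h).symm.exists_nat_pow_eq
      clear h
      induction k with
      | zero => simp
      | succ k ih =>
        rw [pow_succ', Perm.mul_apply]
        rcases ih with h | h <;> rw [h]
        · exact Or.inr rfl
        · exact Or.inl hi
    · rintro (rfl | rfl)
      · rfl
      · exact hfa i
  have hB : (bigSet τ).card = ∑ q ∈ Q, (Finset.univ.filter fun j => f j = q).card := by
    rw [Finset.card_eq_sum_card_fiberwise (f := f) (t := Q)
      (fun i hi => (hmem i).2 hi)]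
    refine Finset.sum_congr rfl fun q hq => ?_
    congr 1
    ext j
    simp only [Finset.mem_filter, Finset.mem_univ, true_and, and_iff_right_iff_imp]
    rintro rfl
    exact (hmem j).1 hq
  have hC : n = ∑ q, (Finset.univ.filter fun j => f j = q).card := by
    conv_lhs => rw [← Fintype.card_fin n, ← Finset.card_univ]
    exact Finset.card_eq_sum_card_fiberwise (fun i _ => Finset.mem_univ _)
  have hz : zPerm τ = Fintype.card (Quotient (cycleSetoid τ)) := by
    rw [zPerm, Nat.card_eq_fintype_card]
  have hD : ∑ q ∈ Qᶜ, (Finset.univ.filter fun j => f j = q).card = 2 * Qᶜ.card := by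
    rw [mul_comm, ← smul_eq_mul]
    refine Finset.sum_eq_card_nsmul fun q hq => ?_
    induction q using Quotient.inductionOn with
    | _ i =>
      rw [Finset.mem_compl] at hq
      exact hsmall i fun h => hq ((hmem i).2 h)
  have hge : ∀ q ∈ Q, 3 ≤ (Finset.univ.filter fun j => f j = q).card := by
    intro q hq
    induction q using Quotient.inductionOn with
    | _ i => exact hbig i ((hmem i).1 hq)
  rw [← Finset.sum_add_sum_compl Q, ← hB, hD] at hC
  rw [← Finset.card_add_card_compl Q] at hz
  have h3 : 3 * Q.card = ∑ q ∈ Q, 3 := by simp [mul_comm]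
  refine ⟨Q.card, by omega, ?_, ?_, ?_⟩
  · rw [h3, hB]
    exact Finset.sum_le_sum hge
  · intro h
    rw [Finset.card_pos]
    obtain ⟨i, hi⟩ := Finset.card_ne_zero.1 h
    exact ⟨f i, (hmem i).2 hi⟩
  · intro h i hi
    rw [hB, h3] at h
    have h4 := (Finset.sum_eq_sum_iff_of_le hge).1 h.symm (f i) ((hmem i).2 hi)
    exact (eq_orbit_of_card_le_three hf (hcl (f i)) h4.symm.le (by simp) (mem_bigSet.1 hi)).2

/-- `τ` is a fixed-point-free involution. -/
def IsMatching {n : ℕ} (τ : Perm (Fin n)) : Prop := ∀ i, τ i ≠ i ∧ τ (τ i) = i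

/-- `τ` is fixed-point-free, the cycle of `l` has length three, and all the other cycles have
length two. -/
def IsTripod {n : ℕ} (l : Fin n) (τ : Perm (Fin n)) : Prop :=
  (∀ i, τ i ≠ i) ∧ τ (τ (τ l)) = l ∧ ∀ i, τ (τ i) = i ∨ i = l ∨ i = τ l ∨ i = τ (τ l)

lemma castSucc_finRotate {m : ℕ} {d : Fin (m + 1)} (h : d ≠ Fin.last m) :
    (finRotate (m + 1) d).castSucc = finRotate (m + 2) d.castSucc := by
  have h1 : (d : ℕ) ≠ m := fun h2 => h (Fin.ext h2)
  have h2 := d.2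
  ext
  rw [val_finRotate, Fin.val_castSucc, val_finRotate, Fin.val_castSucc, if_neg (by omega),
    if_neg (by omega)]

lemma finRotate_castSucc_last {m : ℕ} :
    finRotate (m + 2) (Fin.last m).castSucc = Fin.last (m + 1) := by
  ext
  rw [val_finRotate, Fin.val_castSucc]
  simp

section

variable {m : ℕ} {π : Perm (Fin (m + 2))} {d : Fin (m + 1)}

lemma apply_castSucc_dual_del (h : π (Fin.last _) = (finRotate _ d).castSucc) (a : Fin (m + 1)) :
    π (dual (del (Fin.last _) π) a).castSucc =
      if a = d then Fin.last _ else (finRotate _ a).castSucc := by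
  have h1 := succAbove_del (Fin.last _) π (dual (del (Fin.last _) π) a)
  rw [apply_dual, Fin.succAbove_last, h, swap_comm, eq_comm, Equiv.swap_apply_eq_iff] at h1
  rw [h1]
  split_ifs with h2
  · rw [h2, swap_apply_left]
  · rw [swap_apply_of_ne_of_ne]
    · simpa using h2
    · exact Fin.castSucc_ne_last _

lemma dual_castSucc_of_eq (h : π (Fin.last _) = (finRotate _ d).castSucc) (hd : d ≠ Fin.last m) :
    dual π d.castSucc = Fin.last _ := by
  rw [dual_apply_eq_iff, h, castSucc_finRotate hd]

lemma dual_castSucc_last (h : π (Fin.last _) = (finRotate _ d).castSucc) :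
    dual π (Fin.last m).castSucc = (dual (del (Fin.last _) π) d).castSucc := by
  rw [dual_apply_eq_iff, apply_castSucc_dual_del h, if_pos rfl, finRotate_castSucc_last]

lemma dual_last (h : π (Fin.last _) = (finRotate _ d).castSucc) (hd : d ≠ Fin.last m) :
    dual π (Fin.last _) = (dual (del (Fin.last _) π) (Fin.last m)).castSucc := by
  rw [dual_apply_eq_iff, apply_castSucc_dual_del h, if_neg hd.symm, finRotate_last,
    finRotate_last, Fin.castSucc_zero]

lemma dual_castSucc_of_ne (h : π (Fin.last _) = (finRotate _ d).castSucc) {a : Fin (m + 1)}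
    (ha : a ≠ d) (ha' : a ≠ Fin.last m) :
    dual π a.castSucc = (dual (del (Fin.last _) π) a).castSucc := by
  rw [dual_apply_eq_iff, apply_castSucc_dual_del h, if_neg ha, castSucc_finRotate ha']

end

lemma isTripod_of_isMatching_dual {m : ℕ} {π : Perm (Fin (m + 2))} (hm : IsMatching (dual π))
    (hπ : π (Fin.last _) ≠ Fin.last _) :
    π (Fin.last _) =
        (finRotate _ (dual (del (Fin.last (m + 1)) π) (Fin.last m))).castSucc ∧
      IsTripod (Fin.last m) (dual (del (Fin.last (m + 1)) π)) := by
  obtain ⟨d, hd⟩ : ∃ d : Fin (m + 1), π (Fin.last _) = (finRotate _ d).castSucc := by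
    obtain ⟨x, hx⟩ := Fin.exists_castSucc_eq.2 hπ
    exact ⟨(finRotate _).symm x, by simp [hx]⟩
  have hdl : d ≠ Fin.last m := by
    rintro rfl
    apply (hm (Fin.last _)).1
    rw [dual_apply_eq_iff, hd, finRotate_last, finRotate_last, Fin.castSucc_zero]
  set β := dual π with hβ
  set β' := dual (del (Fin.last (m + 1)) π) with hβ'
  have h1 := dual_castSucc_of_eq hd hdl
  have h2 := dual_castSucc_last hd
  have h3 := dual_last hd hdl
  have h4 := fun a => dual_castSucc_of_ne hd (a := a)
  rw [← hβ] at h1 h2 h3 h4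
  rw [← hβ'] at h2 h3 h4
  have h5 : β' (Fin.last m) = d := by
    apply Fin.castSucc_injective
    rw [← h3, ← h1, (hm _).2]
  have h6 : β (β' d).castSucc = (Fin.last m).castSucc := by rw [← h2, (hm _).2]
  have h7 : β' d ≠ d := fun h => by
    rw [h, h1] at h6
    exact Fin.castSucc_ne_last _ h6.symm
  have h8 : β' d ≠ Fin.last m := fun h => by
    rw [h] at h6
    exact (hm _).1 h6
  have h9 : β' (β' d) = Fin.last m := Fin.castSucc_injective _ (by rw [← h4 _ h7 h8, h6])
  rw [h5]
  refine ⟨hd, ?_, by rw [h5, h9], ?_⟩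
  · intro i
    by_cases hi : i = d
    · rw [hi]
      exact h7
    by_cases hi' : i = Fin.last m
    · rw [hi', h5]
      exact hdl
    intro h
    have := h4 i hi hi'
    rw [h] at this
    exact (hm _).1 this
  · intro i
    rw [h5]
    by_cases hi : i = d
    · simp [hi]
    by_cases hi' : i = Fin.last m
    · simp [hi']
    by_cases hne_d : i = β' d
    · simp [hne_d]
    left
    have h10 := h4 i hi hi'
    apply Fin.castSucc_injective
    rw [← h4, ← h10, (hm _).2]
    · rintro h
      rw [← h5] at h
      exact hi' (β'.injective h)
    · rintro h
      rw [← h9] at h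
      exact hne_d (β'.injective h)

lemma isMatching_dual_of_isTripod {m : ℕ} {π : Perm (Fin (m + 2))}
    (hπ : π (Fin.last _) =
      (finRotate _ (dual (del (Fin.last (m + 1)) π) (Fin.last m))).castSucc)
    (ht : IsTripod (Fin.last m) (dual (del (Fin.last (m + 1)) π))) : IsMatching (dual π) := by
  set β := dual π with hβ
  set β' := dual (del (Fin.last (m + 1)) π) with hβ'
  obtain ⟨hf, h5, h6⟩ := ht
  set d := β' (Fin.last m) with hd
  have hdl : d ≠ Fin.last m := hf _
  have h1 := dual_castSucc_of_eq hπ hdl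
  have h2 := dual_castSucc_last hπ
  have h3 := dual_last hπ hdl
  have h4 := fun a => dual_castSucc_of_ne hπ (a := a)
  rw [← hβ] at h1 h2 h3 h4
  rw [← hβ'] at h2 h3 h4
  rw [← hd] at h3
  have h7 : β' d ≠ d := hf _
  have h8 : β' d ≠ Fin.last m := fun h => by
    rw [h, ← hd] at h5
    exact hdl h5
  have h9 : β (β' d).castSucc = (Fin.last m).castSucc := by rw [h4 _ h7 h8, h5]
  intro i
  induction i using Fin.lastCases with
  | last =>
    rw [h3, h1]
    exact ⟨Fin.castSucc_ne_last _, rfl⟩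
  | cast i =>
    by_cases hi : i = d
    · rw [hi, h1, h3]
      exact ⟨(Fin.castSucc_ne_last _).symm, rfl⟩
    by_cases hi' : i = Fin.last m
    · rw [hi', h2, h9]
      exact ⟨fun h => h8 (Fin.castSucc_injective _ h), rfl⟩
    by_cases hne_d : i = β' d
    · rw [hne_d, h9, h2]
      exact ⟨fun h => h8 (Fin.castSucc_injective _ h).symm, rfl⟩
    rw [h4 i hi hi', h4]
    · refine ⟨fun h => hf i (Fin.castSucc_injective _ h), ?_⟩
      rcases h6 i with h | h | h | h
      · rw [h]
      all_goals exact absurd h ‹_›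
    · rintro h
      exact hi' (β'.injective h)
    · rintro h
      rw [← h5] at h
      exact hne_d (β'.injective h)

lemma ncard_del_of_apply_eq {n : ℕ} (i : Fin (n + 1)) (v : Perm (Fin n) → Fin (n + 1))
    (S : Set (Perm (Fin (n + 1)))) (T : Set (Perm (Fin n))) (hS : ∀ α ∈ S, α i = v (del i α))
    (h : ∀ α, α i = v (del i α) → (α ∈ S ↔ del i α ∈ T)) : S.ncard = T.ncard := by
  refine Set.ncard_congr (fun α _ => del i α) ?_ ?_ ?_
  · intro α h1
    exact (h α (hS α h1)).1 h1
  · intro α β h1 h2 h3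
    apply (delEquiv i).injective
    rw [delEquiv_eq, delEquiv_eq, hS α h1, hS β h2, h3]
  · intro δ hδ
    have h1 := delEquiv_eq i ((delEquiv i).symm (v δ, δ))
    rw [Equiv.apply_symm_apply, Prod.ext_iff] at h1
    have h2 : del i ((delEquiv i).symm (v δ, δ)) = δ := h1.2.symm
    refine ⟨(delEquiv i).symm (v δ, δ), (h _ ?_).2 ?_, h2⟩
    · rw [h2]
      exact h1.1.symm
    · rwa [h2]

/-- The fixed-point-free permutations with `z` cycles whose complementary permutation is a
matching. -/
def matchFamily (n z : ℕ) : Set (Perm (Fin n)) :=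
  {π | zPerm π = z ∧ (∀ i, π i ≠ i) ∧ IsMatching (dual π)}

/-- The fixed-point-free permutations with `z` cycles whose complementary permutation is a tripod
centred at `l`. -/
def tripodFamily (n z : ℕ) (l : Fin n) : Set (Perm (Fin n)) :=
  {π | zPerm π = z ∧ (∀ i, π i ≠ i) ∧ IsTripod l (dual π)}

lemma ncard_matchFamily_inter_last (m z : ℕ) :
    (matchFamily (m + 2) z ∩ {π | Fin.last _ ∈ bigSet π}).ncard =
      (tripodFamily (m + 1) z (Fin.last _)).ncard := by
  refine ncard_del_of_apply_eq (Fin.last (m + 1))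
    (fun δ => (finRotate _ (dual δ (Fin.last m))).castSucc) _ _ ?_ ?_
  · rintro π ⟨⟨-, hf, hm⟩, -⟩
    exact (isTripod_of_isMatching_dual hm (hf _)).1
  · intro π hπ
    have h0 : π (Fin.last _) ≠ Fin.last _ := by
      rw [hπ]
      exact Fin.castSucc_ne_last _
    simp only [matchFamily, tripodFamily, Set.mem_inter_iff, Set.mem_ofPred_eq, mem_bigSet,
      zPerm_del_of_ne h0]
    constructor
    · rintro ⟨⟨h1, h2, h3⟩, h4⟩
      refine ⟨h1, fun i hi => ?_, (isTripod_of_isMatching_dual h3 h0).2⟩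
      rcases del_apply_eq_self_iff.1 hi with h | ⟨h, h'⟩
      · exact h2 _ h
      · rw [h', h] at h4
        exact h4 rfl
    · rintro ⟨h1, h2, h3⟩
      refine ⟨⟨h1, fun i => ?_, isMatching_dual_of_isTripod hπ h3⟩, fun h => ?_⟩
      · induction i using Fin.lastCases with
        | last => exact h0
        | cast i =>
          rw [← Fin.succAbove_last]
          exact fun h => h2 i (del_apply_eq_self_iff.2 (Or.inl h))
      · rw [hπ, ← Fin.succAbove_last] at h
        exact h2 _ (del_apply_eq_self_iff.2 (Or.inr ⟨h, by rw [hπ, Fin.succAbove_last]⟩))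

lemma card_bigSet_del {n : ℕ} {i : Fin (n + 1)} {α : Perm (Fin (n + 1))} (h : α (α i) = i) :
    (bigSet (del i α)).card = (bigSet α).card := by
  have h1 : bigSet α = (bigSet (del i α)).map (Fin.succAboveEmb i) := by
    ext x
    simp only [Finset.mem_map, mem_bigSet, Fin.coe_succAboveEmb]
    induction x using Fin.succAboveCases i with
    | x =>
      simp [h, Fin.succAbove_ne]
    | p a =>
      simp only [(Fin.succAbove_right_injective (p := i)).eq_iff, exists_eq_right]
      rw [← (Fin.succAbove_right_injective (p := i)).ne_iff]
      by_cases h2 : α (i.succAbove a) = i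
      · have h3 : α i = i.succAbove a := by
          rw [← h2] at h
          have := α.injective h
          rw [h2] at this
          exact this
        have h4 : del i α a = a := del_apply_eq_self_iff.2 (Or.inr ⟨h2, h3⟩)
        simp [h4, h2, h3]
      · rw [← succAbove_del_of_ne h2]
        by_cases h5 : α (i.succAbove (del i α a)) = i
        · rw [succAbove_del_of_ne h2] at h5
          have h6 := α.injective (h5.trans h.symm)
          exact absurd (α.injective h6) (Fin.succAbove_ne i a)
        · rw [succAbove_del_of_ne h5]
  rw [h1, Finset.card_map]

/-- The permutations with `z` cycles and `w` points off the cycles of length at most two, whose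
complementary permutation is a tripod centred at the last point and whose only fixed point is the
cyclic successor of the second point of this tripod. -/
def pointedTripodFamily (m z w : ℕ) : Set (Perm (Fin (m + 1))) :=
  {π | zPerm π = z ∧ (bigSet π).card = w ∧ IsTripod (Fin.last _) (dual π) ∧
    ∀ i, π i = i ↔ i = finRotate _ (dual π (Fin.last _))}

lemma ncard_matchFamily_sdiff_last (m z w : ℕ) :
    ((matchFamily (m + 2) z ∩ {π | (bigSet π).card = w}) \ {π | Fin.last _ ∈ bigSet π}).ncard =
      (pointedTripodFamily m z w).ncard := by
  refine ncard_del_of_apply_eq (Fin.last (m + 1))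
    (fun δ => (finRotate _ (dual δ (Fin.last m))).castSucc) _ _ ?_ ?_
  · rintro π ⟨⟨⟨-, hf, hm⟩, -⟩, -⟩
    exact (isTripod_of_isMatching_dual hm (hf _)).1
  · intro π hπ
    have h0 : π (Fin.last _) ≠ Fin.last _ := by
      rw [hπ]
      exact Fin.castSucc_ne_last _
    simp only [matchFamily, pointedTripodFamily, Set.mem_sdiff, Set.mem_inter_iff,
      Set.mem_ofPred_eq, mem_bigSet, zPerm_del_of_ne h0, not_not]
    constructor
    · rintro ⟨⟨⟨h1, h2, h3⟩, h5⟩, h4⟩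
      refine ⟨h1, by rw [card_bigSet_del h4, h5], (isTripod_of_isMatching_dual h3 h0).2,
        fun i => ?_⟩
      rw [del_apply_eq_self_iff, Fin.succAbove_last, hπ, Fin.castSucc_inj]
      constructor
      · rintro (h | h)
        · exact absurd h (h2 _)
        · exact h.2.symm
      · rintro rfl
        rw [← hπ, h4]
        exact Or.inr ⟨rfl, rfl⟩
    · rintro ⟨h1, h5, h3, h2⟩
      have h4 : π (π (Fin.last _)) = Fin.last _ := by
        have h6 := (h2 _).2 rfl
        rw [del_apply_eq_self_iff, Fin.succAbove_last, ← hπ] at h6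
        rcases h6 with h | h
        · exact absurd (π.injective h) h0
        · exact h.1
      refine ⟨⟨⟨h1, fun i => ?_, isMatching_dual_of_isTripod hπ h3⟩, ?_⟩, h4⟩
      · induction i using Fin.lastCases with
        | last => exact h0
        | cast i =>
          intro h
          rw [← Fin.succAbove_last] at h
          have h7 := (h2 i).1 (del_apply_eq_self_iff.2 (Or.inl h))
          rw [Fin.succAbove_last, h7, ← hπ] at h
          exact h0 (π.injective h)
      · rw [← card_bigSet_del h4, h5]

lemma isMatching_dual_del_iff {m : ℕ} {i : Fin (m + 2)} {α : Perm (Fin (m + 2))} (h : α i = i) :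
    (IsTripod (Fin.last _) (dual α) ∧ i = finRotate _ (dual α (Fin.last _))) ↔
      (IsMatching (dual (del i α)) ∧ (dual (del i α) (Fin.last m)).succ = i) := by
  rw [dual_del_of_fixed h]
  set β := dual α with hβ
  have hβi : β i ≠ i := fun h1 => by
    rw [hβ, dual_apply_eq_iff, h] at h1
    exact finRotate_ne i h1.symm
  have hs : ∀ a, i.succAbove (del i β a) = swap i (β i) (β (i.succAbove a)) := succAbove_del i β
  have hL : i ≠ Fin.last _ → i.succAbove (Fin.last m) = Fin.last _ := fun h1 =>
    Fin.succAbove_ne_last_last h1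
  constructor
  · rintro ⟨⟨h1, h2, h3⟩, h4⟩
    have h5 : β (β (Fin.last _)) = i := by rw [hβ, dual_apply_eq_iff, h, ← hβ, h4]
    rw [h5] at h2 h3
    have h6 : i ≠ Fin.last _ := fun h7 => hβi (h2.trans h7.symm)
    have h7 : β (Fin.last _) ≠ i := fun h7 => by
      rw [h7] at h5
      exact hβi h5
    have h8 : i.succAbove (del i β (Fin.last m)) = β (Fin.last _) := by
      rw [hs, hL h6, h2, swap_apply_of_ne_of_ne h7 (h1 _)]
    set c := del i β (Fin.last m) with hc
    have h9 : del i β c = Fin.last m := by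
      apply Fin.succAbove_right_injective (p := i)
      rw [hs, h8, h5, swap_apply_left, h2, hL h6]
    have h10 : c ≠ Fin.last m := fun h10 => by
      rw [h10, hL h6] at h8
      exact h1 _ h8.symm
    have h11 : ∀ a, a ≠ Fin.last m → a ≠ c → i.succAbove (del i β a) = β (i.succAbove a) := by
      intro a ha ha'
      rw [hs, h2, swap_apply_of_ne_of_ne]
      · intro h11
        have h12 := β.injective (h11.trans h5.symm)
        rw [← h8] at h12
        exact ha' (Fin.succAbove_right_injective h12)
      · intro h11
        rw [← h2] at h11
        exact Fin.succAbove_ne i a (β.injective h11)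
    refine ⟨fun a => ?_, ?_⟩
    · by_cases ha : a = Fin.last m
      · rw [ha, ← hc, h9]
        exact ⟨h10, rfl⟩
      by_cases ha' : a = c
      · rw [ha', h9, ← hc]
        exact ⟨h10.symm, rfl⟩
      refine ⟨fun h12 => ?_, ?_⟩
      · have h13 := h11 a ha ha'
        rw [h12] at h13
        exact h1 _ h13.symm
      · apply Fin.succAbove_right_injective (p := i)
        rw [h11, h11 a ha ha']
        · rcases h3 (i.succAbove a) with h12 | h12 | h12 | h12
          · exact h12
          · rw [← hL h6] at h12
            exact absurd (Fin.succAbove_right_injective h12) ha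
          · rw [← h8] at h12
            exact absurd (Fin.succAbove_right_injective h12) ha'
          · exact absurd h12 (Fin.succAbove_ne i a)
        · rw [← h9]
          exact fun h12 => ha' ((del i β).injective h12)
        · exact fun h12 => ha ((del i β).injective h12)
    · have h12 := val_finRotate (β (Fin.last _))
      have h13 := congrArg Fin.val h8
      have h14 : (β (Fin.last _) : ℕ) ≠ m + 1 := fun h14 => h1 _ (Fin.ext h14)
      rw [if_neg (by omega), ← h4] at h12
      rw [val_succAbove] at h13
      ext
      rw [Fin.val_succ]
      split_ifs at h13 <;> omega
  · rintro ⟨h1, h2⟩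
    set c := del i β (Fin.last m) with hc
    have h3 : c ≠ Fin.last m := (h1 _).1
    have h4 : del i β c = Fin.last m := (h1 _).2
    have h5 : i ≠ Fin.last _ := by
      rw [← h2, ← Fin.succ_last]
      exact fun h6 => h3 (Fin.succ_injective _ h6)
    have h7 : finRotate _ (i.succAbove c) = i := by
      have h6 := c.2
      have h7 : (i : ℕ) = c + 1 := by rw [← h2, Fin.val_succ]
      have h8 : (i.succAbove c : ℕ) = c := by rw [val_succAbove, if_pos (by omega)]
      have h9 : (c : ℕ) ≠ m := fun h9 => h3 (Fin.ext h9)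
      ext
      rw [val_finRotate, h8, if_neg (by omega), h7]
    have h8 : β (i.succAbove c) = i := by rw [hβ, dual_apply_eq_iff, h7, h]
    have h9 : β i = Fin.last _ := by
      have := hs c
      rwa [h8, swap_apply_left, h4, hL h5, eq_comm] at this
    have h10 : β (Fin.last _) = i.succAbove c := by
      have := hs (Fin.last m)
      rw [← hc, hL h5, eq_comm, Equiv.swap_apply_eq_iff, h9, swap_apply_of_ne_of_ne] at this
      · exact this
      · exact Fin.succAbove_ne _ _
      · rw [← hL h5]
        exact fun h10 => h3 (Fin.succAbove_right_injective h10)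
    have h11 : ∀ a, a ≠ c → i.succAbove (del i β a) = β (i.succAbove a) := by
      intro a ha
      rw [hs, h9, swap_apply_of_ne_of_ne]
      · intro h11
        exact ha (Fin.succAbove_right_injective (β.injective (h11.trans h8.symm)))
      · intro h11
        rw [← h9] at h11
        exact Fin.succAbove_ne i a (β.injective h11)
    refine ⟨⟨fun x => ?_, by rw [h10, h8, h9], fun x => ?_⟩, by rw [h10, h7]⟩
    · induction x using Fin.succAboveCases i with
      | x => exact hβi
      | p a =>
        by_cases ha : a = c
        · rw [ha, h8]
          exact (Fin.succAbove_ne i c).symm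
        · rw [← h11 a ha]
          exact fun h12 => (h1 a).1 (Fin.succAbove_right_injective h12)
    · rw [h10, h8]
      induction x using Fin.succAboveCases i with
      | x => simp
      | p a =>
        by_cases ha : a = c
        · simp [ha]
        by_cases ha' : a = Fin.last m
        · simp [ha', hL h5]
        left
        rw [← h11 a ha, ← h11, (h1 a).2]
        exact fun h12 => ha' ((del i β).injective h12)

lemma mem_pointedTripodFamily_iff {m z w : ℕ} {i : Fin (m + 2)} {α : Perm (Fin (m + 2))}
    (h : α i = i) :
    α ∈ pointedTripodFamily (m + 1) (z + 1) w ∩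
        {α | finRotate _ (dual α (Fin.last _)) = i} ↔
      del i α ∈ (matchFamily (m + 1) z ∩ {π | (bigSet π).card = w}) ∩
        {π | (dual π (Fin.last m)).succ = i} := by
  have h1 := isMatching_dual_del_iff h
  have h2 : (∀ x, α x = x ↔ x = i) ↔ ∀ a, del i α a ≠ a := by
    rw [Fin.forall_iff_succAbove i]
    simp only [h, true_and, Fin.succAbove_ne, iff_false, Ne, del_apply_eq_self_iff,
      ne_comm.1 (Fin.succAbove_ne i _), and_false, or_false]
  simp only [pointedTripodFamily, matchFamily, Set.mem_inter_iff, Set.mem_ofPred_eq,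
    zPerm_del_of_eq h, Nat.add_right_cancel_iff, card_bigSet_del (show α (α i) = i by rw [h, h])]
  rw [← h2]
  constructor
  · rintro ⟨⟨h3, h4, h5, h6⟩, h7⟩
    rw [h7] at h6
    obtain ⟨h8, h9⟩ := h1.1 ⟨h5, h7.symm⟩
    exact ⟨⟨⟨h3, h6, h8⟩, h4⟩, h9⟩
  · rintro ⟨⟨⟨h3, h6, h8⟩, h4⟩, h9⟩
    obtain ⟨h5, h7⟩ := h1.2 ⟨h8, h9⟩
    refine ⟨⟨h3, h4, h5, ?_⟩, h7.symm⟩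
    rwa [← h7]

lemma ncard_eq_sum_fiber {α ι : Type*} [Finite α] [Fintype ι] (S : Set α) (f : α → ι) :
    S.ncard = ∑ i, (S ∩ {x | f x = i}).ncard := by
  classical
  have := Fintype.ofFinite α
  simp only [Set.ncard_eq_toFinset_card', Set.toFinset_inter, Set.toFinset_ofPred]
  rw [Finset.card_eq_sum_card_fiberwise (f := f) (t := Finset.univ)
    (fun i _ => Finset.mem_univ _)]
  refine Finset.sum_congr rfl fun i _ => ?_
  congr 1
  ext x
  simp

lemma ncard_pointedTripodFamily (m z w : ℕ) :
    (pointedTripodFamily (m + 1) (z + 1) w).ncard =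
      (matchFamily (m + 1) z ∩ {π | (bigSet π).card = w}).ncard := by
  rw [ncard_eq_sum_fiber _ fun α => finRotate _ (dual α (Fin.last _)),
    ncard_eq_sum_fiber (matchFamily (m + 1) z ∩ _) fun π => (dual π (Fin.last m)).succ]
  refine Finset.sum_congr rfl fun i _ => ?_
  rw [← ncard_del i i _ _ fun α => mem_pointedTripodFamily_iff]
  congr 1
  ext α
  simp only [Set.mem_inter_iff, Set.mem_ofPred_eq, pointedTripodFamily]
  constructor
  · rintro ⟨⟨h1, h2, h3, h4⟩, h5⟩
    exact ⟨⟨⟨h1, h2, h3, h4⟩, h5⟩, (h4 i).2 h5.symm⟩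
  · exact fun h => h.1

/-- Conjugation by the standard cycle. -/
def rot {n : ℕ} (α : Perm (Fin n)) : Perm (Fin n) := finRotate n * α * (finRotate n)⁻¹

lemma rot_apply {n : ℕ} (α : Perm (Fin n)) (i : Fin n) :
    rot α (finRotate n i) = finRotate n (α i) := by
  rw [rot, Perm.mul_apply, Perm.mul_apply, Perm.inv_eq_iff_eq.2 rfl]

lemma rot_bijective {n : ℕ} : Function.Bijective (rot (n := n)) :=
  (MulAut.conj (finRotate n)).bijective

lemma dual_rot {n : ℕ} (α : Perm (Fin n)) : dual (rot α) = rot (dual α) := by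
  simp [dual, rot, mul_assoc]

lemma zPerm_rot {n : ℕ} (α : Perm (Fin n)) : zPerm (rot α) = zPerm α := zPerm_conj _ _

lemma forall_finRotate {n : ℕ} {P : Fin n → Prop} : (∀ i, P (finRotate n i)) ↔ ∀ i, P i :=
  (finRotate n).forall_congr_right

lemma finRotate_mem_bigSet_rot {n : ℕ} {α : Perm (Fin n)} {i : Fin n} :
    finRotate n i ∈ bigSet (rot α) ↔ i ∈ bigSet α := by
  rw [mem_bigSet, mem_bigSet, rot_apply, rot_apply, (finRotate n).injective.ne_iff]

lemma card_bigSet_rot {n : ℕ} (α : Perm (Fin n)) : (bigSet (rot α)).card = (bigSet α).card := by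
  symm
  refine Finset.card_bij (fun i _ => finRotate n i) ?_ ?_ ?_
  · intro i hi
    exact finRotate_mem_bigSet_rot.2 hi
  · intro i _ j _ h
    exact (finRotate n).injective h
  · intro j hj
    obtain ⟨i, rfl⟩ := (finRotate n).surjective j
    exact ⟨i, finRotate_mem_bigSet_rot.1 hj, rfl⟩

lemma forall_rot_apply_ne {n : ℕ} {α : Perm (Fin n)} :
    (∀ i, rot α i ≠ i) ↔ ∀ i, α i ≠ i := by
  rw [← forall_finRotate]
  simp only [rot_apply, (finRotate n).injective.ne_iff]

lemma isMatching_rot {n : ℕ} {α : Perm (Fin n)} : IsMatching (rot α) ↔ IsMatching α := by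
  rw [IsMatching, ← forall_finRotate]
  simp only [rot_apply, (finRotate n).injective.ne_iff, (finRotate n).injective.eq_iff]
  rfl

lemma rot_mem_matchFamily {n z : ℕ} {π : Perm (Fin n)} :
    rot π ∈ matchFamily n z ↔ π ∈ matchFamily n z := by
  simp only [matchFamily, Set.mem_ofPred_eq, zPerm_rot, forall_rot_apply_ne, dual_rot,
    isMatching_rot]

/-- Averaging over the rotations of a family. -/
lemma mul_ncard_of_rot {n w : ℕ} {S : Set (Perm (Fin (n + 1)))}
    {f : Perm (Fin (n + 1)) → Finset (Fin (n + 1))} (hS : ∀ α, rot α ∈ S ↔ α ∈ S)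
    (hf : ∀ α i, finRotate _ i ∈ f (rot α) ↔ i ∈ f α) (hw : ∀ α ∈ S, (f α).card = w) :
    w * S.ncard = (n + 1) * (S ∩ {α | Fin.last n ∈ f α}).ncard := by
  classical
  have h1 : ∀ i, (S ∩ {α | finRotate _ i ∈ f α}).ncard = (S ∩ {α | i ∈ f α}).ncard := by
    intro i
    symm
    refine Set.ncard_congr (fun α _ => rot α) ?_ ?_ ?_
    · rintro α ⟨h1, h2⟩
      exact ⟨(hS α).2 h1, (hf α i).2 h2⟩
    · intro α β _ _ h
      exact rot_bijective.1 h
    · rintro β ⟨h1, h2⟩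
      obtain ⟨α, rfl⟩ := rot_bijective.2 β
      exact ⟨α, ⟨(hS α).1 h1, (hf α i).1 h2⟩, rfl⟩
  have h2 : ∀ i, (S ∩ {α | i ∈ f α}).ncard = (S ∩ {α | 0 ∈ f α}).ncard := by
    intro i
    induction i using Fin.induction with
    | zero => rfl
    | succ i ih =>
      rw [← ih, ← h1 i.castSucc]
      simp
  have h3 : ∀ i, (S ∩ {α | i ∈ f α}).ncard = ∑ α ∈ S.toFinset, if i ∈ f α then 1 else 0 := by
    intro i
    rw [← Finset.card_filter, Set.ncard_eq_toFinset_card']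
    congr 1
    ext α
    simp
  trans ∑ α ∈ S.toFinset, (f α).card
  · rw [Finset.sum_congr rfl (fun α hα => hw α (Set.mem_toFinset.1 hα)), Finset.sum_const,
      smul_eq_mul, Set.ncard_eq_toFinset_card', mul_comm]
  · trans ∑ i, (S ∩ {α | i ∈ f α}).ncard
    · simp_rw [h3]
      rw [Finset.sum_comm]
      simp
    · rw [Finset.sum_congr rfl fun i _ => (h2 i).trans (h2 (Fin.last n)).symm]
      simp

/-- The number of elements of `matchFamily n z` with `w` points off the cycles of length at most
two. -/
noncomputable def matchCount (n z w : ℕ) : ℕ :=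
  (matchFamily n z ∩ {π | (bigSet π).card = w}).ncard

lemma mul_matchCount (n z w : ℕ) :
    w * matchCount (n + 1) z w = (n + 1) *
      (matchFamily (n + 1) z ∩ {π | (bigSet π).card = w} ∩ {π | Fin.last _ ∈ bigSet π}).ncard :=
  mul_ncard_of_rot (fun α => by simp [rot_mem_matchFamily, card_bigSet_rot])
    (fun α i => finRotate_mem_bigSet_rot) fun α hα => hα.2

lemma matchCount_succ (m z w : ℕ) :
    (m + 3) * matchCount (m + 3) (z + 1) w =
      w * matchCount (m + 3) (z + 1) w + (m + 3) * matchCount (m + 1) z w := by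
  rw [mul_matchCount, ← mul_add]
  congr 1
  rw [matchCount, matchCount, ← ncard_pointedTripodFamily m z w,
    ← ncard_matchFamily_sdiff_last (m + 1), Set.ncard_inter_add_ncard_sdiff_eq_ncard]

lemma card_bigSet_of_mem_matchFamily {c : ℕ} {π : Perm (Fin (2 * c + 2))}
    (h : π ∈ matchFamily (2 * c + 2) c) : (bigSet π).card = 4 ∨ (bigSet π).card = 6 := by
  obtain ⟨b, h1, h2, h3, -⟩ := exists_card_bigSet h.2.1
  rw [h.1] at h1
  omega

lemma ncard_matchFamily_inter (c : ℕ) (T : Set (Perm (Fin (2 * c + 2)))) :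
    (matchFamily (2 * c + 2) c ∩ T).ncard =
      (matchFamily (2 * c + 2) c ∩ {π | (bigSet π).card = 4} ∩ T).ncard +
        (matchFamily (2 * c + 2) c ∩ {π | (bigSet π).card = 6} ∩ T).ncard := by
  rw [← Set.ncard_union_eq]
  · congr 1
    ext π
    have := card_bigSet_of_mem_matchFamily (π := π)
    simp only [Set.mem_union, Set.mem_inter_iff, Set.mem_ofPred_eq]
    tauto
  · rw [Set.disjoint_left]
    rintro π ⟨⟨-, h1⟩, -⟩ ⟨⟨-, h2⟩, -⟩
    rw [Set.mem_ofPred_eq] at h1 h2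
    omega

lemma ncard_matchFamily (c : ℕ) :
    (matchFamily (2 * c + 2) c).ncard = matchCount (2 * c + 2) c 4 + matchCount (2 * c + 2) c 6 := by
  simpa only [Set.inter_univ, matchCount] using ncard_matchFamily_inter c Set.univ

lemma mul_ncard_tripodFamily_last (c : ℕ) :
    (2 * c + 2) * (tripodFamily (2 * c + 1) c (Fin.last _)).ncard =
      4 * matchCount (2 * c + 2) c 4 + 6 * matchCount (2 * c + 2) c 6 := by
  rw [← ncard_matchFamily_inter_last, ncard_matchFamily_inter, mul_add, ← mul_matchCount,
    ← mul_matchCount]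

lemma matchCount_eq_zero {n z w : ℕ} (h : n < w) : matchCount n z w = 0 := by
  rw [matchCount, Set.ncard_eq_zero, Set.eq_empty_iff_forall_notMem]
  rintro π ⟨-, h1⟩
  have h2 := Finset.card_le_univ (bigSet π)
  rw [Set.mem_ofPred_eq] at h1
  rw [h1, Fintype.card_fin] at h2
  omega

lemma matchCount_four_base : matchCount 4 1 4 = 1 := by
  rw [matchCount, Set.ncard_eq_one]
  refine ⟨(finRotate 4)⁻¹, ?_⟩
  have h1 : ∀ π : Perm (Fin 4), (∀ i, π i ≠ i) → IsMatching (dual π) → (bigSet π).card = 4 →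
      π = (finRotate 4)⁻¹ := by
    unfold IsMatching
    decide
  ext π
  simp only [Set.mem_inter_iff, Set.mem_ofPred_eq, Set.mem_singleton_iff]
  constructor
  · rintro ⟨⟨-, h2, h3⟩, h4⟩
    exact h1 π h2 h3 h4
  · rintro rfl
    have h2 : ∀ i, (finRotate 4)⁻¹ i ≠ i := by decide
    have h3 : (bigSet (finRotate 4)⁻¹).card = 4 := by decide
    refine ⟨⟨?_, h2, ?_⟩, h3⟩
    · obtain ⟨b, h4, h5, h6, -⟩ := exists_card_bigSet h2
      omega
    · unfold IsMatching
      decide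

lemma matchCount_six_base : matchCount 6 2 6 = 1 := by
  rw [matchCount, Set.ncard_eq_one]
  refine ⟨(finRotate 6)⁻¹ ^ 2, ?_⟩
  have h1 : ∀ π : Perm (Fin 6), (∀ i, π (π (π i)) = i) → (∀ i, π i ≠ i) →
      IsMatching (dual π) → π = (finRotate 6)⁻¹ ^ 2 := by
    unfold IsMatching
    decide +kernel
  ext π
  simp only [Set.mem_inter_iff, Set.mem_ofPred_eq, Set.mem_singleton_iff]
  constructor
  · rintro ⟨⟨h, h2, h3⟩, h4⟩
    obtain ⟨b, h5, h6, h7, h8⟩ := exists_card_bigSet h2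
    have h9 : bigSet π = Finset.univ := Finset.eq_univ_of_card _ (by rw [h4, Fintype.card_fin])
    have h10 : ∀ i, π (π (π i)) = i := fun i => h8 (by omega) i (h9 ▸ Finset.mem_univ _)
    exact h1 π h10 h2 h3
  · rintro rfl
    have h2 : ∀ i, ((finRotate 6)⁻¹ ^ 2) i ≠ i := by decide
    have h3 : (bigSet ((finRotate 6)⁻¹ ^ 2)).card = 6 := by decide
    refine ⟨⟨?_, h2, ?_⟩, h3⟩
    · have h4 := zPerm_le_exc h2
      have h5 : exc ((finRotate 6)⁻¹ ^ 2) = 2 := by decide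
      have h6 : zPerm ((finRotate 6)⁻¹ ^ 2) ≠ 1 := by
        intro h6
        obtain ⟨h7, -⟩ := Nat.card_eq_one_iff_unique.1 h6
        have h8 : ((finRotate 6)⁻¹ ^ 2).SameCycle 0 1 := Quotient.exact (h7.elim ⟦0⟧ ⟦1⟧)
        obtain ⟨k, hk⟩ := h8.exists_nat_pow_eq
        have h9 : ∀ k : ℕ, ((((finRotate 6)⁻¹ ^ 2) ^ k) 0 : ℕ) % 2 = 0 := by
          intro k
          induction k with
          | zero => rfl
          | succ k ih =>
            have h10 : ∀ x : Fin 6, (x : ℕ) % 2 = 0 → (((finRotate 6)⁻¹ ^ 2) x : ℕ) % 2 = 0 := by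
              decide
            rw [pow_succ', Perm.mul_apply]
            exact h10 _ ih
        have h11 := h9 k
        rw [hk] at h11
        exact absurd h11 (by decide)
      have h12 := zPerm_pos ((finRotate 6)⁻¹ ^ 2)
      omega
    · unfold IsMatching
      decide

lemma matchCount_four (c : ℕ) : matchCount (2 * c + 2) c 4 = (c + 1).choose 2 := by
  induction c with
  | zero => rw [matchCount_eq_zero (by omega)]; rfl
  | succ c ih =>
    rcases Nat.eq_zero_or_pos c with rfl | hc
    · exact matchCount_four_base
    have h1 := matchCount_succ (2 * c + 1) c 4
    have h2 := Nat.choose_mul_succ_eq (c + 1) 2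
    change (2 * c + 4) * matchCount (2 * c + 4) (c + 1) 4 =
      4 * matchCount (2 * c + 4) (c + 1) 4 + (2 * c + 4) * matchCount (2 * c + 2) c 4 at h1
    change matchCount (2 * c + 4) (c + 1) 4 = _
    rw [ih] at h1
    have h3 : c + 1 + 1 - 2 = c := by omega
    rw [h3] at h2
    apply Nat.eq_of_mul_eq_mul_left hc
    linarith

lemma matchCount_six (c : ℕ) : matchCount (2 * c + 2) c 6 = (c + 1).choose 3 := by
  induction c with
  | zero => rw [matchCount_eq_zero (by omega)]; rfl
  | succ c ih =>
    rcases Nat.lt_or_ge c 2 with hc | hc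
    · interval_cases c
      · rw [matchCount_eq_zero (by omega)]; rfl
      · exact matchCount_six_base
    have h1 := matchCount_succ (2 * c + 1) c 6
    have h2 := Nat.choose_mul_succ_eq (c + 1) 3
    change (2 * c + 4) * matchCount (2 * c + 4) (c + 1) 6 =
      6 * matchCount (2 * c + 4) (c + 1) 6 + (2 * c + 4) * matchCount (2 * c + 2) c 6 at h1
    change matchCount (2 * c + 4) (c + 1) 6 = _
    rw [ih] at h1
    obtain ⟨e, rfl⟩ := Nat.exists_eq_add_of_le hc
    have h3 : 2 + e + 1 + 1 - 3 = e + 1 := by omega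
    rw [h3] at h2
    apply Nat.eq_of_mul_eq_mul_left (Nat.succ_pos e)
    rw [Nat.succ_eq_add_one]
    linarith

lemma mem_family_false_iff {j c c' : ℕ} {α : Perm (Fin (c + c' + 1))} :
    α ∈ family j (c + c' + 1) c c' (fun _ => False) (fun _ => False) ↔
      c + j = c' + 1 ∧ zPerm α = c ∧ zPerm (dual α) = c' ∧ (∀ i, α i ≠ i) ∧
        ∀ i, dual α i ≠ i := by
  simp only [family, Set.mem_ofPred_eq]
  have h0 := exc_dual α
  constructor
  · rintro ⟨h1, h2, h3, h4, h5⟩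
    have h6 := zPerm_le_exc h4
    have h7 := zPerm_le_exc h5
    exact ⟨by omega, h1, h2, h4, h5⟩
  · rintro ⟨h3, h1, h2, h4, h5⟩
    have h6 := zPerm_le_exc h4
    have h7 := zPerm_le_exc h5
    exact ⟨h1, h2, by omega, h4, h5⟩

lemma coreCount_eq_zero {j c c' : ℕ} (h : c + j ≠ c' + 1) : coreCount j c c' = 0 := by
  rw [coreCount, Set.ncard_eq_zero, Set.eq_empty_iff_forall_notMem]
  intro α hα
  exact h (mem_family_false_iff.1 hα).1

lemma coreCount_two (c : ℕ) : coreCount 2 c (c + 1) = (c + 2).choose 3 := by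
  have h1 : family 2 (c + (c + 1) + 1) c (c + 1) (fun _ => False) (fun _ => False) =
      matchFamily (c + (c + 1) + 1) c := by
    ext α
    rw [mem_family_false_iff]
    simp only [matchFamily, Set.mem_ofPred_eq]
    constructor
    · rintro ⟨-, h1, h2, h3, h4⟩
      refine ⟨h1, h3, fun i => ⟨h4 i, ?_⟩⟩
      obtain ⟨b, h5, h6, -, -⟩ := exists_card_bigSet h4
      exact bigSet_eq_empty_iff.1 (Finset.card_eq_zero.1 (by omega)) i
    · rintro ⟨h1, h2, h3⟩
      have h4 : ∀ i, dual α i ≠ i := fun i => (h3 i).1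
      obtain ⟨b, h5, h6, h7, -⟩ := exists_card_bigSet h4
      rw [bigSet_eq_empty_iff.2 fun i => (h3 i).2, Finset.card_empty] at h5 h6
      exact ⟨trivial, h1, by omega, h2, h4⟩
  have h2 : c + (c + 1) + 1 = 2 * c + 2 := by omega
  rw [coreCount, h1, h2, ncard_matchFamily, matchCount_four, matchCount_six]
  exact (Nat.choose_succ_succ (c + 1) 2).symm

lemma coreCount_one (c : ℕ) : 6 * coreCount 1 c c = c * (c + 1) * (2 * c + 1) := by
  have h1 : family 1 (c + c + 1) c c (fun _ => False) (fun _ => False) ∩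
      {α | Fin.last _ ∈ bigSet (dual α)} = tripodFamily (c + c + 1) c (Fin.last _) := by
    ext α
    rw [Set.mem_inter_iff, mem_family_false_iff]
    simp only [tripodFamily, Set.mem_ofPred_eq]
    constructor
    · rintro ⟨⟨-, h1, h2, h3, h4⟩, h8⟩
      obtain ⟨b, h5, h6, -, -⟩ := exists_card_bigSet h4
      obtain ⟨h9, h10⟩ := eq_orbit_of_card_le_three h4 (fun i => apply_mem_bigSet.2)
        (by omega) h8 (mem_bigSet.1 h8)
      refine ⟨h1, h3, h4, h10, fun i => ?_⟩
      by_cases hi : i ∈ bigSet (dual α)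
      · rw [h9] at hi
        simpa using Or.inr hi
      · exact Or.inl (not_not.1 fun h => hi (mem_bigSet.2 h))
    · rintro ⟨h1, h3, h4, h5, h6⟩
      have h8 : Fin.last _ ∈ bigSet (dual α) := mem_bigSet.2 fun h => by
        rw [h] at h5
        exact h4 _ h5
      have h9 : bigSet (dual α) ⊆ {Fin.last _, dual α (Fin.last _),
          dual α (dual α (Fin.last _))} := by
        intro i hi
        simpa [mem_bigSet.1 hi] using h6 i
      have h10 := Finset.card_le_card h9
      rw [card_orbit_three h4 (mem_bigSet.1 h8)] at h10
      obtain ⟨b, h11, h12, h13, -⟩ := exists_card_bigSet h4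
      have h14 := Finset.card_ne_zero_of_mem h8
      exact ⟨⟨trivial, h1, by omega, h3, h4⟩, h8⟩
  have h2 : 3 * coreCount 1 c c = (c + c + 1) * (tripodFamily (c + c + 1) c (Fin.last _)).ncard := by
    rw [← h1]
    refine mul_ncard_of_rot (f := fun α => bigSet (dual α)) (fun α => ?_) (fun α i => ?_)
      fun α hα => ?_
    · rw [mem_family_false_iff, mem_family_false_iff]
      simp only [zPerm_rot, dual_rot, forall_rot_apply_ne]
    · rw [dual_rot, finRotate_mem_bigSet_rot]
    · obtain ⟨-, h1, h2, h3, h4⟩ := mem_family_false_iff.1 hα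
      obtain ⟨b, h5, h6, h7, -⟩ := exists_card_bigSet h4
      omega
  have h3 := mul_ncard_tripodFamily_last c
  rw [matchCount_four, matchCount_six] at h3
  rw [← two_mul] at h2
  set t := (tripodFamily (2 * c + 1) c (Fin.last _)).ncard
  have h4 := Nat.add_one_mul_choose_eq c 1
  have h5 := Nat.add_one_mul_choose_eq c 2
  have h6 : 2 * c.choose 2 + c = c * c := by
    cases c with
    | zero => rfl
    | succ c =>
      have := Nat.add_one_mul_choose_eq c 1
      rw [Nat.choose_one_right] at this
      simp only [Nat.reduceAdd] at this
      nlinarith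
  rw [Nat.choose_one_right] at h4
  simp only [Nat.reduceAdd] at h4 h5
  have h7 : t = c + c.choose 2 := by
    apply Nat.eq_of_mul_eq_mul_left (show 0 < 2 * c + 2 by omega)
    linarith
  have h8 : 2 * t = c * (c + 1) := by linarith
  calc 6 * coreCount 1 c c = 2 * ((2 * c + 1) * t) := by linarith
    _ = (2 * c + 1) * (2 * t) := by ring
    _ = c * (c + 1) * (2 * c + 1) := by rw [h8]; ring

/-- The binomial coefficient `N.choose (k - x)`, taken to be zero for `k < x`. -/
def shiftChoose (N k x : ℕ) : ℤ := if x ≤ k then (N.choose (k - x) : ℤ) else 0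

lemma shiftChoose_of_lt {N k x : ℕ} (h : k < x) : shiftChoose N k x = 0 := if_neg (by omega)

lemma sub_mul_shiftChoose (N k x : ℕ) :
    ((N : ℤ) + 1 - (k - x)) * shiftChoose (N + 1) k x = (N + 1) * shiftChoose N k x := by
  rw [shiftChoose, shiftChoose]
  split_ifs with h
  · obtain ⟨i, rfl⟩ := Nat.exists_eq_add_of_le h
    rw [Nat.add_sub_cancel_left]
    push_cast
    rcases Nat.lt_or_ge (N + 1) i with h1 | h1
    · rw [Nat.choose_eq_zero_of_lt h1, Nat.choose_eq_zero_of_lt (by omega)]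
      simp
    · have h2 := Nat.choose_mul_succ_eq N i
      zify [h1] at h2
      linarith
  · simp

lemma mul_shiftChoose (N k x : ℕ) :
    ((k : ℤ) - x) * shiftChoose (N + 1) k x = (N + 1) * shiftChoose N k (x + 1) := by
  rcases Nat.lt_or_ge k (x + 1) with h | h
  · rw [shiftChoose_of_lt h, shiftChoose]
    split_ifs with h1
    · rw [show k = x by omega]
      simp
    · simp
  · rw [shiftChoose, shiftChoose, if_pos (by omega), if_pos h]
    obtain ⟨i, rfl⟩ := Nat.exists_eq_add_of_le h
    rw [Nat.add_sub_cancel_left, show x + 1 + i - x = i + 1 by omega]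
    have h2 := Nat.add_one_mul_choose_eq N i
    zify at h2
    push_cast
    linarith

lemma mul_shiftChoose_mul_shiftChoose (N k k' x : ℕ) :
    ((N : ℤ) + 1 - (k - x) - (k' - x)) * (shiftChoose (N + 1) k x * shiftChoose (N + 1) k' x) =
      (N + 1) * (shiftChoose N k x * shiftChoose N k' x -
        shiftChoose N k (x + 1) * shiftChoose N k' (x + 1)) := by
  have h1 := sub_mul_shiftChoose N k x
  have h2 := sub_mul_shiftChoose N k' x
  have h3 := mul_shiftChoose N k x
  have h4 := mul_shiftChoose N k' x
  have h5 : (N : ℤ) + 1 ≠ 0 := by positivity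
  apply mul_left_cancel₀ h5
  set b := shiftChoose (N + 1) k x
  set b' := shiftChoose (N + 1) k' x
  have h6 : ((N : ℤ) + 1) * ((N + 1) * (shiftChoose N k x * shiftChoose N k' x -
        shiftChoose N k (x + 1) * shiftChoose N k' (x + 1))) =
      ((N + 1) * shiftChoose N k x) * ((N + 1) * shiftChoose N k' x) -
        ((N + 1) * shiftChoose N k (x + 1)) * ((N + 1) * shiftChoose N k' (x + 1)) := by ring
  rw [h6, ← h1, ← h2, ← h3, ← h4]
  ring

lemma sum_shiftChoose_odd (k k' : ℕ) (h : 1 ≤ k + k') :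
    ∑ x ∈ Finset.range (k + 1), shiftChoose (k + k' + 1) k x * shiftChoose (k + k' + 1) k' x *
        (x * (x + 1) * (2 * x + 1)) =
      (k + k' + 1) * (k + k') * (shiftChoose (k + k' - 1) k 1 * shiftChoose (k + k' - 1) k' 1) := by
  obtain ⟨m, hm⟩ := Nat.exists_eq_add_of_le' h
  have hm' : (k : ℤ) + k' = m + 1 := by exact_mod_cast hm
  rw [hm, Nat.add_sub_cancel, hm']
  set W : ℕ → ℤ := fun x => (m + 1 + 1) * (x * (x + 1) *
      (shiftChoose (m + 1) k x * shiftChoose (m + 1) k' x) +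
    (m + 1) * (shiftChoose m k (x + 1) * shiftChoose m k' (x + 1))) with hW
  have h1 : ∀ x : ℕ, shiftChoose (m + 1 + 1) k x * shiftChoose (m + 1 + 1) k' x *
      (x * (x + 1) * (2 * x + 1)) = W x - W (x + 1) := by
    intro x
    have h2 := mul_shiftChoose_mul_shiftChoose (m + 1) k k' x
    have h3 := mul_shiftChoose_mul_shiftChoose m k k' (x + 1)
    rw [hW]
    push_cast at h2 h3 ⊢
    rw [show (m : ℤ) + 1 + 1 - (k - x) - (k' - x) = 2 * x + 1 by linarith] at h2
    rw [show (m : ℤ) + 1 - (k - (x + 1)) - (k' - (x + 1)) = 2 * (x + 1) by linarith] at h3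
    linear_combination (x * (x + 1) : ℤ) * h2 + (m + 1 + 1 : ℤ) * h3
  rw [Finset.sum_congr rfl fun x _ => h1 x, Finset.sum_range_sub', hW]
  simp [shiftChoose_of_lt (show k < k + 1 by omega), shiftChoose_of_lt (show k < k + 1 + 1 by omega)]
  ring

lemma two_mul_sum_shiftChoose_even (k k' : ℕ) :
    2 * ∑ x ∈ Finset.range (k + 1), shiftChoose (k + k' + 2) k x * shiftChoose (k + k' + 2) k' x *
        (x * (x + 1) * (x + 2)) =
      (k + k' + 2) * (k + k' + 1) * (shiftChoose (k + k') k 1 * shiftChoose (k + k') k' 1) := by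
  set W : ℕ → ℤ := fun x => (k + k' + 2) * (x * (x + 2) *
      (shiftChoose (k + k' + 1) k x * shiftChoose (k + k' + 1) k' x) +
    (k + k' + 1) * (shiftChoose (k + k') k (x + 1) * shiftChoose (k + k') k' (x + 1))) with hW
  have h1 : ∀ x : ℕ, 2 * (shiftChoose (k + k' + 2) k x * shiftChoose (k + k' + 2) k' x *
      (x * (x + 1) * (x + 2))) = W x - W (x + 1) := by
    intro x
    have h2 := mul_shiftChoose_mul_shiftChoose (k + k' + 1) k k' x
    have h3 := mul_shiftChoose_mul_shiftChoose (k + k') k k' (x + 1)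
    rw [hW]
    push_cast at h2 h3 ⊢
    rw [show (k : ℤ) + k' + 1 + 1 - (k - x) - (k' - x) = 2 * x + 2 by ring] at h2
    rw [show (k : ℤ) + k' + 1 - (k - (x + 1)) - (k' - (x + 1)) = 2 * x + 3 by ring] at h3
    linear_combination (x * (x + 2) : ℤ) * h2 + (k + k' + 2 : ℤ) * h3
  rw [Finset.mul_sum, Finset.sum_congr rfl fun x _ => h1 x, Finset.sum_range_sub', hW]
  simp [shiftChoose_of_lt (show k < k + 1 by omega), shiftChoose_of_lt (show k < k + 1 + 1 by omega)]
  ring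

lemma card_genusOne {n j k k' : ℕ} (h : n = k + k' + 1) :
    Nat.card {α : Perm (Fin n) // IsGenusOne α ∧ backPointCount α = j ∧ zPerm α = k} =
      (family j n k k' (fun _ => True) (fun _ => True)).ncard := by
  rw [← Nat.card_coe_set_eq]
  refine Nat.card_congr (Equiv.subtypeEquivRight fun α => ?_)
  have h1 := backPointCount_add α
  change zPerm α + zPerm (dual α) + 2 = n + 1 ∧ _ ↔
    zPerm α = k ∧ zPerm (dual α) = k' ∧ exc α + j = k' + 1 ∧ _
  simp only [implies_true, and_true]
  omega

lemma card_genusOne_eq_zero {n j k : ℕ} (h : n < k + 2) :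
    Nat.card {α : Perm (Fin n) // IsGenusOne α ∧ backPointCount α = j ∧ zPerm α = k} = 0 := by
  rw [Nat.card_eq_zero]
  left
  constructor
  rintro ⟨α, h1, -, h2⟩
  change zPerm α + zPerm (dual α) + 2 = n + 1 at h1
  cases n with
  | zero => omega
  | succ n =>
    have := zPerm_pos (dual α)
    omega

lemma sum_mul_coreCount_one (n k k' : ℕ) :
    ((6 * ∑ c ∈ Finset.range (k + 1), ∑ c' ∈ Finset.range (k' + 1),
      n.choose (k - c) * n.choose (k' - c') * coreCount 1 c c' : ℕ) : ℤ) =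
    ∑ c ∈ Finset.range (k + 1), shiftChoose n k c * shiftChoose n k' c *
      (c * (c + 1) * (2 * c + 1)) := by
  rw [Finset.mul_sum]
  push_cast
  refine Finset.sum_congr rfl fun c hc => ?_
  rw [Finset.mem_range] at hc
  have h1 := coreCount_one c
  zify at h1
  rw [shiftChoose, if_pos (by omega)]
  rcases Nat.lt_or_ge k' c with h | h
  · rw [shiftChoose_of_lt h, Finset.sum_eq_zero]
    · simp
    · intro x hx
      rw [Finset.mem_range] at hx
      rw [coreCount_eq_zero (by omega)]
      simp
  · rw [Finset.sum_eq_single c, ← h1, shiftChoose, if_pos h]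
    · ring
    · intro x _ hx
      rw [coreCount_eq_zero (by omega)]
      simp
    · intro h2
      exact absurd (Finset.mem_range.2 (by omega)) h2

lemma sum_mul_coreCount_two (n k k' : ℕ) :
    ((6 * ∑ c ∈ Finset.range (k + 1), ∑ c' ∈ Finset.range (k' + 1 + 1),
      n.choose (k - c) * n.choose (k' + 1 - c') * coreCount 2 c c' : ℕ) : ℤ) =
    ∑ c ∈ Finset.range (k + 1), shiftChoose n k c * shiftChoose n k' c *
      (c * (c + 1) * (c + 2)) := by
  rw [Finset.mul_sum]
  push_cast
  refine Finset.sum_congr rfl fun c hc => ?_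
  rw [Finset.mem_range] at hc
  have h1 : 6 * (coreCount 2 c (c + 1) : ℤ) = c * (c + 1) * (c + 2) := by
    have h2 := Nat.add_one_mul_choose_eq (c + 1) 2
    have h3 := Nat.add_one_mul_choose_eq c 1
    rw [Nat.choose_one_right] at h3
    rw [coreCount_two]
    zify at h2 h3
    push_cast at h2 h3
    linear_combination (-2 : ℤ) * h2 - (c + 2 : ℤ) * h3
  rw [shiftChoose, if_pos (by omega)]
  rcases Nat.lt_or_ge k' c with h | h
  · rw [shiftChoose_of_lt h, Finset.sum_eq_zero]
    · simp
    · intro x hx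
      rw [Finset.mem_range] at hx
      rw [coreCount_eq_zero (by omega)]
      simp
  · rw [Finset.sum_eq_single (c + 1), ← h1, shiftChoose, if_pos h, Nat.add_sub_add_right]
    · ring
    · intro x _ hx
      rw [coreCount_eq_zero (by omega)]
      simp
    · intro h2
      exact absurd (Finset.mem_range.2 (by omega)) h2

lemma two_mul_choose_two (m : ℕ) : 2 * ((m + 2).choose 2 : ℤ) = (m + 2) * (m + 1) := by
  have := Nat.add_one_mul_choose_eq (m + 1) 1
  rw [Nat.choose_one_right] at this
  zify at this
  linear_combination -this

lemma ncard_family_one (a b : ℕ) :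
    3 * (family 1 (a + b + 3) (a + 1) (b + 1) (fun _ => True) (fun _ => True)).ncard =
      (a + b + 3).choose 2 * (a + b + 1).choose (a + 1) * (a + b + 1).choose a := by
  rw [ncard_family_eq_sum 1 _ _ _ (by omega)]
  have h1 := sum_mul_coreCount_one (a + b + 3) (a + 1) (b + 1)
  have h2 := sum_shiftChoose_odd (a + 1) (b + 1) (by omega)
  have h3 := two_mul_choose_two (a + b + 1)
  rw [show a + 1 + (b + 1) + 1 = a + b + 3 by omega, ← h1,
    show a + 1 + (b + 1) - 1 = a + b + 1 by omega, shiftChoose, shiftChoose, if_pos (by omega),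
    if_pos (by omega), Nat.add_sub_cancel, Nat.add_sub_cancel,
    Nat.choose_symm_of_eq_add (show a + b + 1 = b + (a + 1) by omega)] at h2
  zify
  push_cast at h2 h3 ⊢
  rw [show a + b + 1 + 2 = a + b + 3 by omega] at h3
  apply mul_left_cancel₀ (two_ne_zero (α := ℤ))
  linear_combination h2 -
    ((a + b + 1).choose (a + 1) : ℤ) * ((a + b + 1).choose a : ℤ) * h3

lemma ncard_family_two (a b : ℕ) :
    6 * (family 2 (a + b + 3) (a + 1) (b + 1) (fun _ => True) (fun _ => True)).ncard =
      (a + b + 3).choose 2 * (a + b + 1).choose (a + 2) * (a + b + 1).choose a := by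
  rw [ncard_family_eq_sum 2 _ _ _ (by omega)]
  have h1 := sum_mul_coreCount_two (a + b + 3) (a + 1) b
  have h2 := two_mul_sum_shiftChoose_even (a + 1) b
  have h3 := two_mul_choose_two (a + b + 1)
  have h4 : shiftChoose (a + b + 1) b 1 = (a + b + 1).choose (a + 2) := by
    rw [shiftChoose]
    split_ifs with h
    · rw [Nat.choose_symm_of_eq_add (show a + b + 1 = b - 1 + (a + 2) by omega)]
    · rw [Nat.choose_eq_zero_of_lt (by omega)]
      simp
  rw [show a + 1 + b + 2 = a + b + 3 by omega, ← h1, show a + 1 + b = a + b + 1 by omega, h4,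
    shiftChoose, if_pos (by omega), Nat.add_sub_cancel] at h2
  zify
  push_cast at h2 h3 ⊢
  rw [show a + b + 1 + 2 = a + b + 3 by omega] at h3
  apply mul_left_cancel₀ (two_ne_zero (α := ℤ))
  linear_combination h2 -
    ((a + b + 1).choose (a + 2) : ℤ) * ((a + b + 1).choose a : ℤ) * h3

end GenusOne

/-- For `n ≥ 2` and `k ≥ 1`, the numbers `p₁(n,k)` and `p₂(n,k)` of genus-one
permutations of `{1,…,n}` with `k` cycles and exactly one (resp. two) back points
satisfy `3·p₁(n,k) = C(n,2)·C(n−2,k)·C(n−2,k−1)` and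
`6·p₂(n,k) = C(n,2)·C(n−2,k+1)·C(n−2,k−1)`. -/
theorem genus_one_backpoint_counts (n k : ℕ) (hn : 2 ≤ n) (hk : 1 ≤ k) :
    3 * Nat.card {α : Equiv.Perm (Fin n) //
          IsGenusOne α ∧ backPointCount α = 1 ∧ zPerm α = k} =
        n.choose 2 * (n - 2).choose k * (n - 2).choose (k - 1) ∧
    6 * Nat.card {α : Equiv.Perm (Fin n) //
          IsGenusOne α ∧ backPointCount α = 2 ∧ zPerm α = k} =
        n.choose 2 * (n - 2).choose (k + 1) * (n - 2).choose (k - 1) := by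
  rcases Nat.lt_or_ge n (k + 2) with h | h
  · rw [GenusOne.card_genusOne_eq_zero h, GenusOne.card_genusOne_eq_zero h,
      Nat.choose_eq_zero_of_lt (show n - 2 < k by omega),
      Nat.choose_eq_zero_of_lt (show n - 2 < k + 1 by omega)]
    simp
  · obtain ⟨a, rfl⟩ := Nat.exists_eq_add_of_le' hk
    obtain ⟨b, rfl⟩ := Nat.exists_eq_add_of_le h
    have h1 : a + 1 + 2 + b = a + b + 3 := by omega
    have h2 : a + b + 3 = a + 1 + (b + 1) + 1 := by omega
    rw [h1, GenusOne.card_genusOne h2, GenusOne.card_genusOne h2, GenusOne.ncard_family_one,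
      GenusOne.ncard_family_two]
    exact ⟨rfl, rfl⟩
end

section
/- For all integers n ≥ 0 and k ≥ 2, the number r₀(n,k) of reduced set partitions of {1,…,n} of genus 1 having exactly k blocks is r₀(n,k) = C(n,2k)·C(k+1,3), where C(a,b) denotes the binomial coefficient. -/
/-- The points `i, ζ i, …, ζᵖ i` (where `ζ = finRotate n`) form a trivial cycle of `α`:
a cycle consisting of cyclically consecutive points, each sent to the cyclically next
one, the last back to the first. -/
def IsTrivialCycleAt {n : ℕ} (α : Equiv.Perm (Fin n)) (i : Fin n) (p : ℕ) : Prop :=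
  p < n ∧ (∀ t : ℕ, t < p → α ((finRotate n ^ t) i) = (finRotate n ^ (t + 1)) i) ∧
    α ((finRotate n ^ p) i) = i

/-- `α` is reduced: it contains no trivial cycle. -/
def IsReducedPerm {n : ℕ} (α : Equiv.Perm (Fin n)) : Prop :=
  ¬ ∃ (i : Fin n) (p : ℕ), IsTrivialCycleAt α i p

/-- The number of cycles is the cardinality of the image of any function whose fibres are the
cycles. -/
theorem zPerm_eq_card_image {n : ℕ} {β : Type*} [DecidableEq β] (α : Equiv.Perm (Fin n))
    (h : Fin n → β) (hh : ∀ x y, h x = h y ↔ α.SameCycle x y) :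
    zPerm α = (Finset.univ.image h).card := by
  classical
  rw [zPerm, ← Set.toFinset_range, ← Nat.card_eq_card_toFinset]
  refine Nat.card_congr (Equiv.ofBijective
    (Quotient.lift (fun x => (⟨h x, x, rfl⟩ : Set.range h)) ?_) ⟨?_, ?_⟩)
  · intro a b hab
    exact Subtype.ext ((hh a b).2 hab)
  · rintro ⟨a⟩ ⟨b⟩ hab
    exact Quotient.sound ((hh a b).1 (congrArg Subtype.val hab))
  · rintro ⟨_, x, rfl⟩
    exact ⟨Quotient.mk _ x, rfl⟩

theorem zPerm_eq_cycleType {n : ℕ} (α : Equiv.Perm (Fin n)) :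
    zPerm α + α.cycleType.sum = α.cycleType.card + n := by
  classical
  have key : zPerm α = α.cycleType.card + (Finset.univ.filter fun x => α x = x).card := by
    rw [zPerm_eq_card_image α
      (fun x => if α x = x then (Sum.inr x : Equiv.Perm (Fin n) ⊕ Fin n)
        else Sum.inl (α.cycleOf x))]
    · rw [Equiv.Perm.cycleType_def, Multiset.card_map, ← Finset.card_def, ← Finset.card_disjSum]
      congr 1
      ext (c | x)
      · simp only [Finset.mem_image, Finset.mem_univ, true_and, Finset.inl_mem_disjSum]
        constructor
        · rintro ⟨x, hx⟩
          split_ifs at hx with h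
          cases hx
          rw [Equiv.Perm.cycleOf_mem_cycleFactorsFinset_iff]
          simpa using h
        · intro hc
          obtain ⟨x, hx⟩ := (Equiv.Perm.mem_cycleFactorsFinset_iff.1 hc).1.nonempty_support
          have hcx := Equiv.Perm.cycle_is_cycleOf hx hc
          refine ⟨x, ?_⟩
          have : α x ≠ x := by
            have := Equiv.Perm.mem_cycleFactorsFinset_support_le hc hx
            simpa using this
          rw [if_neg this, ← hcx]
      · simp only [Finset.mem_image, Finset.mem_univ, true_and, Finset.inr_mem_disjSum,
          Finset.mem_filter]
        constructor
        · rintro ⟨y, hy⟩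
          split_ifs at hy with h
          cases hy
          exact h
        · intro hx
          exact ⟨x, by rw [if_pos hx]⟩
    · intro x y
      by_cases hx : α x = x <;> by_cases hy : α y = y
      · simp only [hx, hy, if_true, Sum.inr.injEq]
        refine ⟨fun h => h ▸ Equiv.Perm.SameCycle.refl _ _, fun h => h.eq_of_left hx⟩
      · simp only [hx, hy, if_true, if_false, reduceCtorEq, false_iff]
        intro h
        exact hy ((h.eq_of_left hx) ▸ hx)
      · simp only [hx, hy, if_true, if_false, reduceCtorEq, false_iff]
        intro h
        exact hx ((h.eq_of_right hy) ▸ hy)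
      · simp only [hx, hy, if_false, Sum.inl.injEq]
        exact (Equiv.Perm.sameCycle_iff_cycleOf_eq_of_mem_support (by simpa using hx)
          (by simpa using hy)).symm
  have h2 : (Finset.univ.filter fun x => α x = x).card + α.support.card = n := by
    have := Finset.card_filter_add_card_filter_not (s := (Finset.univ : Finset (Fin n)))
      (fun x => α x = x)
    simpa [Equiv.Perm.support] using this
  rw [key, Equiv.Perm.sum_cycleType]
  omega

theorem zPerm_inv {n : ℕ} (α : Equiv.Perm (Fin n)) : zPerm α⁻¹ = zPerm α := by
  classical
  have h1 := zPerm_eq_cycleType α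
  have h2 := zPerm_eq_cycleType α⁻¹
  rw [Equiv.Perm.cycleType_inv] at h2
  omega

/-- The sign of a permutation is determined by the parity of its number of cycles. -/
theorem sign_eq_zPerm {n : ℕ} (α : Equiv.Perm (Fin n)) :
    Equiv.Perm.sign α = (-1) ^ (n + zPerm α) := by
  classical
  rw [Equiv.Perm.sign_of_cycleType]
  have h1 := zPerm_eq_cycleType α
  have : n + zPerm α + 2 * α.cycleType.sum = α.cycleType.sum + α.cycleType.card + 2 * n := by omega
  have h3 : ((-1 : ℤˣ)) ^ (n + zPerm α + 2 * α.cycleType.sum) =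
      (-1) ^ (α.cycleType.sum + α.cycleType.card + 2 * n) := by rw [this]
  rw [pow_add _ _ (2 * _), pow_add _ _ (2 * n), pow_mul, pow_mul] at h3
  simpa using h3.symm

/-- The points whose image is the smallest element of its cycle are as many as the cycles. -/
theorem zPerm_eq_card_min {n : ℕ} (α : Equiv.Perm (Fin n)) :
    zPerm α = Nat.card {i : Fin n // ∀ j, α.SameCycle i j → α i ≤ j} := by
  classical
  symm
  rw [zPerm]
  refine Nat.card_congr (Equiv.ofBijective
    (fun i => (Quotient.mk (cycleSetoid α) i.1)) ⟨?_, ?_⟩)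
  · rintro ⟨a, ha⟩ ⟨b, hb⟩ hab
    have hab : α.SameCycle a b := Quotient.exact hab
    apply Subtype.ext
    apply α.injective
    apply le_antisymm
    · exact ha _ (Equiv.Perm.sameCycle_apply_right.2 hab)
    · exact hb _ (Equiv.Perm.sameCycle_apply_right.2 hab.symm)
  · rintro ⟨x⟩
    obtain ⟨m, hm, hmin⟩ := Finset.exists_min_image
      (Finset.univ.filter fun y => α.SameCycle x y) id
      ⟨x, by simpa using Equiv.Perm.SameCycle.refl α x⟩
    simp only [Finset.mem_filter, Finset.mem_univ, true_and, id] at hm hmin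
    refine ⟨⟨α⁻¹ m, ?_⟩, ?_⟩
    · intro j hj
      have h1 : α (α⁻¹ m) = m := α.apply_symm_apply m
      rw [h1]
      refine hmin j (hm.trans ?_)
      rwa [← Equiv.Perm.sameCycle_apply_left, h1] at hj
    · refine Quotient.sound (show α.SameCycle (α⁻¹ m) x from ?_)
      rw [← Equiv.Perm.sameCycle_apply_left, show α (α⁻¹ m) = m from α.apply_symm_apply m]
      exact hm.symm

theorem zPerm_add_backPointCount {n : ℕ} (α : Equiv.Perm (Fin n)) :
    zPerm α + backPointCount α = (Finset.univ.filter fun i => α i ≤ i).card := by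
  classical
  simp only [zPerm_eq_card_min, backPointCount, IsBackPoint]
  rw [Nat.card_eq_fintype_card, Nat.card_eq_fintype_card,
    Fintype.card_subtype, Fintype.card_subtype, ← Finset.card_union_of_disjoint]
  · congr 1
    ext i
    simp only [Finset.mem_union, Finset.mem_filter, Finset.mem_univ, true_and]
    constructor
    · rintro (h | h)
      · exact h i (Equiv.Perm.SameCycle.refl _ _)
      · exact h.1.le
    · intro h
      by_cases hm : ∀ j, α.SameCycle i j → α i ≤ j
      · exact Or.inl hm
      · push Not at hm
        refine Or.inr ⟨lt_of_le_of_ne h fun h' => ?_, hm⟩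
        obtain ⟨j, hj, hlt⟩ := hm
        have : i = j := hj.eq_of_left h'
        rw [← this, h'] at hlt
        exact lt_irrefl _ hlt
  · rw [Finset.disjoint_left]
    intro i hi hi'
    simp only [Finset.mem_filter, Finset.mem_univ, true_and] at hi hi'
    obtain ⟨-, j, hj, hlt⟩ := hi'
    exact absurd (hi j hj) (not_le.2 hlt)

theorem isPartitionPerm_iff {n : ℕ} (α : Equiv.Perm (Fin n)) :
    IsPartitionPerm α ↔ (Finset.univ.filter fun i => α i ≤ i).card = zPerm α := by
  have h := zPerm_add_backPointCount α
  have h0 : backPointCount α = 0 ↔ IsPartitionPerm α := by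
    rw [backPointCount, Finite.card_eq_zero_iff, isEmpty_subtype, IsPartitionPerm]
  rw [← h0]
  omega

theorem sameCycle_of_map {α β : Type*} [Finite α] {f : Equiv.Perm α} {g : Equiv.Perm β} (r : α → β)
    (h : ∀ y, g.SameCycle (r y) (r (f y))) {x y : α} (hxy : f.SameCycle x y) :
    g.SameCycle (r x) (r y) := by
  obtain ⟨i, rfl⟩ := hxy.exists_nat_pow_eq
  clear hxy
  induction i with
  | zero => exact Equiv.Perm.SameCycle.refl _ _
  | succ i ih =>
    rw [pow_succ', Equiv.Perm.mul_apply]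
    exact ih.trans (h _)

/-- Two permutations have the same number of cycles when they are related by a retraction
compatible with their orbits. -/
theorem zPerm_eq_of_retract {n m : ℕ} {α : Equiv.Perm (Fin n)} {σ : Equiv.Perm (Fin m)}
    (f : Fin m → Fin n) (r : Fin n → Fin m) (hrf : ∀ x, r (f x) = x)
    (h1 : ∀ y, σ.SameCycle (r y) (r (α y))) (h2 : ∀ y, α.SameCycle y (f (r y)))
    (h3 : ∀ x, α.SameCycle (f x) (f (σ x))) : zPerm α = zPerm σ := by
  refine Nat.card_congr
    { toFun := Quotient.map r fun a b hab => sameCycle_of_map r h1 hab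
      invFun := Quotient.map f fun a b hab => sameCycle_of_map f h3 hab
      left_inv := ?_
      right_inv := ?_ }
  · rintro ⟨x⟩
    exact Quotient.sound (h2 x).symm
  · rintro ⟨x⟩
    exact congrArg (Quotient.mk _) (hrf x)

theorem val_finRotate_pow {n : ℕ} (j : ℕ) (y : Fin (n + 1)) :
    ((finRotate (n + 1) ^ j) y).val = (y.val + j) % (n + 1) := by
  induction j with
  | zero => simp [Nat.mod_eq_of_lt y.isLt]
  | succ j ih =>
    rw [pow_succ', Equiv.Perm.mul_apply, finRotate_apply, Fin.val_add, ih]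
    simp only [Fin.val_one', Nat.add_mod_mod, Nat.mod_add_mod]
    rw [Nat.add_assoc]

theorem exists_finRotate_pow_eq {n : ℕ} (y z : Fin (n + 1)) :
    ∃ j < n + 1, (finRotate (n + 1) ^ j) y = z := by
  rcases le_total y z with h | h
  · refine ⟨z.val - y.val, by omega, Fin.ext ?_⟩
    rw [val_finRotate_pow, Nat.add_sub_cancel' h, Nat.mod_eq_of_lt z.isLt]
  · rcases eq_or_lt_of_le h with rfl | h'
    · exact ⟨0, by omega, rfl⟩
    refine ⟨z.val + (n + 1) - y.val, by have : z.val < y.val := h'; omega, Fin.ext ?_⟩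
    rw [val_finRotate_pow, Nat.add_sub_cancel' (by omega), Nat.add_mod_right,
      Nat.mod_eq_of_lt z.isLt]

theorem val_finRotate {n : ℕ} (y : Fin (n + 1)) :
    (finRotate (n + 1) y).val = if y.val = n then 0 else y.val + 1 := by
  split_ifs with h
  · rw [show y = Fin.last n from Fin.ext h, finRotate_last]; rfl
  · exact coe_finRotate_of_ne_last (by intro h'; exact h (by rw [h']; rfl))

/-- The index of the first point of the range of `s` found at or after `y`, cyclically. -/
def gapIndex {m n : ℕ} (s : Fin (m + 1) ↪o Fin (n + 1)) (y : Fin (n + 1)) : Fin (m + 1) :=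
  Fin.ofNat (m + 1) (Finset.univ.filter fun x => s x < y).card

section gapIndex

variable {m n : ℕ} (s : Fin (m + 1) ↪o Fin (n + 1))

theorem card_filter_apply_lt (x : Fin (m + 1)) :
    (Finset.univ.filter fun x' => s x' < s x).card = x.val := by
  simp only [s.lt_iff_lt]
  rw [← Fin.card_Iio]
  congr 1
  ext
  simp

theorem gapIndex_apply (x : Fin (m + 1)) : gapIndex s (s x) = x := by
  rw [gapIndex, card_filter_apply_lt]
  exact Fin.ext (Nat.mod_eq_of_lt x.isLt)

theorem card_filter_lt_finRotate (y : Fin (n + 1)) (hy : y.val ≠ n) :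
    (Finset.univ.filter fun x => s x < finRotate (n + 1) y) =
      Finset.univ.filter fun x => s x ≤ y := by
  ext x
  simp only [Finset.mem_filter, Finset.mem_univ, true_and, Fin.lt_def, Fin.le_def, val_finRotate,
    if_neg hy]
  omega

theorem gapIndex_finRotate_last (y : Fin (n + 1)) (hy : y.val = n) :
    gapIndex s (finRotate (n + 1) y) = 0 := by
  have h0 : finRotate (n + 1) y = 0 := Fin.ext (by rw [val_finRotate, if_pos hy]; rfl)
  simp [gapIndex, h0]

theorem gapIndex_finRotate_of_notMem (y : Fin (n + 1)) (hy : y ∉ Set.range s) :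
    gapIndex s (finRotate (n + 1) y) = gapIndex s y := by
  have hne : ∀ x, s x ≠ y := fun x hx => hy ⟨x, hx⟩
  by_cases h : y.val = n
  · rw [gapIndex_finRotate_last s y h, gapIndex]
    have : (Finset.univ.filter fun x => s x < y) = Finset.univ := by
      refine Finset.filter_true_of_mem fun x _ => lt_of_le_of_ne ?_ (hne x)
      rw [Fin.le_def, h]
      exact Nat.lt_succ_iff.1 (s x).isLt
    rw [this, Finset.card_univ, Fintype.card_fin]
    exact Fin.ext (Nat.mod_self _).symm
  · rw [gapIndex, gapIndex, card_filter_lt_finRotate s y h]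
    congr 2
    ext x
    simp [le_iff_lt_or_eq, hne x]

theorem gapIndex_finRotate_apply (x : Fin (m + 1)) :
    gapIndex s (finRotate (n + 1) (s x)) = finRotate (m + 1) x := by
  by_cases h : (s x).val = n
  · rw [gapIndex_finRotate_last s _ h]
    have hx : x = Fin.last m := by
      by_contra hx
      have := s.lt_iff_lt.2 (Fin.lt_last_iff_ne_last.2 hx)
      rw [Fin.lt_def] at this
      have := (s (Fin.last m)).isLt
      omega
    rw [hx, finRotate_last]
  · rw [gapIndex, card_filter_lt_finRotate s _ h]
    have : (Finset.univ.filter fun x' => s x' ≤ s x).card = x.val + 1 := by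
      simp only [s.le_iff_le]
      rw [← Fin.card_Iic]
      congr 1
      ext
      simp
    rw [this]
    apply Fin.ext
    rw [val_finRotate]
    split_ifs with h'
    · simp [Fin.ofNat, h']
    · simp only [Fin.ofNat]
      exact Nat.mod_eq_of_lt (by omega)

end gapIndex

/-- `β` acts on the range of `s` as `γ`, and trivially elsewhere. -/
structure IsExtensionAlong {m n : ℕ} (s : Fin m ↪o Fin n) (γ : Equiv.Perm (Fin m))
    (β : Equiv.Perm (Fin n)) : Prop where
  apply_apply : ∀ x, β (s x) = s (γ x)
  apply_of_notMem : ∀ y, y ∉ Set.range s → β y = y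

namespace IsExtensionAlong

section

variable {m n : ℕ} {s : Fin m ↪o Fin n} {γ : Equiv.Perm (Fin m)} {β : Equiv.Perm (Fin n)}

theorem inv (h : IsExtensionAlong s γ β) : IsExtensionAlong s γ⁻¹ β⁻¹ where
  apply_apply x := by
    rw [Equiv.Perm.inv_eq_iff_eq, h.apply_apply]
    simp
  apply_of_notMem y hy := by
    rw [Equiv.Perm.inv_eq_iff_eq, h.apply_of_notMem y hy]

theorem zPerm_add (h : IsExtensionAlong s γ β) : zPerm β + m = zPerm γ + n := by
  classical
  have hβ : β = γ.extendDomain (Equiv.ofInjective s s.injective) := by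
    ext1 y
    by_cases hy : y ∈ Set.range s
    · obtain ⟨x, rfl⟩ := hy
      have := Equiv.Perm.extendDomain_apply_image γ (Equiv.ofInjective s s.injective) x
      simp only [Equiv.ofInjective_apply] at this
      rw [this, h.apply_apply]
    · rw [h.apply_of_notMem y hy, Equiv.Perm.extendDomain_apply_not_subtype _ _ hy]
  have h1 := zPerm_eq_cycleType β
  have h2 := zPerm_eq_cycleType γ
  rw [hβ, Equiv.Perm.cycleType_extendDomain, ← hβ] at h1
  omega

theorem card_filter_lt (h : IsExtensionAlong s γ β) :
    (Finset.univ.filter fun y => y < β y).card = (Finset.univ.filter fun x => x < γ x).card := by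
  classical
  rw [← Finset.card_map s.toEmbedding]
  congr 1
  ext y
  simp only [Finset.mem_filter, Finset.mem_univ, true_and, Finset.mem_map]
  constructor
  · intro hy
    by_cases hy' : y ∈ Set.range s
    · obtain ⟨x, rfl⟩ := hy'
      rw [h.apply_apply, s.lt_iff_lt] at hy
      exact ⟨x, hy, rfl⟩
    · rw [h.apply_of_notMem y hy'] at hy
      exact absurd hy (lt_irrefl _)
  · rintro ⟨x, hx, rfl⟩
    change s x < β (s x)
    rwa [h.apply_apply, s.lt_iff_lt]

end

variable {m n : ℕ} {s : Fin (m + 1) ↪o Fin (n + 1)} {γ : Equiv.Perm (Fin (m + 1))}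
  {β : Equiv.Perm (Fin (n + 1))}

theorem rotate_apply_of_notMem (h : IsExtensionAlong s γ β) {y : Fin (n + 1)}
    (hy : y ∉ Set.range s) : (finRotate (n + 1) * β⁻¹) y = finRotate (n + 1) y := by
  rw [Equiv.Perm.mul_apply, h.inv.apply_of_notMem y hy]

theorem gapIndex_rotate_apply (h : IsExtensionAlong s γ β) (x : Fin (m + 1)) :
    gapIndex s ((finRotate (n + 1) * β⁻¹) (s x)) = (finRotate (m + 1) * γ⁻¹) x := by
  rw [Equiv.Perm.mul_apply, h.inv.apply_apply, gapIndex_finRotate_apply, Equiv.Perm.mul_apply]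

theorem sameCycle_gapIndex (h : IsExtensionAlong s γ β) (y : Fin (n + 1)) :
    (finRotate (n + 1) * β⁻¹).SameCycle y (s (gapIndex s y)) := by
  obtain ⟨j, -, hj⟩ := exists_finRotate_pow_eq y (s 0)
  induction j generalizing y with
  | zero =>
    rw [pow_zero, Equiv.Perm.one_apply] at hj
    rw [hj, gapIndex_apply]
  | succ j ih =>
    by_cases hy : y ∈ Set.range s
    · obtain ⟨x, rfl⟩ := hy
      rw [gapIndex_apply]
    · have := ih (finRotate (n + 1) y) (by rwa [← Equiv.Perm.mul_apply, ← pow_succ])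
      rwa [gapIndex_finRotate_of_notMem s y hy, ← h.rotate_apply_of_notMem hy,
        Equiv.Perm.sameCycle_apply_left] at this

theorem zPerm_rotate (h : IsExtensionAlong s γ β) :
    zPerm (finRotate (n + 1) * β⁻¹) = zPerm (finRotate (m + 1) * γ⁻¹) := by
  refine zPerm_eq_of_retract s (gapIndex s) (gapIndex_apply s) ?_ h.sameCycle_gapIndex ?_
  · intro y
    by_cases hy : y ∈ Set.range s
    · obtain ⟨x, rfl⟩ := hy
      rw [h.gapIndex_rotate_apply, gapIndex_apply, Equiv.Perm.sameCycle_apply_right]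
    · rw [h.rotate_apply_of_notMem hy, gapIndex_finRotate_of_notMem s y hy]
  · intro x
    have := h.sameCycle_gapIndex ((finRotate (n + 1) * β⁻¹) (s x))
    rwa [h.gapIndex_rotate_apply, Equiv.Perm.sameCycle_apply_left] at this

theorem gapIndex_pow_eq (s : Fin (m + 1) ↪o Fin (n + 1)) (i : Fin (n + 1)) (p : ℕ)
    (hp : ∀ t < p, (finRotate (n + 1) ^ t) i ∉ Set.range s) :
    gapIndex s ((finRotate (n + 1) ^ p) i) = gapIndex s i := by
  induction p with
  | zero => rfl
  | succ p ih =>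
    rw [pow_succ', Equiv.Perm.mul_apply, gapIndex_finRotate_of_notMem s _ (hp p (by omega)),
      ih fun t ht => hp t (by omega)]

theorem isReducedPerm_iff (h : IsExtensionAlong s γ β) (hγ : ∀ x, γ x ≠ x) :
    IsReducedPerm (finRotate (n + 1) * β⁻¹) ↔ ∀ x, (finRotate (m + 1) * γ⁻¹) x ≠ x := by
  have hS : ∀ y, (finRotate (n + 1) * β⁻¹) y = finRotate (n + 1) y ↔ y ∉ Set.range s := by
    intro y
    refine ⟨?_, fun hy => h.rotate_apply_of_notMem hy⟩
    rintro hy ⟨x, rfl⟩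
    rw [Equiv.Perm.mul_apply, EmbeddingLike.apply_eq_iff_eq, h.inv.apply_apply,
      EmbeddingLike.apply_eq_iff_eq, Equiv.Perm.inv_eq_iff_eq] at hy
    exact hγ x hy.symm
  rw [IsReducedPerm, ← not_exists_not, not_iff_not]
  simp only [not_not]
  constructor
  · rintro ⟨i, p, hp, h1, h2⟩
    have hout : ∀ t < p, (finRotate (n + 1) ^ t) i ∉ Set.range s := by
      intro t ht
      rw [← hS, h1 t ht, pow_succ', Equiv.Perm.mul_apply]
    have hin : (finRotate (n + 1) ^ p) i ∈ Set.range s := by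
      by_contra hp'
      have hrot : (finRotate (n + 1) ^ (p + 1)) i = i := by
        rw [pow_succ', Equiv.Perm.mul_apply, ← (hS _).2 hp', h2]
      have hall : ∀ j, (finRotate (n + 1) ^ j) i ∉ Set.range s := by
        intro j
        have hper : (finRotate (n + 1) ^ (j % (p + 1))) i = (finRotate (n + 1) ^ j) i := by
          conv_rhs => rw [← Nat.mod_add_div j (p + 1), pow_add, Equiv.Perm.mul_apply, pow_mul]
          rw [Equiv.Perm.pow_apply_eq_self_of_apply_eq_self hrot]
        rw [← hper]
        have := Nat.mod_lt j (Nat.succ_pos p)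
        rcases Nat.lt_succ_iff_lt_or_eq.1 this with h' | h'
        · exact hout _ h'
        · rwa [h']
      obtain ⟨j, -, hj⟩ := exists_finRotate_pow_eq i (s 0)
      exact hall j ⟨0, hj.symm⟩
    obtain ⟨x, hx⟩ := hin
    have hg := gapIndex_pow_eq s i p hout
    rw [← hx, gapIndex_apply] at hg
    refine ⟨x, ?_⟩
    rw [← h.gapIndex_rotate_apply, hx, h2, hg]
  · rintro ⟨x, hx⟩
    classical
    set i := (finRotate (n + 1) * β⁻¹) (s x) with hi
    have hex : ∃ j, (finRotate (n + 1) ^ j) i ∈ Set.range s := by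
      obtain ⟨j, -, hj⟩ := exists_finRotate_pow_eq i (s 0)
      exact ⟨j, 0, hj.symm⟩
    have hout : ∀ t < Nat.find hex, (finRotate (n + 1) ^ t) i ∉ Set.range s :=
      fun t ht => Nat.find_min hex ht
    have hg := gapIndex_pow_eq s i _ hout
    obtain ⟨x', hx'⟩ := Nat.find_spec hex
    rw [← hx', gapIndex_apply, hi, h.gapIndex_rotate_apply, hx] at hg
    refine ⟨i, Nat.find hex, ?_, ?_, ?_⟩
    · obtain ⟨j, hjn, hj⟩ := exists_finRotate_pow_eq i (s 0)
      exact lt_of_le_of_lt (Nat.find_min' hex ⟨0, hj.symm⟩) hjn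
    · intro t ht
      rw [(hS _).2 (hout t ht), pow_succ', Equiv.Perm.mul_apply]
    · rw [← hx', hg]

end IsExtensionAlong

theorem card_filter_rotate_le {n : ℕ} (β : Equiv.Perm (Fin (n + 1))) :
    (Finset.univ.filter fun j => (finRotate (n + 1) * β⁻¹) j ≤ j).card =
      (Finset.univ.filter fun i => i < β i).card + 1 := by
  classical
  have h1 : (Finset.univ.filter fun j => (finRotate (n + 1) * β⁻¹) j ≤ j) =
      (insert (Fin.last n) (Finset.univ.filter fun i => i < β i)).map β.toEmbedding := by
    ext j
    obtain ⟨i, rfl⟩ := β.surjective j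
    rw [← Equiv.coe_toEmbedding β, Finset.mem_map' β.toEmbedding]
    simp only [Equiv.coe_toEmbedding, Finset.mem_filter, Finset.mem_univ, true_and,
      Finset.mem_insert]
    rw [Equiv.Perm.mul_apply, show β⁻¹ (β i) = i from β.symm_apply_apply i, Fin.le_def, val_finRotate, Fin.lt_def,
      Fin.ext_iff, Fin.val_last]
    split_ifs <;> omega
  rw [h1, Finset.card_map, Finset.card_insert_of_notMem]
  simp only [Finset.mem_filter, Finset.mem_univ, true_and, not_lt]
  exact Fin.le_last _

theorem zPerm_le_card_filter_lt {n : ℕ} {γ : Equiv.Perm (Fin n)} (hγ : ∀ x, γ x ≠ x) :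
    zPerm γ ≤ (Finset.univ.filter fun i => i < γ i).card := by
  have h := zPerm_add_backPointCount γ⁻¹
  rw [zPerm_inv] at h
  have h2 : (Finset.univ.filter fun i => γ⁻¹ i ≤ i) =
      (Finset.univ.filter fun i => i < γ i).map γ.toEmbedding := by
    ext j
    obtain ⟨i, rfl⟩ := γ.surjective j
    rw [← Equiv.coe_toEmbedding γ, Finset.mem_map' γ.toEmbedding]
    simp only [Equiv.coe_toEmbedding, Finset.mem_filter, Finset.mem_univ, true_and]
    rw [show γ⁻¹ (γ i) = i from γ.symm_apply_apply i]
    exact ⟨fun h => lt_of_le_of_ne h (hγ i).symm, le_of_lt⟩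
  rw [h2, Finset.card_map] at h
  omega

theorem sum_cycleType_of_forall_ne {n : ℕ} {σ : Equiv.Perm (Fin n)} (hσ : ∀ x, σ x ≠ x) :
    σ.cycleType.sum = n := by
  rw [Equiv.Perm.sum_cycleType, show σ.support = Finset.univ by ext; simp [hσ],
    Finset.card_univ, Fintype.card_fin]

theorem two_mul_zPerm_le {n : ℕ} {σ : Equiv.Perm (Fin n)} (hσ : ∀ x, σ x ≠ x) :
    2 * zPerm σ ≤ n := by
  have h1 := zPerm_eq_cycleType σ
  have h2 := sum_cycleType_of_forall_ne hσ
  have h3 := Multiset.card_nsmul_le_sum (s := σ.cycleType) (a := 2)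
    (fun x hx => Equiv.Perm.two_le_of_mem_cycleType hx)
  rw [smul_eq_mul] at h3
  omega

/-- The permutations left when all fixed points of `α⁻¹ * ζ` are removed, where `α` is a reduced
partition of genus one with `k` blocks. -/
structure IsCore {m : ℕ} (k : ℕ) (γ : Equiv.Perm (Fin m)) : Prop where
  apply_ne : ∀ x, γ x ≠ x
  rotate_apply_ne : ∀ x, (finRotate m * γ⁻¹) x ≠ x
  zPerm_rotate : zPerm (finRotate m * γ⁻¹) = k
  zPerm_add : zPerm γ + k + 1 = m
  card_lt : (Finset.univ.filter fun i => i < γ i).card + 1 = k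

theorem IsCore.eq_two_mul {m k : ℕ} {γ : Equiv.Perm (Fin m)} (h : IsCore k γ) : m = 2 * k := by
  have h1 := zPerm_le_card_filter_lt h.apply_ne
  have h2 := two_mul_zPerm_le h.rotate_apply_ne
  have h3 := h.zPerm_rotate
  have h4 := h.zPerm_add
  have h5 := h.card_lt
  omega

/-- `α` represents a reduced set partition of genus one with `k` blocks. -/
def IsReducedGenusOnePartition {n : ℕ} (k : ℕ) (α : Equiv.Perm (Fin n)) : Prop :=
  IsGenusOne α ∧ IsPartitionPerm α ∧ IsReducedPerm α ∧ zPerm α = k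

theorem isGenusOne_rotate_iff {n : ℕ} (β : Equiv.Perm (Fin n)) :
    IsGenusOne (finRotate n * β⁻¹) ↔ zPerm (finRotate n * β⁻¹) + zPerm β + 2 = n + 1 := by
  rw [IsGenusOne, mul_inv_rev, inv_inv, inv_mul_cancel_right]

theorem isPartitionPerm_rotate_iff {n : ℕ} (β : Equiv.Perm (Fin (n + 1))) :
    IsPartitionPerm (finRotate (n + 1) * β⁻¹) ↔
      (Finset.univ.filter fun i => i < β i).card + 1 = zPerm (finRotate (n + 1) * β⁻¹) := by
  rw [isPartitionPerm_iff, card_filter_rotate_le]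

theorem IsExtensionAlong.isReducedGenusOnePartition_iff {m n k : ℕ}
    {s : Fin (m + 1) ↪o Fin (n + 1)} {γ : Equiv.Perm (Fin (m + 1))}
    {β : Equiv.Perm (Fin (n + 1))} (h : IsExtensionAlong s γ β) (hγ : ∀ x, γ x ≠ x) :
    IsReducedGenusOnePartition k (finRotate (n + 1) * β⁻¹) ↔ IsCore k γ := by
  have hz := h.zPerm_add
  rw [IsReducedGenusOnePartition, isGenusOne_rotate_iff, isPartitionPerm_rotate_iff,
    h.isReducedPerm_iff hγ, h.card_filter_lt, h.zPerm_rotate]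
  constructor
  · rintro ⟨h1, h2, h3, h4⟩
    exact ⟨hγ, h3, h4, by omega, by omega⟩
  · rintro ⟨-, h3, h4, h5, h6⟩
    exact ⟨by omega, by omega, h3, h4⟩

theorem exists_isExtensionAlong {m n : ℕ} (s : Fin m ↪o Fin n) (γ : Equiv.Perm (Fin m)) :
    ∃ β, IsExtensionAlong s γ β := by
  classical
  refine ⟨γ.extendDomain (Equiv.ofInjective s s.injective), fun x => ?_, fun y hy => ?_⟩
  · have := Equiv.Perm.extendDomain_apply_image γ (Equiv.ofInjective s s.injective) x
    simpa only [Equiv.ofInjective_apply] using this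
  · exact Equiv.Perm.extendDomain_apply_not_subtype _ _ hy

theorem exists_isExtensionAlong_of_range {m n : ℕ} (s : Fin m ↪o Fin n)
    (β : Equiv.Perm (Fin n)) (hs : ∀ y, y ∈ Set.range s ↔ β y ≠ y) :
    ∃ γ, IsExtensionAlong s γ β := by
  have hx : ∀ x, ∃ x', s x' = β (s x) := by
    intro x
    have := (hs (s x)).1 ⟨x, rfl⟩
    exact (hs (β (s x))).2 fun h => this (β.injective h)
  choose g hg using hx
  have hinj : Function.Injective g := by
    intro a b hab
    have := hg a
    rw [hab, hg b] at this
    exact (s.injective (β.injective this)).symm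
  refine ⟨Equiv.ofBijective g (Finite.injective_iff_bijective.1 hinj), fun x => (hg x).symm,
    fun y hy => ?_⟩
  by_contra h
  exact hy ((hs y).2 h)

theorem IsExtensionAlong.unique {m n : ℕ} {s : Fin m ↪o Fin n} {γ : Equiv.Perm (Fin m)}
    {β β' : Equiv.Perm (Fin n)} (h : IsExtensionAlong s γ β) (h' : IsExtensionAlong s γ β') :
    β = β' := by
  ext1 y
  by_cases hy : y ∈ Set.range s
  · obtain ⟨x, rfl⟩ := hy
    rw [h.apply_apply, h'.apply_apply]
  · rw [h.apply_of_notMem y hy, h'.apply_of_notMem y hy]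

theorem IsExtensionAlong.mem_range_iff {m n : ℕ} {s : Fin m ↪o Fin n} {γ : Equiv.Perm (Fin m)}
    {β : Equiv.Perm (Fin n)} (h : IsExtensionAlong s γ β) (hγ : ∀ x, γ x ≠ x) (y : Fin n) :
    y ∈ Set.range s ↔ β y ≠ y := by
  constructor
  · rintro ⟨x, rfl⟩
    rw [h.apply_apply]
    exact fun h' => hγ x (s.injective h')
  · intro hy
    by_contra h'
    exact hy (h.apply_of_notMem y h')

theorem card_isReducedGenusOnePartition {n m k : ℕ} (hm : m + 1 = 2 * k) (hk : 2 ≤ k) :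
    Nat.card {α : Equiv.Perm (Fin (n + 1)) // IsReducedGenusOnePartition k α} =
      (n + 1).choose (m + 1) * Nat.card {γ : Equiv.Perm (Fin (m + 1)) // IsCore k γ} := by
  classical
  have hcard : Nat.card {S : Finset (Fin (n + 1)) // S.card = m + 1} = (n + 1).choose (m + 1) := by
    rw [Nat.card_eq_fintype_card, Fintype.card_finset_len, Fintype.card_fin]
  rw [← hcard, ← Nat.card_prod]
  symm
  choose e he using fun (S : {S : Finset (Fin (n + 1)) // S.card = m + 1})
    (γ : Equiv.Perm (Fin (m + 1))) => exists_isExtensionAlong (S.1.orderEmbOfFin S.2) γ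
  refine Nat.card_eq_of_bijective
    (fun p : {S : Finset (Fin (n + 1)) // S.card = m + 1} ×
        {γ : Equiv.Perm (Fin (m + 1)) // IsCore k γ} =>
      (⟨finRotate (n + 1) * (e p.1 p.2.1)⁻¹,
        ((he p.1 p.2.1).isReducedGenusOnePartition_iff p.2.2.apply_ne).2 p.2.2⟩ :
        {α : Equiv.Perm (Fin (n + 1)) // IsReducedGenusOnePartition k α})) ⟨?_, ?_⟩
  · rintro ⟨S, γ, hγ⟩ ⟨S', γ', hγ'⟩ heq
    have heq : e S γ = e S' γ' := by simpa using heq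
    have hS : S = S' := by
      apply Subtype.ext
      ext y
      have h1 := (he S γ).mem_range_iff hγ.apply_ne y
      have h2 := (he S' γ').mem_range_iff hγ'.apply_ne y
      rw [Finset.range_orderEmbOfFin, Finset.mem_coe] at h1 h2
      rw [h1, h2, heq]
    subst hS
    have : γ = γ' := by
      ext1 x
      apply (S.1.orderEmbOfFin S.2).injective
      rw [← (he S γ).apply_apply, ← (he S γ').apply_apply, heq]
    subst this
    rfl
  · rintro ⟨α, hα⟩
    obtain ⟨β, rfl⟩ : ∃ β, α = finRotate (n + 1) * β⁻¹ :=
      ⟨α⁻¹ * finRotate (n + 1), by rw [mul_inv_rev, inv_inv, mul_inv_cancel_left]⟩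
    set S : Finset (Fin (n + 1)) := Finset.univ.filter fun y => β y ≠ y with hSdef
    obtain h0 | ⟨m', hm'⟩ : S.card = 0 ∨ ∃ m', S.card = m' + 1 := by
      rcases Nat.eq_zero_or_pos S.card with h | h
      · exact Or.inl h
      · exact Or.inr ⟨S.card - 1, by omega⟩
    · exfalso
      have hfix : ∀ y, β y = y := by
        intro y
        by_contra hy
        have : y ∈ S := by simp [hSdef, hy]
        rw [Finset.card_eq_zero.1 h0] at this
        simp at this
      obtain ⟨-, h2, -, h4⟩ := hα
      rw [isPartitionPerm_rotate_iff, h4] at h2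
      simp [hfix] at h2
      omega
    · have hmem : ∀ y, y ∈ Set.range (S.orderEmbOfFin hm') ↔ β y ≠ y := by
        intro y
        rw [Finset.range_orderEmbOfFin, Finset.mem_coe]
        simp [hSdef]
      obtain ⟨γ, hγ⟩ := exists_isExtensionAlong_of_range (S.orderEmbOfFin hm') β hmem
      have hne : ∀ x, γ x ≠ x := by
        intro x hx
        refine (hmem (S.orderEmbOfFin hm' x)).1 ⟨x, rfl⟩ ?_
        rw [hγ.apply_apply, hx]
      have hcore := (hγ.isReducedGenusOnePartition_iff hne).1 hα
      obtain rfl : m' = m := by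
        have := hcore.eq_two_mul
        omega
      refine ⟨⟨⟨S, hm'⟩, γ, hcore⟩, ?_⟩
      apply Subtype.ext
      have := (he ⟨S, hm'⟩ γ).unique hγ
      simp only [this]

theorem forall_mem_cycleType_eq_two {n : ℕ} {σ : Equiv.Perm (Fin n)} (hσ : ∀ x, σ x ≠ x)
    (hz : 2 * zPerm σ = n) : ∀ c ∈ σ.cycleType, c = 2 := by
  intro c hc
  have h1 := zPerm_eq_cycleType σ
  have h2 := sum_cycleType_of_forall_ne hσ
  obtain ⟨t, ht⟩ := Multiset.exists_cons_of_mem hc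
  have h3 := Multiset.card_nsmul_le_sum (s := t) (a := 2)
    (fun x hx => Equiv.Perm.two_le_of_mem_cycleType (σ := σ) (ht ▸ Multiset.mem_cons_of_mem hx))
  have h4 := Equiv.Perm.two_le_of_mem_cycleType hc
  rw [smul_eq_mul] at h3
  rw [ht, Multiset.sum_cons] at h2
  rw [ht, Multiset.sum_cons, Multiset.card_cons] at h1
  omega

theorem apply_apply_of_two_mul_zPerm {n : ℕ} {σ : Equiv.Perm (Fin n)} (hσ : ∀ x, σ x ≠ x)
    (hz : 2 * zPerm σ = n) (x : Fin n) : σ (σ x) = x := by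
  have h : orderOf σ ∣ 2 := by
    rw [← Equiv.Perm.lcm_cycleType]
    exact Multiset.lcm_dvd.2 fun c hc => (forall_mem_cycleType_eq_two hσ hz c hc).dvd
  have h' : σ ^ 2 = 1 := orderOf_dvd_iff_pow_eq_one.1 h
  rw [← Equiv.Perm.mul_apply, ← pow_two, h', Equiv.Perm.one_apply]

theorem two_mul_zPerm_of_apply_apply {n : ℕ} {σ : Equiv.Perm (Fin n)} (hσ : ∀ x, σ x ≠ x)
    (hinv : ∀ x, σ (σ x) = x) : 2 * zPerm σ = n := by
  have h1 := zPerm_eq_cycleType σ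
  have h2 := sum_cycleType_of_forall_ne hσ
  have h : orderOf σ ∣ 2 := orderOf_dvd_of_pow_eq_one (by ext1 x; simp [pow_two, hinv])
  have h3 : ∀ c ∈ σ.cycleType, c = 2 := fun c hc => le_antisymm
    (Nat.le_of_dvd (by norm_num) ((Equiv.Perm.dvd_of_mem_cycleType hc).trans h))
    (Equiv.Perm.two_le_of_mem_cycleType hc)
  rw [Multiset.eq_replicate_card.2 h3, Multiset.sum_replicate, Multiset.card_replicate] at h1
  rw [Multiset.eq_replicate_card.2 h3, Multiset.sum_replicate] at h2
  rw [smul_eq_mul] at h1 h2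
  omega

theorem sameCycle_of_apply_apply {n : ℕ} {γ : Equiv.Perm (Fin n)} {x y : Fin n}
    (hx : γ (γ x) = x) (h : γ.SameCycle x y) : y = x ∨ y = γ x := by
  obtain ⟨i, rfl⟩ := h.exists_nat_pow_eq
  clear h
  induction i with
  | zero => exact Or.inl rfl
  | succ i ih =>
    rw [pow_succ', Equiv.Perm.mul_apply]
    rcases ih with h | h
    · rw [h]; exact Or.inr rfl
    · rw [h, hx]; exact Or.inl rfl

/-- Counting the cycles of length two and the longer ones separately. -/
theorem exists_card_cycles {n : ℕ} {γ : Equiv.Perm (Fin n)} (hγ : ∀ x, γ x ≠ x) :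
    ∃ a b, (Finset.univ.filter fun x => γ (γ x) ≠ x).card + 2 * a = n ∧ a + b = zPerm γ ∧
      3 * b ≤ (Finset.univ.filter fun x => γ (γ x) ≠ x).card ∧
      ((Finset.univ.filter fun x => γ (γ x) ≠ x).card ≠ 0 → b ≠ 0) := by
  classical
  set q : Fin n → Quotient (cycleSetoid γ) := Quotient.mk (cycleSetoid γ) with hq
  have hqq : ∀ x y, q x = q y ↔ γ.SameCycle x y := fun x y => Quotient.eq
  have hqγ : ∀ x, q (γ x) = q x := fun x => (hqq _ _).2
    (Equiv.Perm.sameCycle_apply_left.2 (Equiv.Perm.SameCycle.refl _ _))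
  set E := Finset.univ.filter fun x => γ (γ x) ≠ x with hE
  set F := Finset.univ.filter fun x => γ (γ x) = x with hF
  have hEF : E.card + F.card = n := by
    have := Finset.card_filter_add_card_filter_not (s := (Finset.univ : Finset (Fin n)))
      (fun x => γ (γ x) = x)
    rw [Finset.card_univ, Fintype.card_fin] at this
    exact (add_comm _ _).trans this
  have hF2 : ∀ x ∈ F, (F.filter fun y => q y = q x) = {x, γ x} := by
    intro x hx
    have hx : γ (γ x) = x := by simpa [hF] using hx
    ext y
    simp only [hF, Finset.mem_filter, Finset.mem_univ, true_and, Finset.mem_insert,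
      Finset.mem_singleton]
    constructor
    · rintro ⟨-, hy⟩
      exact sameCycle_of_apply_apply hx ((hqq _ _).1 hy.symm)
    · rintro (rfl | rfl)
      · exact ⟨hx, rfl⟩
      · exact ⟨by rw [hx], hqγ x⟩
  have hF2' : ∀ c ∈ F.image q, (F.filter fun y => q y = c).card = 2 := by
    intro c hc
    obtain ⟨x, hx, rfl⟩ := Finset.mem_image.1 hc
    rw [hF2 x hx, Finset.card_pair (hγ x).symm]
  have hE3 : ∀ c ∈ E.image q, 3 ≤ (E.filter fun y => q y = c).card := by
    intro c hc
    obtain ⟨x, hx, rfl⟩ := Finset.mem_image.1 hc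
    have hx : γ (γ x) ≠ x := by simpa [hE] using hx
    have hsub : ({x, γ x, γ (γ x)} : Finset (Fin n)) ⊆ E.filter fun y => q y = q x := by
      intro y hy
      simp only [Finset.mem_insert, Finset.mem_singleton] at hy
      simp only [hE, Finset.mem_filter, Finset.mem_univ, true_and]
      rcases hy with rfl | rfl | rfl
      · exact ⟨hx, rfl⟩
      · exact ⟨fun h => hx (γ.injective h), hqγ _⟩
      · exact ⟨fun h => hx (γ.injective (γ.injective h)), by rw [hqγ, hqγ]⟩
    refine le_trans (le_of_eq ?_) (Finset.card_le_card hsub)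
    rw [Finset.card_eq_three.2 ⟨x, γ x, γ (γ x), (hγ x).symm, hx.symm, (hγ _).symm, rfl⟩]
  have hdisj : Disjoint (F.image q) (E.image q) := by
    rw [Finset.disjoint_left]
    intro c hc hc'
    obtain ⟨x, hx, rfl⟩ := Finset.mem_image.1 hc
    obtain ⟨y, hy, hxy⟩ := Finset.mem_image.1 hc'
    have hx : γ (γ x) = x := by simpa [hF] using hx
    have hy : γ (γ y) ≠ y := by simpa [hE] using hy
    rcases sameCycle_of_apply_apply hx ((hqq _ _).1 hxy.symm) with rfl | rfl
    · exact hy hx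
    · exact hy (by rw [hx])
  have hunion : F.image q ∪ E.image q = Finset.univ := by
    refine Finset.eq_univ_of_forall ?_
    intro c
    obtain ⟨x, rfl⟩ := Quotient.exists_rep c
    rw [Finset.mem_union]
    by_cases hx : γ (γ x) = x
    · exact Or.inl (Finset.mem_image.2 ⟨x, by simpa [hF] using hx, rfl⟩)
    · exact Or.inr (Finset.mem_image.2 ⟨x, by simpa [hE] using hx, rfl⟩)
  refine ⟨(F.image q).card, (E.image q).card, ?_, ?_, ?_, ?_⟩
  · have := Finset.card_eq_sum_card_image q F
    rw [Finset.sum_congr rfl hF2', Finset.sum_const, smul_eq_mul] at this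
    omega
  · rw [← Finset.card_union_of_disjoint hdisj, hunion, zPerm, Nat.card_eq_fintype_card,
      Finset.card_univ]
  · exact Finset.mul_card_image_le_card E 3 hE3
  · intro h
    rw [Finset.card_ne_zero] at h ⊢
    exact h.image q

/-- Fixed point free involutions of a cyclic group without pairs of consecutive elements, such
that the pairs fall in at most three classes of parallel ones. -/
structure IsReducedPairing {N : ℕ} [NeZero N] (s : ZMod N → ZMod N) : Prop where
  apply_apply : ∀ x, s (s x) = x
  apply_ne : ∀ x, s x ≠ x
  apply_ne_succ : ∀ x, s x ≠ x + 1
  card_le : (Finset.univ.filter fun x => s (x + 1) ≠ s x - 1).card ≤ 6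

theorem isCore_iff {m k : ℕ} (hm : m + 1 = 2 * k) (γ : Equiv.Perm (Fin (m + 1))) :
    IsCore k γ ↔ @IsReducedPairing (m + 1) _ (⇑(finRotate (m + 1) * γ⁻¹)) := by
  obtain ⟨σ, hσ⟩ : ∃ σ, σ = finRotate (m + 1) * γ⁻¹ := ⟨_, rfl⟩
  have hrot : ∀ x, finRotate (m + 1) x = x + 1 := fun x => finRotate_apply x
  have hσγ : ∀ x, σ (γ x) = x + 1 := by
    intro x
    rw [hσ, Equiv.Perm.mul_apply, show γ⁻¹ (γ x) = x from γ.symm_apply_apply x, hrot]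
  have hpar : zPerm σ = k → (zPerm γ + k) % 2 = 1 := by
    intro hz
    have h1 : finRotate (m + 1) = σ * γ := by rw [hσ, inv_mul_cancel_right]
    have h2 := congrArg Equiv.Perm.sign h1
    rw [map_mul, sign_finRotate, sign_eq_zPerm, sign_eq_zPerm, ← pow_add, hz] at h2
    by_contra hodd
    have hm' : Odd (m + 1 - 1) := ⟨k - 1, by omega⟩
    have h3 : Even (m + 1 + k + (m + 1 + zPerm γ)) := by
      rw [Nat.even_iff]; omega
    rw [hm'.neg_one_pow, h3.neg_one_pow] at h2
    exact absurd h2 (by decide)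
  have hE : (∀ x, σ (σ x) = x) → (Finset.univ.filter fun x => γ (γ x) ≠ x) =
      Finset.univ.filter fun x => σ (x + 1) ≠ σ x - 1 := by
    intro hinv
    have hγσ : ∀ x, γ x = σ (x + 1) := fun x => by rw [← hσγ, hinv]
    ext x
    simp only [Finset.mem_filter, Finset.mem_univ, true_and, hγσ, not_iff_not]
    constructor
    · intro h
      have := congrArg σ h
      rw [hinv] at this
      rw [← this, add_sub_cancel_right]
    · intro h
      rw [h, sub_add_cancel, hinv]
  rw [← hσ]
  constructor
  · rintro ⟨h1, h2, h3, h4, h5⟩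
    rw [← hσ] at h2 h3
    have hinv := apply_apply_of_two_mul_zPerm h2 (by omega)
    refine ⟨hinv, h2, ?_, ?_⟩
    · intro x hx
      exact h1 x (σ.injective ((hσγ x).trans hx.symm))
    · obtain ⟨a, b, ha, hb, hab, -⟩ := exists_card_cycles h1
      rw [hE hinv] at ha hab
      change (Finset.univ.filter fun x : Fin (m + 1) => σ (x + 1) ≠ σ x - 1).card ≤ 6
      omega
  · rintro ⟨hinv, h2, h3, h4⟩
    change (Finset.univ.filter fun x : Fin (m + 1) => σ (x + 1) ≠ σ x - 1).card ≤ 6 at h4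
    have h1 : ∀ x, γ x ≠ x := by
      intro x hx
      apply h3 x
      have := hσγ x
      rw [hx] at this
      exact this
    have hz := two_mul_zPerm_of_apply_apply h2 hinv
    have hzk : zPerm σ = k := by omega
    refine ⟨h1, by rwa [← hσ], by rw [← hσ, hzk], ?_, ?_⟩
    · obtain ⟨a, b, ha, hb, hab, hb'⟩ := exists_card_cycles h1
      have hp := hpar hzk
      have hle := two_mul_zPerm_le h1
      rw [hE hinv] at ha hab hb'
      omega
    · rw [← hzk, hσ, ← isPartitionPerm_rotate_iff, ← hσ]
      rintro i ⟨hi, j, hj, hlt⟩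
      rcases sameCycle_of_apply_apply (hinv i) hj with rfl | rfl
      · exact absurd (hi.trans hlt) (lt_irrefl _)
      · exact absurd hlt (lt_irrefl _)

theorem card_isCore {m k : ℕ} (hm : m + 1 = 2 * k) :
    Nat.card {γ : Equiv.Perm (Fin (m + 1)) // IsCore k γ} =
      Nat.card {s : ZMod (m + 1) → ZMod (m + 1) // IsReducedPairing s} := by
  refine Nat.card_eq_of_bijective (fun γ => ⟨⇑(finRotate (m + 1) * γ.1⁻¹),
    (isCore_iff hm γ.1).1 γ.2⟩) ⟨?_, ?_⟩
  · rintro ⟨γ, hγ⟩ ⟨γ', hγ'⟩ h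
    have h : ⇑(finRotate (m + 1) * γ⁻¹) = ⇑(finRotate (m + 1) * γ'⁻¹) := congrArg Subtype.val h
    have := DFunLike.coe_injective h
    simpa using this
  · rintro ⟨s, hs⟩
    let σ : Equiv.Perm (Fin (m + 1)) := ⟨s, s, hs.apply_apply, hs.apply_apply⟩
    have hσ : finRotate (m + 1) * (σ⁻¹ * finRotate (m + 1))⁻¹ = σ := by
      rw [mul_inv_rev, inv_inv, mul_inv_cancel_left]
    refine ⟨⟨σ⁻¹ * finRotate (m + 1), (isCore_iff hm _).2 ?_⟩, ?_⟩
    · rw [hσ]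
      exact hs
    · apply Subtype.ext
      change ⇑(finRotate (m + 1) * (σ⁻¹ * finRotate (m + 1))⁻¹) = s
      rw [hσ]
      rfl

/-- The least `d : ℕ` such that `x + d ∈ T`. -/
noncomputable def stepsUp {k : ℕ} (T : Finset (ZMod k)) (x : ZMod k) : ℕ :=
  sInf {d : ℕ | x + d ∈ T}

/-- The least `d : ℕ` such that `x - 1 - d ∈ T`. -/
noncomputable def stepsDown {k : ℕ} (T : Finset (ZMod k)) (x : ZMod k) : ℕ :=
  sInf {d : ℕ | x - 1 - d ∈ T}

section steps

variable {k : ℕ} {T : Finset (ZMod k)}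

theorem add_intCast_notMem {x : ZMod k} {j : ℤ} (h1 : -(stepsDown T x : ℤ) ≤ j)
    (h2 : j < stepsUp T x) : x + (j : ZMod k) ∉ T := by
  intro h
  rcases le_or_gt 0 j with hj | hj
  · obtain ⟨d, rfl⟩ := Int.eq_ofNat_of_zero_le hj
    have : stepsUp T x ≤ d := Nat.sInf_le (by simpa using h)
    omega
  · obtain ⟨d, hd⟩ := Int.eq_ofNat_of_zero_le (show 0 ≤ -1 - j by omega)
    have hj' : j = -1 - d := by omega
    have : stepsDown T x ≤ d := by
      refine Nat.sInf_le ?_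
      rw [hj'] at h
      push_cast at h
      rw [Set.mem_ofPred_eq]
      convert h using 1
      ring
    omega

theorem stepsUp_eq {x : ZMod k} {a : ℕ} (h1 : x + a ∈ T) (h2 : ∀ j < a, x + (j : ℕ) ∉ T) :
    stepsUp T x = a := by
  refine le_antisymm (Nat.sInf_le h1) ?_
  by_contra h
  exact h2 _ (not_le.1 h) (Nat.sInf_mem (s := {d : ℕ | x + d ∈ T}) ⟨a, h1⟩)

theorem stepsDown_eq {x : ZMod k} {a : ℕ} (h1 : x - 1 - a ∈ T)
    (h2 : ∀ j < a, x - 1 - (j : ℕ) ∉ T) : stepsDown T x = a := by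
  refine le_antisymm (Nat.sInf_le h1) ?_
  by_contra h
  exact h2 _ (not_le.1 h) (Nat.sInf_mem (s := {d : ℕ | x - 1 - d ∈ T}) ⟨a, h1⟩)

theorem stepsUp_of_mem {x : ZMod k} (hx : x ∈ T) : stepsUp T x = 0 :=
  stepsUp_eq (by simpa using hx) (by simp)

theorem stepsDown_succ_of_mem {x : ZMod k} (hx : x ∈ T) : stepsDown T (x + 1) = 0 :=
  stepsDown_eq (by simpa using hx) (by simp)

variable [NeZero k]

theorem add_stepsUp_mem (hT : T.Nonempty) (x : ZMod k) : x + stepsUp T x ∈ T := by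
  obtain ⟨t, ht⟩ := hT
  exact Nat.sInf_mem (s := {d : ℕ | x + d ∈ T}) ⟨(t - x).val, by simpa using ht⟩

theorem sub_stepsDown_mem (hT : T.Nonempty) (x : ZMod k) : x - 1 - stepsDown T x ∈ T := by
  obtain ⟨t, ht⟩ := hT
  exact Nat.sInf_mem (s := {d : ℕ | x - 1 - d ∈ T}) ⟨(x - 1 - t).val, by simpa using ht⟩

theorem stepsUp_reflect (hT : T.Nonempty) (x : ZMod k) :
    stepsUp T (x + stepsUp T x - stepsDown T x) = stepsDown T x := by
  refine stepsUp_eq ?_ fun j hj => ?_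
  · rw [sub_add_cancel]
    exact add_stepsUp_mem hT x
  · have := add_intCast_notMem (T := T) (x := x)
      (j := (stepsUp T x : ℤ) - stepsDown T x + j) (by omega) (by omega)
    push_cast at this
    convert this using 2
    ring

theorem stepsDown_reflect (hT : T.Nonempty) (x : ZMod k) :
    stepsDown T (x + stepsUp T x - stepsDown T x) = stepsUp T x := by
  refine stepsDown_eq ?_ fun j hj => ?_
  · have := sub_stepsDown_mem hT x
    convert this using 1
    ring
  · have := add_intCast_notMem (T := T) (x := x)
      (j := (stepsUp T x : ℤ) - stepsDown T x - 1 - j) (by omega) (by omega)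
    push_cast at this
    convert this using 2
    ring

theorem stepsUp_add_stepsDown_le (hT : 2 ≤ T.card) (x : ZMod k) :
    stepsUp T x + stepsDown T x + 2 ≤ k := by
  by_contra h
  have hk := NeZero.pos k
  have : T ⊆ {x + (stepsUp T x : ZMod k)} := by
    intro t ht
    rw [Finset.mem_singleton]
    by_contra hne
    set v := (x + stepsUp T x - t).val with hv
    have hvk : v < k := ZMod.val_lt _
    have hv0 : v ≠ 0 := by
      rw [hv, Ne, ZMod.val_eq_zero, sub_eq_zero]
      exact fun h => hne h.symm
    refine add_intCast_notMem (T := T) (x := x) (j := (stepsUp T x : ℤ) - v) (by omega) (by omega) ?_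
    push_cast
    rw [hv, ZMod.natCast_zmod_val]
    convert ht using 1
    ring
  have := Finset.card_le_card this
  rw [Finset.card_singleton] at this
  omega

theorem stepsUp_succ_of_notMem (hT : T.Nonempty) {x : ZMod k} (hx : x ∉ T) :
    stepsUp T (x + 1) + 1 = stepsUp T x := by
  have h0 : stepsUp T x ≠ 0 := by
    intro h
    have := add_stepsUp_mem hT x
    rw [h, Nat.cast_zero, add_zero] at this
    exact hx this
  obtain ⟨a, ha⟩ := Nat.exists_eq_succ_of_ne_zero h0
  rw [ha, Nat.succ_eq_add_one, Nat.add_right_cancel_iff]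
  refine stepsUp_eq ?_ fun j hj => ?_
  · have := add_stepsUp_mem hT x
    rw [ha] at this
    convert this using 1
    push_cast
    ring
  · have := add_intCast_notMem (T := T) (x := x) (j := 1 + j) (by omega) (by omega)
    push_cast at this
    convert this using 2
    ring

theorem stepsDown_succ_of_notMem (hT : T.Nonempty) {x : ZMod k} (hx : x ∉ T) :
    stepsDown T (x + 1) = stepsDown T x + 1 := by
  refine stepsDown_eq ?_ fun j hj => ?_
  · have := sub_stepsDown_mem hT x
    convert this using 1
    push_cast
    ring
  · rcases Nat.eq_zero_or_pos j with rfl | hj0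
    · simpa using hx
    · have hup : stepsUp T x ≠ 0 := by
        intro h
        have := add_stepsUp_mem hT x
        rw [h, Nat.cast_zero, add_zero] at this
        exact hx this
      have := add_intCast_notMem (T := T) (x := x) (j := -j) (by omega) (by omega)
      push_cast at this
      convert this using 2
      ring

end steps

theorem castHom_eq_zero_iff {k N : ℕ} [NeZero k] [NeZero N] (hN : N = 2 * k) (x : ZMod N) :
    ZMod.castHom (Dvd.intro_left 2 hN.symm : k ∣ N) (ZMod k) x = 0 ↔ x = 0 ∨ x = k := by
  have hk := NeZero.pos k
  constructor
  · intro h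
    rw [← ZMod.natCast_zmod_val x, map_natCast, ZMod.natCast_eq_zero_iff] at h
    have hlt := ZMod.val_lt x
    obtain ⟨c, hc⟩ := h
    have hc2 : c < 2 := by
      by_contra hc2
      have := Nat.mul_le_mul_left k (not_lt.1 hc2)
      omega
    rw [← ZMod.natCast_zmod_val x, hc]
    interval_cases c <;> simp
  · rintro (rfl | rfl)
    · exact map_zero _
    · rw [map_natCast, ZMod.natCast_self]

theorem natCast_half_add_half {k N : ℕ} (hN : N = 2 * k) : (k : ZMod N) + k = 0 := by
  have : ((2 * k : ℕ) : ZMod N) = 0 := by rw [← hN, ZMod.natCast_self]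
  rw [← this]
  push_cast
  ring

theorem natCast_half_ne_zero {k N : ℕ} [NeZero k] (hN : N = 2 * k) : (k : ZMod N) ≠ 0 := by
  have hk := NeZero.pos k
  rw [Ne, ZMod.natCast_eq_zero_iff]
  intro h
  have := Nat.le_of_dvd hk h
  omega

theorem card_filter_castHom_mem {k N : ℕ} [NeZero k] [NeZero N] (hN : N = 2 * k)
    (T : Finset (ZMod k)) :
    (Finset.univ.filter fun x : ZMod N =>
      ZMod.castHom (Dvd.intro_left 2 hN.symm : k ∣ N) (ZMod k) x ∈ T).card = 2 * T.card := by
  set π := ZMod.castHom (Dvd.intro_left 2 hN.symm : k ∣ N) (ZMod k) with hπ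
  rw [Finset.card_eq_sum_card_fiberwise (f := π) (t := T) (by intro x hx; simpa using hx),
    Finset.sum_congr rfl (g := fun _ => 2), Finset.sum_const, smul_eq_mul, mul_comm]
  intro t ht
  obtain ⟨x, rfl⟩ := ZMod.castHom_surjective (Dvd.intro_left 2 hN.symm : k ∣ N) t
  rw [← hπ] at ht ⊢
  have : ((Finset.univ.filter fun x => π x ∈ T).filter fun y => π y = π x) = {x, x + k} := by
    ext y
    simp only [Finset.mem_filter, Finset.mem_univ, true_and, Finset.mem_insert,
      Finset.mem_singleton]
    have h1 : π y = π x ↔ y = x ∨ y = x + k := by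
      rw [← sub_eq_zero, ← map_sub, castHom_eq_zero_iff hN, sub_eq_zero, sub_eq_iff_eq_add']
    rw [h1]
    refine ⟨fun h => h.2, fun h => ⟨?_, h⟩⟩
    rwa [h1.2 h]
  rw [this, Finset.card_pair]
  intro h
  exact natCast_half_ne_zero hN (left_eq_add.1 h)

/-- The centrally symmetric pairing of `ZMod N` whose classes of parallel pairs are delimited by
the points lying above `T`. -/
noncomputable def symmetricPairing {k N : ℕ} (hN : N = 2 * k) (T : Finset (ZMod k)) (x : ZMod N) :
    ZMod N :=
  x + stepsUp T (ZMod.castHom (Dvd.intro_left 2 hN.symm : k ∣ N) (ZMod k) x) -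
    stepsDown T (ZMod.castHom (Dvd.intro_left 2 hN.symm : k ∣ N) (ZMod k) x) + k

theorem symmetricPairing_succ_ne_iff {k N : ℕ} [NeZero k] [NeZero N] (hN : N = 2 * k)
    {T : Finset (ZMod k)} (hT : 2 ≤ T.card) (x : ZMod N) :
    symmetricPairing hN T (x + 1) ≠ symmetricPairing hN T x - 1 ↔
      ZMod.castHom (Dvd.intro_left 2 hN.symm : k ∣ N) (ZMod k) x ∈ T := by
  have hne : T.Nonempty := Finset.card_pos.1 (by omega)
  rw [symmetricPairing, symmetricPairing, map_add, map_one]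
  set y := ZMod.castHom (Dvd.intro_left 2 hN.symm : k ∣ N) (ZMod k) x
  constructor
  · intro h
    by_contra hy
    apply h
    rw [stepsDown_succ_of_notMem hne hy, ← stepsUp_succ_of_notMem hne hy]
    push_cast
    ring
  · intro hy h
    rw [stepsDown_succ_of_mem hy, stepsUp_of_mem hy] at h
    have h1 := stepsUp_add_stepsDown_le hT y
    have h2 := stepsUp_add_stepsDown_le hT (y + 1)
    have h3 : ((stepsUp T (y + 1) + stepsDown T y + 2 : ℕ) : ZMod N) = 0 := by
      push_cast at h ⊢
      linear_combination h
    rw [ZMod.natCast_eq_zero_iff] at h3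
    have := Nat.le_of_dvd (by omega) h3
    omega

theorem isReducedPairing_symmetricPairing {k N : ℕ} [NeZero k] [NeZero N] (hN : N = 2 * k)
    {T : Finset (ZMod k)} (hT : 2 ≤ T.card) (hT' : T.card ≤ 3) :
    IsReducedPairing (symmetricPairing hN T) := by
  have hne : T.Nonempty := Finset.card_pos.1 (by omega)
  have hdiff : ∀ x : ZMod N, ∀ c : ℕ, c ≤ 1 → symmetricPairing hN T x ≠ x + c := by
    intro x c hc h
    rw [symmetricPairing] at h
    set y := ZMod.castHom (Dvd.intro_left 2 hN.symm : k ∣ N) (ZMod k) x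
    have h1 := stepsUp_add_stepsDown_le hT y
    have h2 : ((stepsUp T y + (k - stepsDown T y - c) : ℕ) : ZMod N) = 0 := by
      rw [Nat.cast_add, Nat.cast_sub (by omega), Nat.cast_sub (by omega)]
      linear_combination h
    rw [ZMod.natCast_eq_zero_iff] at h2
    have := Nat.le_of_dvd (by omega) h2
    omega
  refine ⟨fun x => ?_, fun x => ?_, fun x => ?_, ?_⟩
  · have h1 : ZMod.castHom (Dvd.intro_left 2 hN.symm : k ∣ N) (ZMod k) (symmetricPairing hN T x) =
        ZMod.castHom (Dvd.intro_left 2 hN.symm : k ∣ N) (ZMod k) x +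
        stepsUp T (ZMod.castHom (Dvd.intro_left 2 hN.symm : k ∣ N) (ZMod k) x) -
        stepsDown T (ZMod.castHom (Dvd.intro_left 2 hN.symm : k ∣ N) (ZMod k) x) := by
      rw [symmetricPairing, map_add, map_sub, map_add, map_natCast, map_natCast, map_natCast,
        ZMod.natCast_self, add_zero]
    rw [symmetricPairing, h1, stepsUp_reflect hne, stepsDown_reflect hne, symmetricPairing]
    linear_combination natCast_half_add_half hN
  · simpa using hdiff x 0 (by omega)
  · simpa using hdiff x 1 le_rfl
  · rw [Finset.filter_congr fun x _ => symmetricPairing_succ_ne_iff hN hT x,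
      card_filter_castHom_mem hN]
    omega

theorem nth_add_count_of_periodic {p : ℕ → Prop} [DecidablePred p] {N : ℕ}
    (hp : ∀ i, p (N + i) ↔ p i) (hinf : (Set.ofPred p).Infinite) (j : ℕ) :
    Nat.nth p (j + Nat.count p N) = Nat.nth p j + N := by
  have h1 : p (N + Nat.nth p j) := (hp _).2 (Nat.nth_mem_of_infinite hinf j)
  have h2 := Nat.nth_count h1
  rw [Nat.count_add] at h2
  simp only [hp] at h2
  rw [Nat.count_nth_of_infinite hinf] at h2
  rw [add_comm j, h2, add_comm]

/-- A nonempty set of residues can be listed in cyclic order. -/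
theorem exists_cyclic_enumeration {N : ℕ} [NeZero N] {E : Finset (ZMod N)} (hE : E.Nonempty) :
    ∃ (e : ZMod E.card → ZMod N) (l : ZMod E.card → ℕ), Function.Injective e ∧
      (∀ x, x ∈ E ↔ ∃ c, e c = x) ∧
      ∀ c, 0 < l c ∧ e c + l c = e (c + 1) ∧ ∀ d : ℕ, 0 < d → d < l c → e c + d ∉ E := by
  classical
  let p : ℕ → Prop := fun i => (i : ZMod N) ∈ E
  have hp : ∀ i, p (N + i) ↔ p i := by simp [p]
  have hp' : ∀ q i, p (N * q + i) ↔ p i := by simp [p]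
  obtain ⟨x₀, hx₀⟩ := hE
  have hN := NeZero.pos N
  have hinf : (Set.ofPred p).Infinite := by
    refine Set.infinite_of_not_bddAbove ?_
    rintro ⟨B, hB⟩
    have h1 : p (N * (B + 1) + x₀.val) := (hp' _ _).2 (by simpa [p] using hx₀)
    have h2 := hB h1
    have h3 := Nat.le_mul_of_pos_left (B + 1) hN
    omega
  obtain ⟨m, hm⟩ : ∃ m, m = Nat.count p N := ⟨_, rfl⟩
  have hshift : ∀ j, Nat.nth p (j + m) = Nat.nth p j + N := by
    rw [hm]
    exact nth_add_count_of_periodic hp hinf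
  have hm0 : 0 < m := by
    rw [hm, Nat.pos_iff_ne_zero]
    intro h
    exact Nat.count_iff_forall_not.1 h _ (ZMod.val_lt x₀) (by simpa [p] using hx₀)
  have : NeZero m := ⟨hm0.ne'⟩
  let e : ZMod m → ZMod N := fun c => (Nat.nth p c.val : ℕ)
  have hmod : ∀ q j, ((Nat.nth p (j + m * q) : ℕ) : ZMod N) = (Nat.nth p j : ℕ) := by
    intro q j
    induction q with
    | zero => rfl
    | succ q ih =>
      rw [Nat.mul_succ, ← add_assoc, hshift, Nat.cast_add, ih, ZMod.natCast_self, add_zero]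
  have he : ∀ j : ℕ, e j = (Nat.nth p j : ℕ) := by
    intro j
    simp only [e]
    rw [ZMod.val_natCast, ← hmod (j / m) (j % m), Nat.mod_add_div]
  have hinj : Function.Injective e := by
    intro a b hab
    have h1 : ∀ c : ZMod m, Nat.nth p c.val < N := fun c =>
      Nat.nth_lt_of_lt_count (hm ▸ ZMod.val_lt c)
    have h2 := congrArg ZMod.val hab
    rw [ZMod.val_cast_of_lt (h1 a), ZMod.val_cast_of_lt (h1 b)] at h2
    exact ZMod.val_injective m (Nat.nth_injective hinf h2)
  have hmem : ∀ x, x ∈ E ↔ ∃ c, e c = x := by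
    refine fun x => ⟨fun hx => ⟨(Nat.count p x.val : ℕ), ?_⟩, ?_⟩
    · rw [he, Nat.nth_count (by simpa [p] using hx), ZMod.natCast_zmod_val]
    · rintro ⟨c, rfl⟩
      exact Nat.nth_mem_of_infinite hinf c.val
  have hcard : m = E.card := by
    have : E = Finset.univ.image e := by
      ext x
      simp [hmem]
    rw [this, Finset.card_image_of_injective _ hinj, Finset.card_univ, ZMod.card]
  subst hcard
  have hlt : ∀ c : ZMod E.card, Nat.nth p c.val < Nat.nth p (c.val + 1) := fun c =>
    Nat.nth_strictMono hinf (Nat.lt_succ_self _)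
  refine ⟨e, fun c => Nat.nth p (c.val + 1) - Nat.nth p c.val, hinj, hmem, fun c => ⟨?_, ?_, ?_⟩⟩
  · exact Nat.sub_pos_of_lt (hlt c)
  · have h1 : e (c + 1) = (Nat.nth p (c.val + 1) : ℕ) := by
      rw [← he, Nat.cast_succ, ZMod.natCast_zmod_val]
    rw [h1, Nat.cast_sub (hlt c).le]
    simp [e]
  · intro d hd0 hd h
    replace hd : d < Nat.nth p (c.val + 1) - Nat.nth p c.val := hd
    have h1 : p (Nat.nth p c.val + d) := by
      simpa [p, e] using h
    have h2 := Nat.nth_count h1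
    have h3 : c.val < Nat.count p (Nat.nth p c.val + d) := by
      rw [← (Nat.nth_strictMono hinf).lt_iff_lt, h2]
      omega
    have h4 : Nat.count p (Nat.nth p c.val + d) < c.val + 1 := by
      rw [← (Nat.nth_strictMono hinf).lt_iff_lt, h2]
      omega
    omega

theorem two_dvd_of_involutive {m : ℕ} [NeZero m] {ρ : ZMod m → ZMod m}
    (h1 : ∀ c, ρ (ρ c) = c) (h2 : ∀ c, ρ c ≠ c) : 2 ∣ m := by
  by_contra h
  obtain ⟨c, hc⟩ := Equiv.Perm.exists_fixed_point_of_prime (p := 2) (n := 1)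
    (σ := (⟨ρ, ρ, h1, h1⟩ : Equiv.Perm (ZMod m))) (by rwa [ZMod.card])
    (Equiv.ext fun c => by simpa [sq] using h1 c)
  exact h2 c hc

theorem eq_add_three_of_involutive {ρ : ZMod 6 → ZMod 6}
    (h1 : ∀ c, ρ (ρ c) = c) (h2 : ∀ c, ρ c ≠ c) (h3 : ∀ c, ρ c ≠ c + 1)
    (h4 : ∀ c, ρ (c + 1) + 1 ≠ ρ c) (c : ZMod 6) : ρ c = c + 3 := by
  have inv : ∀ {i j}, ρ i = j → ρ j = i := fun h => by rw [← h, h1]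
  have cases : ∀ c, ρ c = c + 2 ∨ ρ c = c + 3 ∨ ρ c = c + 4 := by
    intro c
    have a1 := h2 c
    have a2 := h3 c
    have a3 : ρ c ≠ c - 1 := fun h => h3 (c - 1) (by rw [inv h, sub_add_cancel])
    revert a1 a2 a3
    generalize ρ c = a
    revert a c
    decide
  have h6 : (6 : ZMod 6) = 0 := rfl
  have not_two : ∀ c, ρ c ≠ c + 2 := by
    intro c h
    have h' := inv h
    have e4 : ρ (c + 4) = c + 1 := by
      rcases cases (c + 4) with e | e | e
      · have := (inv e).symm
        rw [show c + 4 + 2 = c by linear_combination h6, h] at this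
        exact absurd (show (2 : ZMod 6) = 0 by linear_combination this) (by decide)
      · rw [e]
        linear_combination h6
      · have := (inv e).symm
        rw [show c + 4 + 4 = c + 2 by linear_combination h6, h'] at this
        exact absurd (show (4 : ZMod 6) = 0 by linear_combination this) (by decide)
    have e5 : ρ (c + 5) = c + 3 := by
      rcases cases (c + 5) with e | e | e
      · have := (inv e).symm
        rw [show c + 5 + 2 = c + 1 by linear_combination h6, inv e4] at this
        exact absurd (show (1 : ZMod 6) = 0 by linear_combination this) (by decide)
      · have := (inv e).symm
        rw [show c + 5 + 3 = c + 2 by linear_combination h6, h'] at this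
        exact absurd (show (5 : ZMod 6) = 0 by linear_combination this) (by decide)
      · rw [e]
        linear_combination h6
    apply h4 (c + 2)
    rw [show c + 2 + 1 = c + 3 by ring, inv e5, h']
    linear_combination h6
  rcases cases c with h | h | h
  · exact absurd h (not_two c)
  · exact h
  · refine absurd ?_ (not_two (c + 4))
    rw [inv h]
    linear_combination -h6

theorem eq_add_half_of_involutive {m : ℕ} [NeZero m] (h6 : m ≤ 6) {ρ : ZMod m → ZMod m}
    (h1 : ∀ c, ρ (ρ c) = c) (h2 : ∀ c, ρ c ≠ c) (h3 : ∀ c, ρ c ≠ c + 1)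
    (h4 : ∀ c, ρ (c + 1) + 1 ≠ ρ c) :
    ∃ t : ℕ, (t = 2 ∨ t = 3) ∧ m = 2 * t ∧ ∀ c, ρ c = c + t := by
  have h0 := NeZero.pos m
  obtain ⟨t, rfl⟩ := two_dvd_of_involutive h1 h2
  obtain rfl | rfl | rfl : t = 1 ∨ t = 2 ∨ t = 3 := by omega
  · exfalso
    have a1 := h2 0
    have a2 := h3 0
    revert a1 a2
    generalize ρ 0 = a
    revert a
    decide
  · refine ⟨2, Or.inl rfl, rfl, fun c => ?_⟩
    have a1 := h2 c
    have a2 := h3 c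
    have a3 : ρ c ≠ c - 1 := fun h => h3 (c - 1) (by rw [← h, h1, h, sub_add_cancel])
    revert a1 a2 a3
    generalize ρ c = a
    revert a c
    decide
  · exact ⟨3, Or.inr rfl, rfl, eq_add_three_of_involutive h1 h2 h3 h4⟩

theorem eq_half_of_add_self {k N : ℕ} [NeZero N] (hN : N = 2 * k) {x : ZMod N} (h : x + x = 0)
    (hx : x ≠ 0) : x = k := by
  rw [← ZMod.natCast_zmod_val x, ← Nat.cast_add, ZMod.natCast_eq_zero_iff] at h
  obtain ⟨q, hq⟩ := h
  have h0 : x.val ≠ 0 := by rwa [Ne, ZMod.val_eq_zero]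
  have h1 := ZMod.val_lt x
  have h2 : 0 < q := by
    rw [Nat.pos_iff_ne_zero]
    rintro rfl
    omega
  have h3 : q < 2 := by
    by_contra h3
    have := Nat.mul_le_mul_left N (not_lt.1 h3)
    omega
  obtain rfl : q = 1 := by omega
  rw [← ZMod.natCast_zmod_val x, show x.val = k by omega]

section pairing

variable {N : ℕ} {s : ZMod N → ZMod N}

theorem apply_succ_apply_succ_ne (hs : ∀ x, s (s x) = x) {x : ZMod N}
    (hx : s (x + 1) ≠ s x - 1) : s (s (x + 1) + 1) ≠ s (s (x + 1)) - 1 := by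
  intro h
  rw [hs, add_sub_cancel_right] at h
  exact hx (eq_sub_of_add_eq (by rw [← hs (s (x + 1) + 1), h]))

theorem apply_pred_ne (hs : ∀ x, s (s x) = x) {x : ZMod N} (hx : s (x + 1) ≠ s x - 1) :
    s (s x - 1 + 1) ≠ s (s x - 1) - 1 := by
  intro h
  rw [sub_add_cancel, hs] at h
  apply hx
  rw [show x + 1 = s (s x - 1) by linear_combination h, hs]

theorem apply_succ_apply_succ_eq (hs : ∀ x, s (s x) = x) {x : ZMod N}
    (hx : s (x + 1) = s x - 1) : s (s (x + 1) + 1) = s (s (x + 1)) - 1 := by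
  rw [hs, hx, sub_add_cancel, hs, add_sub_cancel_right]

variable [NeZero N]

theorem IsReducedPairing.exists_succ_ne (hs : IsReducedPairing s) :
    ∃ x, s (x + 1) ≠ s x - 1 := by
  by_contra! h
  have h1 : ∀ n : ℕ, s n = s 0 - n := by
    intro n
    induction n with
    | zero => simp
    | succ n ih =>
      rw [Nat.cast_succ, h, ih]
      ring
  obtain ⟨d, hd⟩ := Nat.even_or_odd' (s 0).val
  have h2 := h1 d
  rw [← ZMod.natCast_zmod_val (s 0)] at h2
  rcases hd with hd | hd <;> rw [hd] at h2
  · refine hs.apply_ne d ?_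
    rw [h2]
    push_cast
    ring
  · refine hs.apply_ne_succ d ?_
    rw [h2]
    push_cast
    ring

/-- The breaks of a reduced pairing are centrally symmetric, and each class of parallel pairs joins
two opposite arcs. -/
theorem IsReducedPairing.breaks_symmetric {k : ℕ} [NeZero k] (hN : N = 2 * k) (hs : IsReducedPairing s)
    {E : Finset (ZMod N)} (hE : ∀ x, x ∈ E ↔ s (x + 1) ≠ s x - 1) :
    (E.card = 4 ∨ E.card = 6) ∧ (∀ x ∈ E, x + k ∈ E) ∧
      ∀ x ∈ E, s (x + 1) = x + 1 + stepsUp E (x + 1) + k := by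
  have hE' : ∀ x, x ∉ E ↔ s (x + 1) = s x - 1 := fun x => by rw [hE, not_not]
  have hne : E.Nonempty := by
    obtain ⟨x, hx⟩ := hs.exists_succ_ne
    exact ⟨x, (hE x).2 hx⟩
  have hcard : E.card ≤ 6 := by
    refine le_trans (Finset.card_le_card fun x hx => ?_) hs.card_le
    simpa using (hE x).1 hx
  have : NeZero E.card := ⟨hne.card_pos.ne'⟩
  obtain ⟨e, l, he, hmem, hl⟩ := exists_cyclic_enumeration hne
  have hle : ∀ c, e c + l c = e (c + 1) := fun c => (hl c).2.1
  have hl0 : ∀ c, 0 < l c := fun c => (hl c).1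
  have hl' : ∀ c (d : ℕ), 0 < d → d < l c → e c + d ∉ E := fun c => (hl c).2.2
  have heE : ∀ c, e c ∈ E := fun c => (hmem _).2 ⟨c, rfl⟩
  have hwalk : ∀ c (d : ℕ), d < l c → s (e c + 1 + d) = s (e c + 1) - d := by
    intro c d hd
    induction d with
    | zero => simp
    | succ d ih =>
      have := (hE' _).1 (hl' c (d + 1) d.succ_pos hd)
      rw [Nat.cast_succ] at this ⊢
      rw [show e c + 1 + (d + 1 : ZMod N) = e c + (d + 1) + 1 by ring, this,
        show e c + (d + 1 : ZMod N) = e c + 1 + d by ring, ih (by omega)]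
      ring
  have hend : ∀ c, s (e (c + 1)) = s (e c + 1) - l c + 1 := by
    intro c
    have h0 : 1 ≤ l c := hl0 c
    have := hwalk c (l c - 1) (Nat.sub_lt (hl0 c) one_pos)
    rw [Nat.cast_sub h0, Nat.cast_one, add_add_sub_cancel, hle] at this
    rw [this]
    ring
  have hex : ∀ c, ∃ r, s (e c + 1) = e (r + 1) ∧ l r = l c := by
    intro c
    obtain ⟨r', hr'⟩ := (hmem _).1 ((hE _).2 (apply_succ_apply_succ_ne hs.apply_apply
      ((hE _).1 (heE c))))
    obtain ⟨r, rfl⟩ : ∃ r, r' = r + 1 := ⟨r' - 1, by ring⟩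
    refine ⟨r, hr'.symm, ?_⟩
    rcases lt_trichotomy (l r) (l c) with h | h | h
    · exfalso
      have h1 := apply_succ_apply_succ_eq hs.apply_apply ((hE' _).1 (hl' c (l r) (hl0 r) h))
      rw [← hE', add_right_comm, hwalk c _ h, ← hr', ← hle, add_sub_cancel_right] at h1
      exact h1 (heE r)
    · exact h
    · exfalso
      have h1 := (hE _).2 (apply_pred_ne hs.apply_apply ((hE _).1 (heE (c + 1))))
      rw [hend, add_sub_cancel_right, ← hr', ← hle] at h1
      have h2 := hl' r (l r - l c) (by omega) (Nat.sub_lt (hl0 r) (hl0 c))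
      rw [Nat.cast_sub h.le] at h2
      apply h2
      convert h1 using 1
      ring
  choose ρ hρ hlρ using hex
  have hend' : ∀ c, s (e (c + 1)) = e (ρ c) + 1 := by
    intro c
    rw [hend, hρ, ← hle, hlρ]
    ring
  have h1 : ∀ c, ρ (ρ c) = c := by
    intro c
    have := hρ (ρ c)
    rw [← hend', hs.apply_apply] at this
    exact (add_right_cancel (he this)).symm
  have h2 : ∀ c, ρ c ≠ c := by
    intro c h
    have h0 := hl0 c
    have h3 := hle c
    have h4 := hρ c
    rw [h, ← h3] at h4
    obtain ⟨d, hd⟩ := Nat.even_or_odd' (l c - 1)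
    have h5 := hwalk c d (by omega)
    rcases hd with hd | hd
    · have h6 : l c = 2 * d + 1 := by omega
      refine hs.apply_ne (e c + 1 + d) ?_
      rw [h5, h4, h6]
      push_cast
      ring
    · have h6 : l c = 2 * d + 2 := by omega
      refine hs.apply_ne_succ (e c + 1 + d) ?_
      rw [h5, h4, h6]
      push_cast
      ring
  have h3 : ∀ c, ρ c ≠ c + 1 := by
    intro c h
    refine hs.apply_ne_succ (e (c + 1)) ?_
    rw [hend', h]
  have h4 : ∀ c, ρ (c + 1) + 1 ≠ ρ c := by
    intro c h
    refine (hE _).1 (heE (c + 1)) ?_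
    rw [hρ, hend', h, add_sub_cancel_right]
  obtain ⟨t, ht, htE, hρt⟩ := eq_add_half_of_involutive hcard h1 h2 h3 h4
  have htt := natCast_half_add_half htE
  have ht0 : (t : ZMod E.card) ≠ 0 := by
    have : NeZero t := ⟨by omega⟩
    exact natCast_half_ne_zero htE
  have hstep : ∀ c, e (c + 1 + t) - e (c + 1) = e (c + t) - e c := by
    intro c
    rw [← hle c, add_right_comm, ← hle (c + t), ← hρt c, hlρ]
    ring
  have hconst : ∀ c, e (c + t) - e c = e (0 + t) - e 0 := by
    intro c
    rw [← ZMod.natCast_zmod_val c]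
    induction c.val with
    | zero => simp
    | succ n ih => rw [Nat.cast_succ, hstep, ih]
  have hhalf : ∀ c, e (c + t) = e c + k := by
    intro c
    have h5 := (hconst (c + t)).trans (hconst c).symm
    rw [add_assoc, htt, add_zero] at h5
    have h6 : e (c + t) - e c ≠ 0 := by
      rw [sub_ne_zero, he.ne_iff]
      simpa using ht0
    have h7 : (e (c + t) - e c) + (e (c + t) - e c) = 0 := by
      linear_combination -h5
    rw [← eq_half_of_add_self hN h7 h6, add_sub_cancel]
  refine ⟨by omega, fun x hx => ?_, fun x hx => ?_⟩
  · obtain ⟨c, rfl⟩ := (hmem x).1 hx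
    rw [← hhalf]
    exact heE _
  · obtain ⟨c, rfl⟩ := (hmem x).1 hx
    have h0 : 1 ≤ l c := hl0 c
    have h5 : stepsUp E (e c + 1) = l c - 1 := by
      refine stepsUp_eq ?_ fun j hj => ?_
      · rw [Nat.cast_sub h0, Nat.cast_one, add_add_sub_cancel, hle]
        exact heE _
      · have := hl' c (j + 1) (by omega) (by omega)
        rw [Nat.cast_succ] at this
        convert this using 2
        ring
    rw [h5, hρ, hρt, add_right_comm, hhalf, ← hle, Nat.cast_sub h0]
    push_cast
    ring

/-- A reduced pairing is determined by its breaks. -/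
theorem IsReducedPairing.eq_of_succ_ne_iff {k : ℕ} [NeZero k] (hN : N = 2 * k)
    {s' : ZMod N → ZMod N} (hs : IsReducedPairing s) (hs' : IsReducedPairing s')
    (h : ∀ x, s (x + 1) ≠ s x - 1 ↔ s' (x + 1) ≠ s' x - 1) : s = s' := by
  classical
  let E : Finset (ZMod N) := Finset.univ.filter fun x => s (x + 1) ≠ s x - 1
  have hE : ∀ x, x ∈ E ↔ s (x + 1) ≠ s x - 1 := by simp [E]
  have h1 := (hs.breaks_symmetric hN hE).2.2
  have h2 := (hs'.breaks_symmetric hN fun x => (hE x).trans (h x)).2.2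
  have hmem : ∀ x ∈ E, s (x + 1) = s' (x + 1) := fun x hx => by rw [h1 x hx, h2 x hx]
  obtain ⟨x₀, hx₀⟩ := hs.exists_succ_ne
  have key : ∀ n : ℕ, s (x₀ + 1 + n) = s' (x₀ + 1 + n) := by
    intro n
    induction n with
    | zero => simpa using hmem x₀ ((hE _).2 hx₀)
    | succ n ih =>
      rw [Nat.cast_succ, ← add_assoc]
      by_cases hx : x₀ + 1 + n ∈ E
      · exact hmem _ hx
      · rw [not_not.1 (mt (hE _).2 hx),
          not_not.1 (mt ((hE _).trans (h _)).2 hx), ih]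
  funext x
  have := key (x - (x₀ + 1)).val
  rwa [ZMod.natCast_zmod_val, add_sub_cancel] at this

end pairing

theorem card_isReducedPairing {N k : ℕ} [NeZero N] [NeZero k] (hN : N = 2 * k) :
    Nat.card {s : ZMod N → ZMod N // IsReducedPairing s} = (k + 1).choose 3 := by
  classical
  have key : Nat.card {T : Finset (ZMod k) // T.card = 2 ∨ T.card = 3} = (k + 1).choose 3 := by
    rw [Nat.card_eq_fintype_card, Fintype.card_subtype_or_disjoint, Fintype.card_finset_len,
      Fintype.card_finset_len, ZMod.card, Nat.choose_succ_succ]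
    rw [Pi.disjoint_iff]
    intro T
    rw [Prop.disjoint_iff]
    omega
  rw [← key]
  symm
  refine Nat.card_eq_of_bijective (fun T => ⟨symmetricPairing hN T.1,
    isReducedPairing_symmetricPairing hN (by have := T.2; omega) (by have := T.2; omega)⟩)
    ⟨?_, ?_⟩
  · rintro ⟨T, hT⟩ ⟨T', hT'⟩ h
    have h : symmetricPairing hN T = symmetricPairing hN T' := congrArg Subtype.val h
    apply Subtype.ext
    ext y
    obtain ⟨x, rfl⟩ := ZMod.castHom_surjective (Dvd.intro_left 2 hN.symm : k ∣ N) y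
    rw [← symmetricPairing_succ_ne_iff hN (T := T) (by omega), h,
      symmetricPairing_succ_ne_iff hN (T := T') (by omega)]
  · rintro ⟨s, hs⟩
    set π := ZMod.castHom (Dvd.intro_left 2 hN.symm : k ∣ N) (ZMod k) with hπ
    let E : Finset (ZMod N) := Finset.univ.filter fun x => s (x + 1) ≠ s x - 1
    have hE : ∀ x, x ∈ E ↔ s (x + 1) ≠ s x - 1 := by simp [E]
    obtain ⟨hcard, hsymm, -⟩ := hs.breaks_symmetric hN hE
    have hmem : ∀ x, π x ∈ E.image π ↔ x ∈ E := by
      refine fun x => ⟨fun hx => ?_, fun hx => Finset.mem_image_of_mem _ hx⟩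
      obtain ⟨y, hy, hyx⟩ := Finset.mem_image.1 hx
      rw [eq_comm, ← sub_eq_zero, ← map_sub, castHom_eq_zero_iff hN, sub_eq_zero,
        sub_eq_iff_eq_add'] at hyx
      rcases hyx with rfl | rfl
      · exact hy
      · exact hsymm y hy
    have hcard' := card_filter_castHom_mem hN (E.image π)
    rw [Finset.filter_congr fun x _ => hmem x, Finset.filter_mem_eq_inter, Finset.univ_inter]
      at hcard'
    have hT : (E.image π).card = 2 ∨ (E.image π).card = 3 := by omega
    refine ⟨⟨E.image π, hT⟩, Subtype.ext ?_⟩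
    refine IsReducedPairing.eq_of_succ_ne_iff hN
      (isReducedPairing_symmetricPairing hN (T := E.image π) (by omega) (by omega)) hs fun x => ?_
    rw [symmetricPairing_succ_ne_iff hN (T := E.image π) (by omega), ← hE]
    exact hmem x

theorem not_isGenusOne_zero (α : Equiv.Perm (Fin 0)) : ¬ IsGenusOne α := by
  intro h
  unfold IsGenusOne at h
  omega

/-- For `n ≥ 0` and `k ≥ 2`, the number of reduced genus-one set partitions of
`{1,…,n}` with exactly `k` blocks is `C(n,2k)·C(k+1,3)`. -/
theorem reduced_genus_one_partition_count (n k : ℕ) (hk : 2 ≤ k) :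
    Nat.card {α : Equiv.Perm (Fin n) //
        IsGenusOne α ∧ IsPartitionPerm α ∧ IsReducedPerm α ∧ zPerm α = k} =
      n.choose (2 * k) * (k + 1).choose 3 := by
  cases n with
  | zero =>
    rw [Nat.choose_eq_zero_of_lt (by omega), zero_mul, Nat.card_eq_zero]
    exact Or.inl ⟨fun α => not_isGenusOne_zero α.1 α.2.1⟩
  | succ n =>
    obtain ⟨m, hm⟩ : ∃ m, m + 1 = 2 * k := ⟨2 * k - 1, by omega⟩
    have : NeZero k := ⟨by omega⟩
    rw [← hm, ← card_isReducedPairing hm, ← card_isCore hm]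
    exact card_isReducedGenusOnePartition hm hk
end
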